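/- Let 1<p,q<∞, 1/r := 1/q − 1/p, α/d := 1/p − 1/q, μ ∈ A_p, λ ∈ A_q, and ν^{1/p+1/q'} := μ^{1/p} λ^{−1/q}. Let 𝒟 be a dyadic lattice and 𝒮 ⊆ 𝒟 a γ-sparse collection. For any b ∈ L^1_loc, the sparse operator 𝒜^⋆_{𝒮,b} f := Σ_{Q∈𝒮} ⟨|b − ⟨b⟩_Q| f⟩_Q 1_Q satisfies ‖𝒜^⋆_{𝒮,b}‖_{L^p(μ)→L^q(λ)} ≲ [μ]_{A_p}^{max(1,1/(p−1))} [λ]_{A_q}^{max(1/p'+1/q, 1/(q−1))} ‖b‖_{BMO_ν^α} if p ≤ q, and ‖𝒜^⋆_{𝒮,b}‖_{L^p(μ)→L^q(λ)} ≲ [μ]_{A_p}^{max(1,1/(p−1))} [λ]_{A_q}^{max(1,1/(q−1))} ‖M_ν^# b‖_{L^r(ν)} if p > q. -/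

import Mathlib

open MeasureTheory ENNReal Set Filter

noncomputable section

/-- `ℝ^d` with the Euclidean structure. -/
abbrev Rd (d : ℕ) := EuclideanSpace ℝ (Fin d)

variable {d : ℕ}

/-- An axis-parallel cube in `ℝ^d`, given by a corner and a (positive) side length. -/
structure Cube (d : ℕ) where
  corner : Fin d → ℝ
  side : ℝ
  side_pos : 0 < side

namespace Cube

/-- The set of points of the cube. -/
def carrier (Q : Cube d) : Set (Rd d) :=
  {x | ∀ i, Q.corner i ≤ x i ∧ x i < Q.corner i + Q.side}

/-- The volume `|Q| = ℓ(Q)^d` of the cube. -/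
def vol (Q : Cube d) : ℝ := Q.side ^ d

/-- The concentric cube with twice the side length. -/
def double (Q : Cube d) : Cube d :=
  ⟨fun i => Q.corner i - Q.side / 2, 2 * Q.side, by have := Q.side_pos; linarith⟩

end Cube

/-- `∫_Q f`. -/
def intC (Q : Cube d) (f : Rd d → ℝ) : ℝ := ∫ x in Q.carrier, f x

/-- `w(Q) = ∫_Q w`. -/
def wInt (Q : Cube d) (w : Rd d → ℝ) : ℝ := intC Q w

/-- The average `⟨f⟩_Q = |Q|⁻¹ ∫_Q f`. -/
def avg (Q : Cube d) (f : Rd d → ℝ) : ℝ := Q.vol⁻¹ * intC Q f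

/-- The mean oscillation `∫_Q |f - ⟨f⟩_Q|`. -/
def osc (Q : Cube d) (b : Rd d → ℝ) : ℝ := ∫ x in Q.carrier, |b x - avg Q b|

/-- The conjugate (dual) exponent `p' = p/(p-1)`. -/
def conj (p : ℝ) : ℝ := p / (p - 1)

/-- The weighted Lebesgue norm `‖f‖_{L^p(w)} = (∫ |f|^p w dx)^{1/p}`. -/
def wnorm (p : ℝ) (w : Rd d → ℝ) (f : Rd d → ℝ) : ℝ≥0∞ :=
  (∫⁻ x, ENNReal.ofReal (|f x| ^ p * w x)) ^ (1 / p)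

/-- The weighted Lebesgue norm of an `ℝ≥0∞`-valued function. -/
def wnormE (p : ℝ) (w : Rd d → ℝ) (f : Rd d → ℝ≥0∞) : ℝ≥0∞ :=
  (∫⁻ x, f x ^ p * ENNReal.ofReal (w x)) ^ (1 / p)

/-- A weight: a positive, measurable, locally integrable function. -/
def IsWeight (w : Rd d → ℝ) : Prop :=
  (∀ x, 0 < w x) ∧ Measurable w ∧ LocallyIntegrable w volume

/-- `b ∈ L¹_loc`. -/
def L1loc (b : Rd d → ℝ) : Prop := Measurable b ∧ LocallyIntegrable b volume

/-- Bounded measurable functions with compact support (the class `L^∞_c`). -/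
def BddCompactSupp (f : Rd d → ℝ) : Prop :=
  Measurable f ∧ HasCompactSupport f ∧ ∃ M : ℝ, ∀ x, |f x| ≤ M

/-- `‖U‖_{L^p(μ) → L^q(λ)} ≤ N`, tested on all measurable functions. -/
def OpBound (p q : ℝ) (μ lam : Rd d → ℝ) (U : (Rd d → ℝ) → Rd d → ℝ) (N : ℝ) : Prop :=
  ∀ f : Rd d → ℝ, Measurable f → wnorm q lam (U f) ≤ ENNReal.ofReal N * wnorm p μ f

/-- `‖U‖_{L^p(μ) → L^q(λ)} ≤ N`, tested on the dense class `L^∞_c`. -/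
def OpBoundCS (p q : ℝ) (μ lam : Rd d → ℝ) (U : (Rd d → ℝ) → Rd d → ℝ) (N : ℝ) : Prop :=
  ∀ f : Rd d → ℝ, BddCompactSupp f → wnorm q lam (U f) ≤ ENNReal.ofReal N * wnorm p μ f

/-- The weighted sharp maximal function, with cubes restricted to the family `𝒟`. -/
def sharpMaxOn (𝒟 : Set (Cube d)) (ν b : Rd d → ℝ) (x : Rd d) : ℝ≥0∞ :=
  ⨆ (Q : Cube d) (_ : Q ∈ 𝒟) (_ : x ∈ Q.carrier), ENNReal.ofReal (osc Q b / wInt Q ν)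

/-- `‖M^♯_ν b‖_{L^r(ν)}`. -/
def sharpNormOn (𝒟 : Set (Cube d)) (r : ℝ) (ν b : Rd d → ℝ) : ℝ≥0∞ :=
  wnormE r ν (sharpMaxOn 𝒟 ν b)

/-- `‖b‖_{BMO_ν^α} = sup_Q ν(Q)^{-e} ∫_Q |b - ⟨b⟩_Q|` with `e = 1 + α/d`. -/
def bmoNormOn (𝒟 : Set (Cube d)) (e : ℝ) (ν b : Rd d → ℝ) : ℝ≥0∞ :=
  ⨆ (Q : Cube d) (_ : Q ∈ 𝒟), ENNReal.ofReal (osc Q b / wInt Q ν ^ e)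

/-- The Muckenhoupt `A_p` characteristic over the family `𝒟`. -/
def ApCharOn (𝒟 : Set (Cube d)) (p : ℝ) (w : Rd d → ℝ) : ℝ≥0∞ :=
  ⨆ (Q : Cube d) (_ : Q ∈ 𝒟),
    ENNReal.ofReal (avg Q w * avg Q (fun x => w x ^ (-(conj p / p))) ^ (p / conj p))

/-- `w ∈ A_p` (over the family `𝒟`). -/
def IsApOn (𝒟 : Set (Cube d)) (p : ℝ) (w : Rd d → ℝ) : Prop :=
  IsWeight w ∧ LocallyIntegrable (fun x => w x ^ (-(conj p / p))) volume ∧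
    ApCharOn 𝒟 p w < ⊤

/-- The Fujii–Wilson `A_∞` characteristic over the family `𝒟`. -/
def AinfCharOn (𝒟 : Set (Cube d)) (w : Rd d → ℝ) : ℝ≥0∞ :=
  ⨆ (Q : Cube d) (_ : Q ∈ 𝒟),
    (∫⁻ x in Q.carrier,
        ⨆ (R : Cube d) (_ : R ∈ 𝒟) (_ : x ∈ R.carrier),
          ENNReal.ofReal ((∫ y in Q.carrier ∩ R.carrier, w y) / R.vol)) /
      ENNReal.ofReal (wInt Q w)

/-- The relative Fujii–Wilson characteristic `[w]_{A_∞(ν)}` over the family `𝒟`. -/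
def relAinfOn (𝒟 : Set (Cube d)) (w ν : Rd d → ℝ) : ℝ≥0∞ :=
  ⨆ (Q : Cube d) (_ : Q ∈ 𝒟),
    (∫⁻ x in Q.carrier,
        (⨆ (R : Cube d) (_ : R ∈ 𝒟) (_ : R.carrier ⊆ Q.carrier) (_ : x ∈ R.carrier),
          ENNReal.ofReal (wInt R w / wInt R ν)) * ENNReal.ofReal (ν x)) /
      ENNReal.ofReal (wInt Q w)

/-- The joint Bloom–Muckenhoupt characteristic `[μ',λ,ν]_{B_{p',q}}` (for upper bounds). -/
def BupperOn (𝒟 : Set (Cube d)) (p q : ℝ) (μ' lam ν : Rd d → ℝ) : ℝ≥0∞ :=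
  ⨆ (Q : Cube d) (_ : Q ∈ 𝒟),
    ENNReal.ofReal (avg Q μ' ^ (1 / conj p) * avg Q lam ^ (1 / q) *
      avg Q ν ^ (1 / p + 1 / conj q))

/-- The joint Bloom–Muckenhoupt characteristic `[μ,λ']_{B_{p,q'}(ν)}` (for lower bounds). -/
def BlowerOn (𝒟 : Set (Cube d)) (p q : ℝ) (μ lam' ν : Rd d → ℝ) : ℝ≥0∞ :=
  ⨆ (Q : Cube d) (_ : Q ∈ 𝒟),
    ENNReal.ofReal ((wInt Q μ / wInt Q ν) ^ (1 / p) * (wInt Q lam' / wInt Q ν) ^ (1 / conj q))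

/-- A doubling weight. -/
def DoublingWeight (w : Rd d → ℝ) : Prop :=
  ∃ C : ℝ, 0 < C ∧ ∀ Q : Cube d, wInt Q.double w ≤ C * wInt Q w

/-- A `(γ, ν)`-sparse collection of cubes (with respect to a weight `ν`). -/
def SparseFamily (γ : ℝ) (ν : Rd d → ℝ) (S : Set (Cube d)) : Prop :=
  ∃ E : Cube d → Set (Rd d),
    (∀ Q ∈ S, E Q ⊆ Q.carrier ∧ MeasurableSet (E Q) ∧ γ * wInt Q ν ≤ ∫ x in E Q, ν x) ∧
    S.Pairwise fun Q R => Disjoint (E Q) (E R)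

/-- A `(γ, ν)`-sparse collection of cubes (with respect to a measure `ν`). -/
def MSparseFamily (γ : ℝ) (ν : Measure (Rd d)) (S : Set (Cube d)) : Prop :=
  ∃ E : Cube d → Set (Rd d),
    (∀ Q ∈ S, E Q ⊆ Q.carrier ∧ ENNReal.ofReal γ * ν Q.carrier ≤ ν (E Q)) ∧
    S.Pairwise fun Q R => Disjoint (E Q) (E R)

/-- The weighted sharp maximal function with respect to a measure `ν`. -/
def mSharpMaxOn (𝒟 : Set (Cube d)) (ν : Measure (Rd d)) (b : Rd d → ℝ) (x : Rd d) : ℝ≥0∞ :=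
  ⨆ (Q : Cube d) (_ : Q ∈ 𝒟) (_ : x ∈ Q.carrier), ENNReal.ofReal (osc Q b) / ν Q.carrier

/-- The distance between two sets in `ℝ^d`. -/
def setDist (s t : Set (Rd d)) : ℝ := sInf {r | ∃ x ∈ s, ∃ y ∈ t, r = dist x y}

/-- Supports separated by a positive distance. -/
def SeparatedSupports (f g : Rd d → ℝ) : Prop :=
  ∃ ε : ℝ, 0 < ε ∧ ∀ x ∈ tsupport f, ∀ y ∈ tsupport g, ε ≤ dist x y

/-- A dyadic lattice on `ℝ^d`: for every `k ∈ ℤ` a partition of `ℝ^d` into cubes of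
side length `2^{-k}`, each refining the previous one. -/
structure DyadicLattice (d : ℕ) where
  layer : ℤ → Set (Cube d)
  side_eq : ∀ k : ℤ, ∀ Q ∈ layer k, Q.side = (2 : ℝ) ^ (-k)
  covers : ∀ k : ℤ, ∀ x : Rd d, ∃ Q ∈ layer k, x ∈ Q.carrier
  pairwiseDisjoint : ∀ k : ℤ, ∀ Q ∈ layer k, ∀ R ∈ layer k,
    Q ≠ R → Q.carrier ∩ R.carrier = ∅
  refines : ∀ k : ℤ, ∀ Q ∈ layer (k + 1), ∃ R ∈ layer k, Q.carrier ⊆ R.carrier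

/-- The cubes of a dyadic lattice. -/
def DyadicLattice.cubes (D : DyadicLattice d) : Set (Cube d) := {Q | ∃ k, Q ∈ D.layer k}

/-- `𝒟(Q₀)`: the dyadic cubes contained in `Q₀`. -/
def DyadicLattice.below (D : DyadicLattice d) (Q₀ : Cube d) : Set (Cube d) :=
  {Q ∈ D.cubes | Q.carrier ⊆ Q₀.carrier}

open Classical in
/-- The martingale difference `D_Q b = Σ_{R : R̂ = Q} ⟨b⟩_R 1_R − ⟨b⟩_Q 1_Q`. -/
def DyadicLattice.DQ (D : DyadicLattice d) (Q : Cube d) (b : Rd d → ℝ) (x : Rd d) : ℝ :=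
  if h : x ∈ Q.carrier ∧
      ∃ R, R ∈ D.cubes ∧ R.side = Q.side / 2 ∧ x ∈ R.carrier ∧ R.carrier ⊆ Q.carrier
  then avg h.2.choose b - avg Q b
  else 0

/-- Finite partial sums `Σ_{Q ∈ F} D_Q b ⟨f⟩_Q` of the paraproduct. -/
def parasum (D : DyadicLattice d) (b f : Rd d → ℝ) (F : Finset (Cube d)) (x : Rd d) : ℝ :=
  ∑ Q ∈ F, D.DQ Q b x * avg Q f

/-- Unconditional convergence of the paraproduct sum in `L¹_loc` to the function `S`. -/
def UncondConvL1loc (D : DyadicLattice d) (b f S : Rd d → ℝ) : Prop :=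
  ∀ K : Set (Rd d), IsCompact K → ∀ ε : ℝ, 0 < ε →
    ∃ F₀ : Finset (Cube d), ↑F₀ ⊆ D.cubes ∧
      ∀ F : Finset (Cube d), ↑F ⊆ D.cubes → F₀ ⊆ F →
        ∫ x in K, |parasum D b f F x - S x| < ε

/-- `P` is the dyadic paraproduct `Π_b` associated to `b` and the lattice `D`. -/
def IsParaproduct (D : DyadicLattice d) (b : Rd d → ℝ) (P : (Rd d → ℝ) → Rd d → ℝ) : Prop :=
  ∀ f : Rd d → ℝ, BddCompactSupp f → UncondConvL1loc D b f (P f)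

/-- Unconditional convergence of the paraproduct sum in `L^q(λ)` to the function `S`. -/
def UncondConvLq (D : DyadicLattice d) (q : ℝ) (lam : Rd d → ℝ) (b f S : Rd d → ℝ) : Prop :=
  ∀ ε : ℝ, 0 < ε →
    ∃ F₀ : Finset (Cube d), ↑F₀ ⊆ D.cubes ∧
      ∀ F : Finset (Cube d), ↑F ⊆ D.cubes → F₀ ⊆ F →
        wnorm q lam (fun x => parasum D b f F x - S x) < ENNReal.ofReal ε

/-- A modulus of continuity: increasing with `ω(t) → 0` as `t → 0`. -/
def ModulusOfContinuity (ω : ℝ → ℝ) : Prop :=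
  Monotone ω ∧ (∀ t, 0 ≤ ω t) ∧ Tendsto ω (nhdsWithin 0 (Ioi 0)) (nhds 0)

/-- The Dini condition `∫₀¹ ω(t)/t dt < ∞`. -/
def DiniCondition (ω : ℝ → ℝ) : Prop :=
  IntegrableOn (fun t => ω t / t) (Ioc (0 : ℝ) 1) volume

/-- An `ω`-Calderón–Zygmund kernel. -/
structure CZKernel (d : ℕ) (ω : ℝ → ℝ) where
  kernel : Rd d → Rd d → ℝ
  CK : ℝ
  CK_pos : 0 < CK
  size : ∀ x y : Rd d, x ≠ y → |kernel x y| ≤ CK / dist x y ^ d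
  smooth : ∀ x x' y : Rd d, x ≠ y → dist x x' ≤ dist x y / 2 →
    |kernel x y - kernel x' y| + |kernel y x - kernel y x'| ≤
      1 / dist x y ^ d * ω (dist x x' / dist x y)

/-- Non-degeneracy of a Calderón–Zygmund kernel. -/
def CZKernel.NonDegenerate {d : ℕ} {ω : ℝ → ℝ} (K : CZKernel d ω) : Prop :=
  ∃ c : ℝ, 0 < c ∧ ∀ (x : Rd d) (r : ℝ), 0 < r →
    ∃ y : Rd d, c * r ≤ dist x y ∧ c / r ^ d ≤ |K.kernel y x|

/-- An `ω`-Calderón–Zygmund operator: a linear operator, bounded on some `L^{p₀}`, with an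
`ω`-Calderón–Zygmund kernel representation off the support. -/
structure CZOperator (d : ℕ) (ω : ℝ → ℝ) extends CZKernel d ω where
  T : (Rd d → ℝ) → Rd d → ℝ
  map_add : ∀ f g : Rd d → ℝ, T (f + g) = T f + T g
  map_smul : ∀ (c : ℝ) (f : Rd d → ℝ), T (c • f) = c • T f
  measurable_map : ∀ f : Rd d → ℝ, Measurable f → Measurable (T f)
  p₀ : ℝ
  one_lt_p₀ : 1 < p₀
  N₀ : ℝ
  bounded : ∀ f : Rd d → ℝ, Measurable f →
    wnorm p₀ (fun _ => 1) (T f) ≤ ENNReal.ofReal N₀ * wnorm p₀ (fun _ => 1) f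
  kernel_repr : ∀ f : Rd d → ℝ, BddCompactSupp f → ∀ x ∉ tsupport f,
    T f x = ∫ y, kernel x y * f y

/-- The commutator `[b, T] f = b · Tf − T(b f)`. -/
def commutatorOp (b : Rd d → ℝ) (T : (Rd d → ℝ) → Rd d → ℝ) : (Rd d → ℝ) → Rd d → ℝ :=
  fun f x => b x * T f x - T (fun y => b y * f y) x

/-- The sparse operator `𝒜^⋆_{S,b} f = Σ_{Q∈S} ⟨|b − ⟨b⟩_Q| |f|⟩_Q 1_Q`. -/
def sparseOpStar (S : Set (Cube d)) (b f : Rd d → ℝ) (x : Rd d) : ℝ≥0∞ :=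
  ∑' Q : S, (Q : Cube d).carrier.indicator
      (fun _ => ENNReal.ofReal (avg (Q : Cube d) fun y => |b y - avg (Q : Cube d) b| * |f y|)) x

/-- The sparse operator `f ↦ Σ_{Q∈S} ⟨|b − ⟨b⟩_Q|⟩_Q ⟨|f|⟩_Q 1_Q`. -/
def sparseOp2 (S : Set (Cube d)) (b f : Rd d → ℝ) (x : Rd d) : ℝ≥0∞ :=
  ∑' Q : S, (Q : Cube d).carrier.indicator
      (fun _ => ENNReal.ofReal ((avg (Q : Cube d) fun y => |b y - avg (Q : Cube d) b|) *
        avg (Q : Cube d) fun y => |f y|)) x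

/-- The sparse operator `f ↦ Σ_{Q∈S} (|Q|^{-s} ∫_Q |f|^s)^{1/s} 1_Q`. -/
def sparseOpPow (S : Set (Cube d)) (s : ℝ) (f : Rd d → ℝ) (x : Rd d) : ℝ≥0∞ :=
  ∑' Q : S, (Q : Cube d).carrier.indicator
      (fun _ => ENNReal.ofReal (((Q : Cube d).vol ^ (-s) *
        intC (Q : Cube d) fun y => |f y| ^ s) ^ (1 / s))) x

section DyadicForms

open scoped Classical

variable {X : Type*}

/-- A finite family of sets any two of which are nested or disjoint. -/
def Laminar (T : Finset (Set X)) : Prop :=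
  ∀ P ∈ T, ∀ Q ∈ T, P ⊆ Q ∨ Q ⊆ P ∨ Disjoint P Q

/-- The Carleson packing condition. -/
def CarlesonFamily [MeasurableSpace X] (V : Measure X) (L : ℝ≥0∞) (T : Finset (Set X)) : Prop :=
  ∀ R ∈ T, ∑ Q ∈ T with Q ⊆ R, V Q ≤ L * V R

lemma Laminar.mono {T U : Finset (Set X)} (hT : Laminar T) (hU : U ⊆ T) : Laminar U :=
  fun P hP Q hQ => hT P (hU hP) Q (hU hQ)

lemma CarlesonFamily.mono [MeasurableSpace X] {V : Measure X} {L : ℝ≥0∞} {T U : Finset (Set X)}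
    (hT : CarlesonFamily V L T) (hU : U ⊆ T) : CarlesonFamily V L U := fun R hR =>
  (Finset.sum_le_sum_of_subset (Finset.filter_subset_filter _ hU)).trans (hT R (hU hR))

/-- The maximal elements of a finite family of sets. -/
def maxSets (U : Finset (Set X)) : Finset (Set X) := U.filter fun M => ∀ Q ∈ U, M ⊆ Q → Q = M

lemma maxSets_subset (U : Finset (Set X)) : maxSets U ⊆ U := Finset.filter_subset _ _

lemma exists_maxSets {U : Finset (Set X)} {Q : Set X} (hQ : Q ∈ U) : ∃ M ∈ maxSets U, Q ⊆ M := by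
  obtain ⟨M, hQM, hM⟩ := Finset.exists_le_maximal U hQ
  refine ⟨M, Finset.mem_filter.2 ⟨hM.1, fun R hR h => ?_⟩, hQM⟩
  exact (hM.2 hR h).antisymm h

lemma Laminar.maxSets_disjoint {U : Finset (Set X)} (hU : Laminar U) :
    (↑(maxSets U) : Set (Set X)).PairwiseDisjoint id := by
  intro P hP Q hQ hPQ
  have hP' := Finset.mem_filter.1 (Finset.mem_coe.1 hP)
  have hQ' := Finset.mem_filter.1 (Finset.mem_coe.1 hQ)
  rcases hU P hP'.1 Q hQ'.1 with h | h | h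
  · exact absurd (hP'.2 Q hQ'.1 h).symm hPQ
  · exact absurd (hQ'.2 P hP'.1 h) hPQ
  · exact h

lemma sum_le_sum_cover {ι κ : Type*} (U : Finset ι) (I : Finset κ) (r : ι → κ → Prop)
    (h : ∀ Q ∈ U, ∃ M ∈ I, r Q M) (f : ι → ℝ≥0∞) :
    ∑ Q ∈ U, f Q ≤ ∑ M ∈ I, ∑ Q ∈ U with r Q M, f Q := by
  simp_rw [Finset.sum_filter]
  rw [Finset.sum_comm]
  refine Finset.sum_le_sum fun Q hQ => ?_
  obtain ⟨M, hM, hr⟩ := h Q hQ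
  calc f Q = if r Q M then f Q else 0 := by simp [hr]
    _ ≤ _ := Finset.single_le_sum (f := fun M => if r Q M then f Q else 0)
      (fun _ _ => zero_le) hM

variable [MeasurableSpace X]

lemma sum_measure_le_of_disjoint {w : Measure X} {U : Finset (Set X)} {R : Set X}
    (hm : ∀ Q ∈ U, MeasurableSet Q) (hd : (↑U : Set (Set X)).PairwiseDisjoint id)
    (hR : ∀ Q ∈ U, Q ⊆ R) : ∑ Q ∈ U, w Q ≤ w R := by
  have := measure_biUnion_finset (μ := w) hd (f := id) hm
  simp only [id] at this
  rw [← this]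
  exact measure_mono (iUnion₂_subset hR)

lemma CarlesonFamily.weak_type {V w : Measure X} {L : ℝ≥0∞} {T : Finset (Set X)}
    (hC : CarlesonFamily V L T) (hT : Laminar T) (hm : ∀ Q ∈ T, MeasurableSet Q) (R : Set X)
    (t : ℝ≥0∞) : ∑ Q ∈ T with Q ⊆ R ∧ t * V Q ≤ w Q, t * V Q ≤ L * w R := by
  set U := T.filter fun Q => Q ⊆ R ∧ t * V Q ≤ w Q with hU
  have hUT : U ⊆ T := Finset.filter_subset _ _
  calc ∑ Q ∈ U, t * V Q
      ≤ ∑ M ∈ maxSets U, ∑ Q ∈ U with Q ⊆ M, t * V Q :=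
        sum_le_sum_cover _ _ _ (fun Q hQ => exists_maxSets hQ) _
    _ ≤ ∑ M ∈ maxSets U, L * w M := by
        refine Finset.sum_le_sum fun M hM => ?_
        have hM' := maxSets_subset U hM
        rw [← Finset.mul_sum]
        calc t * ∑ Q ∈ U with Q ⊆ M, V Q ≤ t * (L * V M) := by
              gcongr; exact hC.mono hUT M hM'
          _ = L * (t * V M) := by ring
          _ ≤ L * w M := by gcongr; exact (Finset.mem_filter.1 hM').2.2
    _ = L * ∑ M ∈ maxSets U, w M := by rw [Finset.mul_sum]
    _ ≤ L * w R := by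
        gcongr
        refine sum_measure_le_of_disjoint (fun Q hQ => hm Q (hUT (maxSets_subset U hQ)))
          (hT.mono hUT).maxSets_disjoint fun Q hQ => ?_
        exact (Finset.mem_filter.1 (maxSets_subset U hQ)).2.1

lemma exists_two_pow_le_lt {x : ℝ≥0∞} (h1 : 1 ≤ x) (hx : x ≠ ⊤) :
    ∃ i : ℕ, 2 ^ i ≤ x ∧ x ≤ 2 ^ (i + 1) := by
  have hex : ∃ n : ℕ, x < 2 ^ n := by
    obtain ⟨n, hn⟩ := ENNReal.exists_nat_gt hx
    refine ⟨n, hn.trans ?_⟩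
    exact_mod_cast n.lt_two_pow_self
  have h0 : Nat.find hex ≠ 0 := by
    intro h
    have := Nat.find_spec hex
    rw [h] at this
    simp only [pow_zero] at this
    exact absurd h1 (not_le.2 this)
  obtain ⟨i, hi⟩ := Nat.exists_eq_succ_of_ne_zero h0
  refine ⟨i, not_lt.1 (Nat.find_min hex (by omega)), ?_⟩
  have := Nat.find_spec hex
  rw [hi] at this
  exact this.le

/-- Kolmogorov-type packing: `∑_{Q ⊆ R} |Q|^{1-B} w(Q)^B ≲ |R|^{1-B} w(R)^B` for `B < 1`. -/
lemma CarlesonFamily.kolmogorov {B : ℝ} (hB0 : 0 ≤ B) (hB1 : B < 1) (L : ℝ≥0∞) (hL : L ≠ ⊤) :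
    ∃ C : ℝ≥0∞, C ≠ ⊤ ∧ ∀ (V w : Measure X) (T : Finset (Set X)), CarlesonFamily V L T →
      Laminar T → (∀ Q ∈ T, MeasurableSet Q) → (∀ Q ∈ T, V Q ≠ 0 ∧ V Q ≠ ⊤) →
      (∀ Q ∈ T, w Q ≠ 0 ∧ w Q ≠ ⊤) → ∀ R ∈ T,
      ∑ Q ∈ T with Q ⊆ R, V Q ^ (1 - B) * w Q ^ B ≤ C * (V R ^ (1 - B) * w R ^ B) := by
  set r : ℝ≥0∞ := (2 : ℝ≥0∞) ^ (B - 1) with hr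
  have hr1 : r < 1 := ENNReal.rpow_lt_one_of_one_lt_of_neg (by norm_num) (by linarith)
  refine ⟨L * (1 + 2 * (1 - r)⁻¹), ?_, ?_⟩
  · refine ENNReal.mul_ne_top hL (ENNReal.add_ne_top.2 ⟨by simp, ENNReal.mul_ne_top (by simp) ?_⟩)
    exact ENNReal.inv_ne_top.2 (tsub_pos_of_lt hr1).ne'
  intro V w T hC hT hm hV hw R hR
  obtain ⟨hVR0, hVRt⟩ := hV R hR
  obtain ⟨hwR0, hwRt⟩ := hw R hR
  set m : ℝ≥0∞ := w R / V R with hm'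
  have hm0 : m ≠ 0 := ENNReal.div_ne_zero.2 ⟨hwR0, hVRt⟩
  have hmt : m ≠ ⊤ := ENNReal.div_ne_top hwRt hVR0
  have hmV : m * V R = w R := ENNReal.div_mul_cancel hVR0 hVRt
  have hgoal : V R ^ (1 - B) * w R ^ B = m ^ B * V R := by
    rw [← hmV, ENNReal.mul_rpow_of_nonneg _ _ hB0, mul_left_comm,
      ← ENNReal.rpow_add _ _ hVR0 hVRt]
    simp
  have key : ∀ Q ∈ T, V Q ^ (1 - B) * w Q ^ B ≤ m ^ B * V Q +
      ∑' i : ℕ, if 2 ^ i * m * V Q ≤ w Q then (2 * m ^ B * r ^ i * (1 / m)) *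
        (2 ^ i * m * V Q) else 0 := by
    intro Q hQ
    obtain ⟨hVQ0, hVQt⟩ := hV Q hQ
    obtain ⟨hwQ0, hwQt⟩ := hw Q hQ
    have gen : ∀ y : ℝ≥0∞, w Q ≤ y * V Q → V Q ^ (1 - B) * w Q ^ B ≤ y ^ B * V Q := by
      intro y hy
      calc V Q ^ (1 - B) * w Q ^ B ≤ V Q ^ (1 - B) * (y * V Q) ^ B := by gcongr
        _ = y ^ B * V Q := by
          rw [ENNReal.mul_rpow_of_nonneg _ _ hB0, mul_left_comm, ← ENNReal.rpow_add _ _ hVQ0 hVQt]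
          simp
    by_cases h : w Q ≤ m * V Q
    · exact (gen m h).trans le_self_add
    · push Not at h
      have hmVQ0 : m * V Q ≠ 0 := mul_ne_zero hm0 hVQ0
      have hmVQt : m * V Q ≠ ⊤ := ENNReal.mul_ne_top hmt hVQt
      obtain ⟨i, hi1, hi2⟩ := exists_two_pow_le_lt (x := w Q / (m * V Q))
        ((ENNReal.le_div_iff_mul_le (Or.inl hmVQ0) (Or.inl hmVQt)).2 (by simpa using h.le))
        (ENNReal.div_ne_top hwQt hmVQ0)
      rw [ENNReal.le_div_iff_mul_le (Or.inl hmVQ0) (Or.inl hmVQt), ← mul_assoc] at hi1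
      rw [ENNReal.div_le_iff_le_mul (Or.inl hmVQ0) (Or.inl hmVQt), ← mul_assoc] at hi2
      refine le_trans ?_ (le_add_left (ENNReal.le_tsum i))
      rw [if_pos hi1]
      refine (gen _ hi2).trans ?_
      have e1 : ((2 : ℝ≥0∞) ^ (i + 1) * m) ^ B = (2 : ℝ≥0∞) ^ (((i : ℝ) + 1) * B) * m ^ B := by
        rw [ENNReal.mul_rpow_of_nonneg _ _ hB0, ← ENNReal.rpow_natCast, ← ENNReal.rpow_mul]
        push_cast; rfl
      have e2 : r ^ i * 2 ^ i = (2 : ℝ≥0∞) ^ ((i : ℝ) * B) := by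
        rw [hr, ← ENNReal.rpow_natCast, ← ENNReal.rpow_mul, ← ENNReal.rpow_natCast,
          ← ENNReal.rpow_add _ _ (by simp) (by simp)]
        congr 1; ring
      have e3 : (1 / m) * m = 1 := by rw [one_div]; exact ENNReal.inv_mul_cancel hm0 hmt
      calc ((2 : ℝ≥0∞) ^ (i + 1) * m) ^ B * V Q
          = (2 : ℝ≥0∞) ^ (((i : ℝ) + 1) * B) * m ^ B * V Q := by rw [e1]
        _ ≤ (2 * (2 : ℝ≥0∞) ^ ((i : ℝ) * B)) * m ^ B * V Q := by
          gcongr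
          rw [add_mul, one_mul, ENNReal.rpow_add _ _ (by simp) (by simp), mul_comm]
          gcongr
          calc (2 : ℝ≥0∞) ^ B ≤ 2 ^ (1 : ℝ) := by
                apply ENNReal.rpow_le_rpow_of_exponent_le (by norm_num) hB1.le
            _ = 2 := by simp
        _ = 2 * m ^ B * (r ^ i * 2 ^ i) * ((1 / m) * m) * V Q := by rw [e2, e3]; ring
        _ = _ := by ring
  calc ∑ Q ∈ T with Q ⊆ R, V Q ^ (1 - B) * w Q ^ B
      ≤ ∑ Q ∈ T with Q ⊆ R, (m ^ B * V Q +
      ∑' i : ℕ, if 2 ^ i * m * V Q ≤ w Q then (2 * m ^ B * r ^ i * (1 / m)) *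
        (2 ^ i * m * V Q) else 0) :=
        Finset.sum_le_sum fun Q hQ => key Q (Finset.mem_filter.1 hQ).1
    _ = m ^ B * ∑ Q ∈ T with Q ⊆ R, V Q + ∑' i : ℕ, (2 * m ^ B * r ^ i * (1 / m)) *
        ∑ Q ∈ T with Q ⊆ R ∧ 2 ^ i * m * V Q ≤ w Q, 2 ^ i * m * V Q := by
        rw [Finset.sum_add_distrib, Finset.mul_sum]
        congr 1
        rw [← Summable.tsum_finsetSum (fun _ _ => ENNReal.summable)]
        congr 1; ext i
        rw [← Finset.filter_filter, Finset.sum_filter (p := fun Q => 2 ^ i * m * V Q ≤ w Q),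
          Finset.mul_sum]
        refine Finset.sum_congr rfl fun Q _ => ?_
        split_ifs <;> simp
    _ ≤ m ^ B * (L * V R) + ∑' i : ℕ, (2 * m ^ B * r ^ i * (1 / m)) * (L * w R) := by
        gcongr with i
        · exact hC R hR
        · exact hC.weak_type hT hm R _
    _ = L * (1 + 2 * (1 - r)⁻¹) * (m ^ B * V R) := by
        rw [ENNReal.tsum_mul_right]
        have : ∀ i : ℕ, 2 * m ^ B * r ^ i * (1 / m) = (2 * m ^ B * (1 / m)) * r ^ i := by
          intro i; ring
        simp_rw [this]
        rw [ENNReal.tsum_mul_left, ENNReal.tsum_geometric, ← hmV]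
        have e3 : (1 / m) * m = 1 := by rw [one_div]; exact ENNReal.inv_mul_cancel hm0 hmt
        calc _ = m ^ B * (L * V R) + 2 * m ^ B * ((1 / m) * m) * (1 - r)⁻¹ * (L * V R) := by ring
          _ = _ := by rw [e3]; ring
    _ = _ := by rw [hgoal]

/-- Packing for products comparable to a power of the underlying measure. -/
lemma CarlesonFamily.packing {e B a q : ℝ} (he : 0 ≤ e) (hB0 : 0 ≤ B) (hB1 : B < 1) (ha : 0 ≤ a)
    (hqe : q * e = a + (1 - B)) (L : ℝ≥0∞) (hL : L ≠ ⊤) :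
    ∃ C : ℝ≥0∞, C ≠ ⊤ ∧ ∀ (V w : Measure X) (T : Finset (Set X)) (x : Set X → ℝ≥0∞) (c : ℝ≥0∞),
      CarlesonFamily V L T →
      Laminar T → (∀ Q ∈ T, MeasurableSet Q) → (∀ Q ∈ T, V Q ≠ 0 ∧ V Q ≠ ⊤) →
      (∀ Q ∈ T, w Q ≠ 0 ∧ w Q ≠ ⊤) → (∀ Q ∈ T, c * V Q ^ q ≤ x Q ∧ x Q ≤ 2 * (c * V Q ^ q)) →
      ∀ R ∈ T, ∑ Q ∈ T with Q ⊆ R, x Q ^ e * w Q ^ B ≤ C * (x R ^ e * w R ^ B) := by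
  obtain ⟨C, hC, H⟩ := CarlesonFamily.kolmogorov (X := X) hB0 hB1 L hL
  refine ⟨2 ^ e * C, ENNReal.mul_ne_top (by simp) hC, ?_⟩
  intro V w T x c hCar hT hm hV hw hx R hR
  have hpow : ∀ Q, (c * V Q ^ q) ^ e = c ^ e * V Q ^ a * V Q ^ (1 - B) := by
    intro Q
    rw [ENNReal.mul_rpow_of_nonneg _ _ he, ← ENNReal.rpow_mul, hqe,
      ENNReal.rpow_add_of_nonneg _ _ ha (by linarith), mul_assoc]
  calc ∑ Q ∈ T with Q ⊆ R, x Q ^ e * w Q ^ B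
      ≤ ∑ Q ∈ T with Q ⊆ R, (2 ^ e * c ^ e * V R ^ a) * (V Q ^ (1 - B) * w Q ^ B) := by
        refine Finset.sum_le_sum fun Q hQ => ?_
        obtain ⟨hQT, hQR⟩ := Finset.mem_filter.1 hQ
        calc x Q ^ e * w Q ^ B ≤ (2 * (c * V Q ^ q)) ^ e * w Q ^ B := by
              gcongr; exact (hx Q hQT).2
          _ = 2 ^ e * c ^ e * V Q ^ a * (V Q ^ (1 - B) * w Q ^ B) := by
              rw [ENNReal.mul_rpow_of_nonneg _ _ he, hpow]; ring
          _ ≤ _ := by gcongr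
    _ = (2 ^ e * c ^ e * V R ^ a) * ∑ Q ∈ T with Q ⊆ R, (V Q ^ (1 - B) * w Q ^ B) := by
        rw [Finset.mul_sum]
    _ ≤ (2 ^ e * c ^ e * V R ^ a) * (C * (V R ^ (1 - B) * w R ^ B)) := by
        gcongr; exact H V w T hCar hT hm hV hw R hR
    _ = 2 ^ e * C * ((c * V R ^ q) ^ e * w R ^ B) := by rw [hpow]; ring
    _ ≤ _ := by gcongr; exact (hx R hR).1

/-- Large subsets with bounded overlap inside the members of a Carleson family. -/
lemma CarlesonFamily.exists_subsets {V : Measure X} {L : ℝ≥0∞} {T : Finset (Set X)}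
    (hC : CarlesonFamily V L T) (hT : Laminar T) (hm : ∀ Q ∈ T, MeasurableSet Q)
    (hV : ∀ Q ∈ T, V Q ≠ 0 ∧ V Q ≠ ⊤) (n : ℕ) (hn : 2 * L ≤ n) :
    ∃ E : Set X → Set X, (∀ F ∈ T, E F ⊆ F ∧ MeasurableSet (E F) ∧ V F ≤ 2 * V (E F)) ∧
      ∀ x, ∑ F ∈ T, (E F).indicator (1 : X → ℝ≥0∞) x ≤ n := by
  let N : Set X → X → ℝ≥0∞ := fun F x => ∑ Q ∈ T with Q ⊆ F, Q.indicator 1 x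
  have hN : ∀ F, Measurable (N F) := fun F =>
    Finset.measurable_sum _ fun Q hQ => measurable_one.indicator (hm Q (Finset.mem_filter.1 hQ).1)
  refine ⟨fun F => F ∩ {x | N F x ≤ n}, fun F hF => ⟨inter_subset_left, ?_, ?_⟩, fun x => ?_⟩
  · exact (hm F hF).inter (measurableSet_le (hN F) measurable_const)
  · obtain ⟨h0, ht⟩ := hV F hF
    have hint : ∫⁻ x, N F x ∂V ≤ L * V F := by
      rw [lintegral_finsetSum _ fun Q hQ =>
        measurable_one.indicator (hm Q (Finset.mem_filter.1 hQ).1)]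
      refine le_of_eq_of_le (Finset.sum_congr rfl fun Q hQ => ?_) (hC F hF)
      exact lintegral_indicator_one (hm Q (Finset.mem_filter.1 hQ).1)
    have hbad : 2 * V {x | (n : ℝ≥0∞) < N F x} ≤ V F := by
      by_cases hL0 : L = 0
      · have := hC F hF
        rw [hL0, zero_mul, nonpos_iff_eq_zero, Finset.sum_eq_zero_iff] at this
        exact absurd (this F (by simp [hF])) h0
      have h1 : (n : ℝ≥0∞) * V {x | (n : ℝ≥0∞) < N F x} ≤ L * V F :=
        le_trans (by gcongr; exact fun hx => le_of_lt hx)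
          ((mul_meas_ge_le_lintegral (hN F) _).trans hint)
      have h2 : L * (2 * V {x | (n : ℝ≥0∞) < N F x}) ≤ L * V F := by
        refine le_trans ?_ h1
        rw [← mul_assoc, mul_comm L]; gcongr
      have hLt : L ≠ ⊤ := by
        rintro rfl
        simp at hn
      exact (ENNReal.mul_le_mul_iff_right hL0 hLt).1 h2
    have hsplit : V F ≤ V (F ∩ {x | N F x ≤ n}) + V {x | (n : ℝ≥0∞) < N F x} := by
      refine (measure_mono fun x hx => ?_).trans (measure_union_le _ _)
      by_cases h : N F x ≤ n
      · exact Or.inl ⟨hx, h⟩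
      · exact Or.inr (not_le.1 h)
    have h3 : V F + V F ≤ 2 * V (F ∩ {x | N F x ≤ n}) + V F := by
      calc V F + V F = 2 * V F := by ring
        _ ≤ 2 * (V (F ∩ {x | N F x ≤ n}) + V {x | (n : ℝ≥0∞) < N F x}) := by gcongr
        _ = 2 * V (F ∩ {x | N F x ≤ n}) + 2 * V {x | (n : ℝ≥0∞) < N F x} := by ring
        _ ≤ _ := by gcongr
    exact (ENNReal.add_le_add_iff_right ht).1 h3
  · set U := T.filter fun F => x ∈ F ∧ N F x ≤ n with hU
    have hsum : ∑ F ∈ T, (F ∩ {x | N F x ≤ n}).indicator (1 : X → ℝ≥0∞) x = (U.card : ℝ≥0∞) := by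
      rw [Finset.card_eq_sum_ones, hU, Finset.sum_filter]
      push_cast
      exact Finset.sum_congr rfl fun F _ => by simp [indicator_apply]
    rw [hsum]
    rcases U.eq_empty_or_nonempty with h | h
    · simp [h]
    obtain ⟨F, hF⟩ := Finset.exists_maximal h
    obtain ⟨hFT, hxF, hNF⟩ := Finset.mem_filter.1 hF.1
    refine le_trans ?_ hNF
    have : (U.card : ℝ≥0∞) = ∑ Q ∈ U, Q.indicator (1 : X → ℝ≥0∞) x := by
      rw [Finset.card_eq_sum_ones]
      push_cast
      exact Finset.sum_congr rfl fun Q hQ => by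
        simp [(Finset.mem_filter.1 hQ).2.1]
    rw [this]
    refine Finset.sum_le_sum_of_subset fun Q hQ => ?_
    obtain ⟨hQT, hxQ, hNQ⟩ := Finset.mem_filter.1 hQ
    refine Finset.mem_filter.2 ⟨hQT, ?_⟩
    rcases hT Q hQT F hFT with h | h | h
    · exact h
    · exact hF.2 hQ h
    · exact absurd hxF (Set.disjoint_left.1 h hxQ)

/-- If the subsets `E F` carry a fixed proportion of `w`, then `w` satisfies a packing condition. -/
lemma carleson_of_subsets {w : Measure X} {T : Finset (Set X)} {E : Set X → Set X} {n : ℕ}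
    {L : ℝ≥0∞} (hE : ∀ F ∈ T, E F ⊆ F ∧ MeasurableSet (E F))
    (hn : ∀ x, ∑ F ∈ T, (E F).indicator (1 : X → ℝ≥0∞) x ≤ n)
    (hw : ∀ F ∈ T, w F ≤ L * w (E F)) :
    CarlesonFamily w (L * n) T := by
  intro G hG
  calc ∑ F ∈ T with F ⊆ G, w F ≤ ∑ F ∈ T with F ⊆ G, L * w (E F) :=
        Finset.sum_le_sum fun F hF => hw F (Finset.mem_filter.1 hF).1
    _ = L * ∑ F ∈ T with F ⊆ G, w (E F) := by rw [Finset.mul_sum]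
    _ ≤ L * (n * w G) := by
        gcongr
        calc ∑ F ∈ T with F ⊆ G, w (E F)
            = ∑ F ∈ T with F ⊆ G, ∫⁻ x in G, (E F).indicator 1 x ∂w := by
              refine Finset.sum_congr rfl fun F hF => ?_
              obtain ⟨hFT, hFG⟩ := Finset.mem_filter.1 hF
              rw [lintegral_indicator_one (hE F hFT).2, Measure.restrict_apply (hE F hFT).2,
                inter_eq_left.2 ((hE F hFT).1.trans hFG)]
          _ = ∫⁻ x in G, ∑ F ∈ T with F ⊆ G, (E F).indicator 1 x ∂w := by
              rw [lintegral_finsetSum _ fun F hF => measurable_one.indicator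
                (hE F (Finset.mem_filter.1 hF).1).2]
          _ ≤ ∫⁻ x in G, n ∂w := by
              refine lintegral_mono fun x => le_trans ?_ (hn x)
              exact Finset.sum_le_sum_of_subset (Finset.filter_subset _ _)
          _ = n * w G := by simp
    _ = _ := by ring

end DyadicForms

section SparseForms

open scoped Classical

lemma sum_zpow_rpow_le {ι : Type*} {t : ℝ} (ht : 0 < t) (U : Finset ι) (l : ι → ℤ)
    (hl : Set.InjOn l U) (y : ℝ≥0∞) (hy : ∀ i ∈ U, (2 : ℝ≥0∞) ^ l i ≤ y) :
    ∑ i ∈ U, ((2 : ℝ≥0∞) ^ l i) ^ t ≤ (1 - 2 ^ (-t))⁻¹ * y ^ t := by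
  rcases U.eq_empty_or_nonempty with rfl | hU
  · simp
  obtain ⟨j, hj, hmax⟩ := Finset.exists_max_image U l hU
  set N : ι → ℕ := fun i => (l j - l i).toNat with hN
  have hNi : ∀ i ∈ U, ((N i : ℕ) : ℤ) = l j - l i := fun i hi =>
    Int.toNat_of_nonneg (by linarith [hmax i hi])
  have hinj : Set.InjOn N U := by
    intro a ha b hb hab
    apply hl ha hb
    have h1 := hNi a ha
    have h2 := hNi b hb
    rw [hab] at h1
    linarith
  calc ∑ i ∈ U, ((2 : ℝ≥0∞) ^ l i) ^ t
      = ∑ i ∈ U, ((2 : ℝ≥0∞) ^ l j) ^ t * ((2 : ℝ≥0∞) ^ (-t)) ^ (N i) := by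
        refine Finset.sum_congr rfl fun i hi => ?_
        rw [← ENNReal.rpow_intCast, ← ENNReal.rpow_intCast, ← ENNReal.rpow_natCast,
          ← ENNReal.rpow_mul, ← ENNReal.rpow_mul, ← ENNReal.rpow_mul,
          ← ENNReal.rpow_add _ _ (by simp) (by simp)]
        congr 1
        have : ((N i : ℕ) : ℝ) = (l j : ℝ) - l i := by exact_mod_cast hNi i hi
        rw [this]; ring
    _ = ((2 : ℝ≥0∞) ^ l j) ^ t * ∑ n ∈ U.image N, ((2 : ℝ≥0∞) ^ (-t)) ^ n := by
        rw [Finset.sum_image hinj, Finset.mul_sum]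
    _ ≤ y ^ t * ∑' n, ((2 : ℝ≥0∞) ^ (-t)) ^ n := by
        gcongr
        · exact hy j hj
        · exact ENNReal.sum_le_tsum _
    _ = _ := by rw [ENNReal.tsum_geometric, mul_comm]

lemma geometric_const_ne_top {t : ℝ} (ht : 0 < t) : (1 - (2 : ℝ≥0∞) ^ (-t))⁻¹ ≠ ⊤ :=
  ENNReal.inv_ne_top.2 (tsub_pos_of_lt
    (ENNReal.rpow_lt_one_of_one_lt_of_neg (by norm_num) (by linarith))).ne'

lemma sum_rpow_le_rpow_sum {ι : Type*} (U : Finset ι) (f : ι → ℝ≥0∞) {t : ℝ} (ht : 1 ≤ t) :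
    ∑ i ∈ U, f i ^ t ≤ (∑ i ∈ U, f i) ^ t := by
  induction U using Finset.induction_on with
  | empty => simp
  | insert a s ha ih =>
    rw [Finset.sum_insert ha, Finset.sum_insert ha]
    exact (add_le_add le_rfl ih).trans (ENNReal.add_rpow_le_rpow_add _ _ ht)

variable {X : Type*} [MeasurableSpace X]

/-- The average of `h` over `Q` with respect to the measure `m`. -/
def lavg (m : Measure X) (h : X → ℝ≥0∞) (Q : Set X) : ℝ≥0∞ := (∫⁻ x in Q, h x ∂m) / m Q

/-- The principal sets of a laminar family with respect to the averages of a function. -/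
lemma exists_principal {p : ℝ} (hp : 1 < p) : ∃ C : ℝ≥0∞, C ≠ ⊤ ∧
    ∀ (m : Measure X) (T : Finset (Set X)) (h : X → ℝ≥0∞), Laminar T →
      (∀ Q ∈ T, MeasurableSet Q) → Measurable h → (∀ Q ∈ T, m Q ≠ 0 ∧ m Q ≠ ⊤) →
      (∀ Q ∈ T, ∫⁻ x in Q, h x ∂m ≠ 0 ∧ ∫⁻ x in Q, h x ∂m ≠ ⊤) →
      ∃ F : Finset (Set X), F ⊆ T ∧
        (∀ Q ∈ T, ∃ P ∈ F, Q ⊆ P ∧ lavg m h Q ≤ 2 * lavg m h P) ∧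
        ∑ P ∈ F, lavg m h P ^ p * m P ≤ C * ∫⁻ x, h x ^ p ∂m := by
  set c : ℝ≥0∞ := (1 - (2 : ℝ≥0∞) ^ (-(p - 1)))⁻¹ with hc
  have hct : c ≠ ⊤ := geometric_const_ne_top (by linarith)
  refine ⟨2 * 2 ^ (p - 1) * (c * 2 ^ (p - 1)), ?_, ?_⟩
  · have : (2 : ℝ≥0∞) ^ (p - 1) ≠ ⊤ := ENNReal.rpow_ne_top_of_nonneg (by linarith) (by simp)
    exact ENNReal.mul_ne_top (ENNReal.mul_ne_top (by simp) this) (ENNReal.mul_ne_top hct this)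
  intro m T h hT hm hh hmT hhT
  have hlev : ∀ Q : Set X, ∃ n : ℤ, Q ∈ T →
      (2 : ℝ≥0∞) ^ n ≤ lavg m h Q ∧ lavg m h Q ≤ 2 * 2 ^ n := by
    intro Q
    by_cases hQ : Q ∈ T
    · have h0 : lavg m h Q ≠ 0 := ENNReal.div_ne_zero.2 ⟨(hhT Q hQ).1, (hmT Q hQ).2⟩
      have ht : lavg m h Q ≠ ⊤ := ENNReal.div_ne_top (hhT Q hQ).2 (hmT Q hQ).1
      obtain ⟨n, hn⟩ := ENNReal.exists_mem_Ico_zpow h0 ht (y := 2) (by norm_num) (by norm_num)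
      refine ⟨n, fun _ => ⟨hn.1, hn.2.le.trans_eq ?_⟩⟩
      rw [ENNReal.zpow_add (by norm_num) (by norm_num), zpow_one, mul_comm]
    · exact ⟨0, fun h => absurd h hQ⟩
  choose l hl using hlev
  set F := T.filter fun P => ∀ Q ∈ T, P ⊆ Q → l Q = l P → Q = P with hF
  have hFT : F ⊆ T := Finset.filter_subset _ _
  refine ⟨F, hFT, ?_, ?_⟩
  · intro Q hQ
    obtain ⟨P, hQP, hP⟩ := Finset.exists_le_maximal (T.filter fun P => l P = l Q)
      (Finset.mem_filter.2 ⟨hQ, rfl⟩)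
    obtain ⟨hPT, hlP⟩ := Finset.mem_filter.1 hP.1
    refine ⟨P, Finset.mem_filter.2 ⟨hPT, fun R hR hPR hlR => ?_⟩, hQP, ?_⟩
    · exact (hP.2 (Finset.mem_filter.2 ⟨hR, hlR.trans hlP⟩) hPR).antisymm hPR
    · calc lavg m h Q ≤ 2 * 2 ^ l Q := (hl Q hQ).2
        _ = 2 * 2 ^ l P := by rw [hlP]
        _ ≤ _ := by gcongr; exact (hl P hPT).1
  · have hone : ∀ P ∈ F, lavg m h P ^ p * m P ≤
        ∫⁻ x, P.indicator (fun x => if (2 : ℝ≥0∞) ^ l P ≤ 2 * h x then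
          2 * (2 * 2 ^ l P) ^ (p - 1) * h x else 0) x ∂m := by
      intro P hP
      have hPT := hFT hP
      obtain ⟨hm0, hmt⟩ := hmT P hPT
      have hav : lavg m h P * m P = ∫⁻ x in P, h x ∂m := ENNReal.div_mul_cancel hm0 hmt
      set S : Set X := {x | (2 : ℝ≥0∞) ^ l P ≤ 2 * h x} with hS
      have hSm : MeasurableSet S := measurableSet_le measurable_const (hh.const_mul 2)
      have h1 : ∫⁻ x in P, h x ∂m ≤ 2 * ∫⁻ x in P, S.indicator h x ∂m := by
        have e1 : 2 * ∫⁻ x in P, h x ∂m ≤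
            2 * ∫⁻ x in P, S.indicator h x ∂m + ∫⁻ x in P, h x ∂m := by
          calc 2 * ∫⁻ x in P, h x ∂m
              = ∫⁻ x in P, 2 * h x ∂m := (lintegral_const_mul _ hh).symm
            _ ≤ ∫⁻ x in P, (2 * S.indicator h x + 2 ^ l P) ∂m := by
                refine lintegral_mono fun x => ?_
                by_cases hx : x ∈ S
                · simp [hx]
                · simp only [hx, not_false_eq_true, indicator_of_notMem, mul_zero, zero_add]
                  exact (not_le.1 hx).le
            _ = 2 * ∫⁻ x in P, S.indicator h x ∂m + 2 ^ l P * m P := by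
                rw [lintegral_add_right _ measurable_const,
                  lintegral_const_mul _ (hh.indicator hSm)]
                simp
            _ ≤ _ := by
                rw [← hav]; gcongr; exact (hl P hPT).1
        rw [two_mul] at e1
        exact (ENNReal.add_le_add_iff_right (hhT P hPT).2).1 e1
      calc lavg m h P ^ p * m P = lavg m h P ^ (p - 1) * (lavg m h P * m P) := by
            rw [← mul_assoc]
            congr 1
            conv_rhs => rw [← ENNReal.rpow_one (lavg m h P), ← ENNReal.rpow_mul, one_mul]
            rw [← ENNReal.rpow_add_of_nonneg _ _ (by linarith) (by norm_num)]
            congr 1; ring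
        _ ≤ (2 * 2 ^ l P) ^ (p - 1) * (2 * ∫⁻ x in P, S.indicator h x ∂m) := by
            rw [hav]; gcongr
            exact (hl P hPT).2
        _ = ∫⁻ x in P, 2 * (2 * 2 ^ l P) ^ (p - 1) * S.indicator h x ∂m := by
            rw [lintegral_const_mul _ (hh.indicator hSm)]; ring
        _ = _ := by
            rw [← lintegral_indicator (hm P hPT)]
            refine lintegral_congr fun x => ?_
            simp only [indicator_apply]
            congr 1
            by_cases hx : x ∈ S
            · rw [if_pos hx, if_pos (show (2 : ℝ≥0∞) ^ l P ≤ 2 * h x from hx)]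
            · rw [if_neg hx, if_neg (show ¬ (2 : ℝ≥0∞) ^ l P ≤ 2 * h x from hx), mul_zero]
    have hmeas : ∀ P ∈ F, Measurable (P.indicator (fun x => if (2 : ℝ≥0∞) ^ l P ≤ 2 * h x then
          2 * (2 * 2 ^ l P) ^ (p - 1) * h x else 0)) := by
      intro P hP
      refine Measurable.indicator ?_ (hm P (hFT hP))
      exact Measurable.ite (measurableSet_le measurable_const (hh.const_mul 2))
        (hh.const_mul _) measurable_const
    calc ∑ P ∈ F, lavg m h P ^ p * m P
        ≤ ∑ P ∈ F, ∫⁻ x, P.indicator (fun x => if (2 : ℝ≥0∞) ^ l P ≤ 2 * h x then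
          2 * (2 * 2 ^ l P) ^ (p - 1) * h x else 0) x ∂m := Finset.sum_le_sum hone
      _ = ∫⁻ x, ∑ P ∈ F, P.indicator (fun x => if (2 : ℝ≥0∞) ^ l P ≤ 2 * h x then
          2 * (2 * 2 ^ l P) ^ (p - 1) * h x else 0) x ∂m :=
          (lintegral_finsetSum _ hmeas).symm
      _ ≤ ∫⁻ x, 2 * 2 ^ (p - 1) * (c * 2 ^ (p - 1)) * h x ^ p ∂m := by
          refine lintegral_mono fun x => ?_
          set U := F.filter fun P => x ∈ P ∧ (2 : ℝ≥0∞) ^ l P ≤ 2 * h x with hU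
          have hUinj : Set.InjOn l U := by
            intro P hP Q hQ hPQ
            obtain ⟨hPF, hxP, -⟩ := Finset.mem_filter.1 (Finset.mem_coe.1 hP)
            obtain ⟨hQF, hxQ, -⟩ := Finset.mem_filter.1 (Finset.mem_coe.1 hQ)
            rcases hT P (hFT hPF) Q (hFT hQF) with h | h | h
            · exact ((Finset.mem_filter.1 hPF).2 Q (hFT hQF) h hPQ.symm).symm
            · exact (Finset.mem_filter.1 hQF).2 P (hFT hPF) h hPQ
            · exact absurd hxQ (Set.disjoint_left.1 h hxP)
          have hgeo := sum_zpow_rpow_le (t := p - 1) (by linarith) U l hUinj (2 * h x)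
            fun P hP => (Finset.mem_filter.1 hP).2.2
          calc _ = ∑ P ∈ U, 2 * (2 * 2 ^ l P) ^ (p - 1) * h x := by
                conv_rhs => rw [hU, Finset.sum_filter]
                refine Finset.sum_congr rfl fun P _ => ?_
                simp only [indicator_apply]
                by_cases h1 : x ∈ P
                · by_cases h2 : (2 : ℝ≥0∞) ^ l P ≤ 2 * h x <;> simp [h1, h2]
                · simp [h1]
            _ = 2 * 2 ^ (p - 1) * (∑ P ∈ U, (2 ^ l P) ^ (p - 1)) * h x := by
                rw [Finset.mul_sum, Finset.sum_mul]
                refine Finset.sum_congr rfl fun P _ => ?_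
                rw [ENNReal.mul_rpow_of_nonneg _ _ (by linarith)]; ring
            _ ≤ 2 * 2 ^ (p - 1) * (c * (2 * h x) ^ (p - 1)) * h x := by gcongr
            _ = 2 * 2 ^ (p - 1) * (c * 2 ^ (p - 1)) * (h x ^ (p - 1) * h x) := by
                rw [ENNReal.mul_rpow_of_nonneg _ _ (by linarith)]; ring
            _ = _ := by
                congr 1
                conv_lhs => rw [← ENNReal.rpow_one (h x), ← ENNReal.rpow_mul, one_mul]
                rw [← ENNReal.rpow_add_of_nonneg _ _ (by linarith) (by norm_num)]
                congr 1; ring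
      _ = _ := lintegral_const_mul _ (hh.pow_const p)

end SparseForms

section SparseFormBounds

open scoped Classical

variable {X : Type*} [MeasurableSpace X]

lemma bilinear_sum_le_of_principal {p p' t : ℝ} (hpp : p.HolderConjugate p') (ht : 0 < t)
    (htp : t ≤ p') {T U F G : Finset (Set X)} (hU : U ⊆ T) (hF : F ⊆ T)
    (hG : G ⊆ T) {s w : Measure X} {a H K : Set X → ℝ≥0∞} {c L : ℝ≥0∞}
    (ha : ∀ R ∈ T, a R = s R ^ (1 / p) * w R ^ (1 / t))
    (hpack : ∀ R ∈ T, ∑ Q ∈ T with Q ⊆ R, a Q ≤ c * a R)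
    (hw : CarlesonFamily w L T)
    (hFG : ∀ Q ∈ U, ∃ P ∈ F, ∃ R ∈ G, Q ⊆ P ∧ P ⊆ R ∧ H Q ≤ 2 * H P ∧ K Q ≤ 2 * K R) :
    ∑ Q ∈ U, a Q * H Q * K Q ≤ 4 * c * L ^ (1 / p') * ((∑ P ∈ F, H P ^ p * s P) ^ (1 / p) *
      (∑ R ∈ G, K R ^ t * w R) ^ (1 / t)) := by
  have hp0 := hpp.pos
  have hp'0 := hpp.symm.pos
  obtain ⟨M, hM1, hM2⟩ : ∃ M : Set X → ℝ≥0∞, (∀ P, ∀ R ∈ G, P ⊆ R → K R ≤ M P) ∧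
      ∀ P, M P ^ p' ≤ ∑ R ∈ G with P ⊆ R, K R ^ p' := by
    refine ⟨fun P => (G.filter fun R => P ⊆ R).sup K, fun P R hR hPR =>
      Finset.le_sup (f := K) (Finset.mem_filter.2 ⟨hR, hPR⟩), fun P => ?_⟩
    rcases (G.filter fun R => P ⊆ R).eq_empty_or_nonempty with h | h
    · simp [h, hp'0]
    · obtain ⟨R, hR, hRe⟩ := Finset.exists_mem_eq_sup _ h K
      simp only [hRe]
      exact Finset.single_le_sum (f := fun R => K R ^ p') (fun _ _ => zero_le) hR
  have hstep : ∑ Q ∈ U, a Q * H Q * K Q ≤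
      ∑ P ∈ F, 4 * c * ((H P * s P ^ (1 / p)) * (M P * w P ^ (1 / t))) := by
    calc ∑ Q ∈ U, a Q * H Q * K Q
        ≤ ∑ P ∈ F, ∑ Q ∈ U with Q ⊆ P ∧ H Q ≤ 2 * H P ∧ K Q ≤ 2 * M P, a Q * H Q * K Q := by
          convert sum_le_sum_cover U F
            (fun Q P => Q ⊆ P ∧ H Q ≤ 2 * H P ∧ K Q ≤ 2 * M P) (fun Q hQ => ?_)
            (fun Q => a Q * H Q * K Q)
          obtain ⟨P, hP, R, hR, h1, h2, h3, h4⟩ := hFG Q hQ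
          refine ⟨P, hP, h1, h3, h4.trans ?_⟩
          gcongr
          exact hM1 P R hR h2
      _ ≤ ∑ P ∈ F, ∑ Q ∈ T with Q ⊆ P, (4 * (H P * M P)) * a Q := by
          refine Finset.sum_le_sum fun P _ => ?_
          refine (Finset.sum_le_sum (g := fun Q => (4 * (H P * M P)) * a Q) fun Q hQ => ?_).trans
            (Finset.sum_le_sum_of_subset fun Q hQ => ?_)
          · obtain ⟨-, -, h1, h2⟩ := Finset.mem_filter.1 hQ
            calc a Q * H Q * K Q ≤ a Q * (2 * H P) * (2 * M P) := by gcongr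
              _ = _ := by ring
          · obtain ⟨h0, h1, -⟩ := Finset.mem_filter.1 hQ
            exact Finset.mem_filter.2 ⟨hU h0, h1⟩
      _ ≤ ∑ P ∈ F, (4 * (H P * M P)) * (c * a P) := by
          refine Finset.sum_le_sum fun P hP => ?_
          rw [← Finset.mul_sum]
          gcongr
          exact hpack P (hF hP)
      _ = _ := by
          refine Finset.sum_congr rfl fun P hP => ?_
          rw [ha P (hF hP)]; ring
  have hhold := ENNReal.inner_le_Lp_mul_Lq F (fun P => H P * s P ^ (1 / p))
    (fun P => M P * w P ^ (1 / t)) hpp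
  have hfst : ∑ P ∈ F, (H P * s P ^ (1 / p)) ^ p = ∑ P ∈ F, H P ^ p * s P := by
    refine Finset.sum_congr rfl fun P _ => ?_
    rw [ENNReal.mul_rpow_of_nonneg _ _ hp0.le, ← ENNReal.rpow_mul, one_div,
      inv_mul_cancel₀ hp0.ne', ENNReal.rpow_one]
  have hpt : 1 ≤ p' / t := (one_le_div ht).2 htp
  have hsnd : ∑ P ∈ F, (M P * w P ^ (1 / t)) ^ p' ≤
      L * (∑ R ∈ G, K R ^ t * w R) ^ (p' / t) := by
    calc ∑ P ∈ F, (M P * w P ^ (1 / t)) ^ p'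
        ≤ ∑ P ∈ F, ∑ R ∈ G with P ⊆ R, K R ^ p' * w P ^ (p' / t) := by
          refine Finset.sum_le_sum fun P _ => ?_
          rw [ENNReal.mul_rpow_of_nonneg _ _ hp'0.le, ← ENNReal.rpow_mul, ← Finset.sum_mul]
          rw [show 1 / t * p' = p' / t by ring]
          gcongr
          exact hM2 P
      _ = ∑ R ∈ G, ∑ P ∈ F with P ⊆ R, K R ^ p' * w P ^ (p' / t) := by
          simp_rw [Finset.sum_filter]
          exact Finset.sum_comm
      _ ≤ ∑ R ∈ G, L * (K R ^ t * w R) ^ (p' / t) := by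
          refine Finset.sum_le_sum fun R hR => ?_
          have hsplit : ∀ x : ℝ≥0∞, x ^ (p' / t) = x ^ (p' / t - 1) * x := by
            intro x
            conv_rhs => rw [← ENNReal.rpow_one x, ← ENNReal.rpow_mul, one_mul]
            rw [← ENNReal.rpow_add_of_nonneg _ _ (by linarith) (by norm_num)]
            congr 1; ring
          calc ∑ P ∈ F with P ⊆ R, K R ^ p' * w P ^ (p' / t)
              ≤ ∑ P ∈ F with P ⊆ R, K R ^ p' * w R ^ (p' / t - 1) * w P := by
                refine Finset.sum_le_sum fun P hP => ?_
                rw [hsplit, ← mul_assoc]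
                gcongr
                exact (Finset.mem_filter.1 hP).2
            _ = K R ^ p' * w R ^ (p' / t - 1) * ∑ P ∈ F with P ⊆ R, w P := by
                rw [Finset.mul_sum]
            _ ≤ K R ^ p' * w R ^ (p' / t - 1) * (L * w R) := by
                gcongr
                exact (Finset.sum_le_sum_of_subset (Finset.filter_subset_filter _ hF)).trans
                  (hw R (hG hR))
            _ = L * (K R ^ p' * w R ^ (p' / t)) := by rw [hsplit (w R)]; ring
            _ = _ := by
                rw [ENNReal.mul_rpow_of_nonneg _ _ (by linarith), ← ENNReal.rpow_mul,
                  mul_div_cancel₀ _ ht.ne']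
      _ ≤ _ := by
          rw [← Finset.mul_sum]
          gcongr
          exact sum_rpow_le_rpow_sum _ _ hpt
  calc ∑ Q ∈ U, a Q * H Q * K Q
      ≤ 4 * c * ∑ P ∈ F, (H P * s P ^ (1 / p)) * (M P * w P ^ (1 / t)) := by
        rw [Finset.mul_sum]; exact hstep
    _ ≤ 4 * c * ((∑ P ∈ F, H P ^ p * s P) ^ (1 / p) *
        (L * (∑ R ∈ G, K R ^ t * w R) ^ (p' / t)) ^ (1 / p')) := by
        gcongr
        refine hhold.trans ?_
        rw [hfst]
        gcongr
    _ = _ := by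
        rw [ENNReal.mul_rpow_of_nonneg _ _ (by positivity), ← ENNReal.rpow_mul,
          show p' / t * (1 / p') = 1 / t by field_simp]
        ring

lemma packing_of_level {p q p' q' : ℝ} (hpp : p.HolderConjugate p') (hqq : q.HolderConjugate q')
    (hpq : p ≤ q) (L : ℝ≥0∞) (hL : L ≠ ⊤) :
    ∃ C : ℝ≥0∞, C ≠ ⊤ ∧ ∀ (V w s : Measure X) (T : Finset (Set X)) (c : ℝ≥0∞),
      CarlesonFamily V L T → Laminar T → (∀ Q ∈ T, MeasurableSet Q) →
      (∀ Q ∈ T, V Q ≠ 0 ∧ V Q ≠ ⊤) → (∀ Q ∈ T, w Q ≠ 0 ∧ w Q ≠ ⊤) →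
      (∀ Q ∈ T, s Q ≠ 0 ∧ s Q ≠ ⊤) →
      (∀ Q ∈ T, c * V Q ^ q ≤ w Q * s Q ^ (q - 1) ∧
        w Q * s Q ^ (q - 1) ≤ 2 * (c * V Q ^ q)) →
      ∀ R ∈ T, ∑ Q ∈ T with Q ⊆ R, s Q ^ (1 / p) * w Q ^ (1 / q') ≤
        C * (s R ^ (1 / p) * w R ^ (1 / q')) := by
  have hq1 := hqq.lt
  have hp1 := hpp.lt
  have hq0 := hqq.pos
  have hp0 := hpp.pos
  have hq'0 := hqq.symm.pos
  have hq'e : 1 / q' = 1 - 1 / q := by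
    have := hqq.inv_add_inv_eq_one
    rw [one_div, one_div]; linarith
  have hqi : 1 / q ≤ 1 / p := one_div_le_one_div_of_le hp0 hpq
  have hqlt : 1 / q < 1 := by rw [div_lt_one hq0]; exact hq1
  have hplt : 1 / p < 1 := by rw [div_lt_one hp0]; exact hp1
  have hqpos : 0 < 1 / q := by positivity
  have hppos : 0 < 1 / p := by positivity
  rcases le_total (1 / (p * (q - 1))) (1 / q') with h | h
  · set e := 1 / (p * (q - 1)) with he
    have he0 : 0 ≤ e := one_div_nonneg.2 (mul_nonneg hp0.le (by linarith))
    have hee : (q - 1) * e = 1 / p := by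
      have : q - 1 ≠ 0 := by linarith
      rw [he]; field_simp
    obtain ⟨C, hC, H⟩ := CarlesonFamily.packing (X := X) (e := e) (B := 1 / q' - e)
      (a := 1 / p - 1 / q) (q := q) he0 (by linarith) (by linarith) (by linarith)
      (by rw [hq'e]; linarith) L hL
    refine ⟨C, hC, fun V w s T c hCar hT hm hV hw hs hx R hR => ?_⟩
    have := H V w T (fun Q => w Q * s Q ^ (q - 1)) c hCar hT hm hV hw hx R hR
    have hid : ∀ Q, s Q ^ (1 / p) * w Q ^ (1 / q') =
        (w Q * s Q ^ (q - 1)) ^ e * w Q ^ (1 / q' - e) := by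
      intro Q
      rw [ENNReal.mul_rpow_of_nonneg _ _ he0, ← ENNReal.rpow_mul, hee, mul_right_comm,
        ← ENNReal.rpow_add_of_nonneg _ _ he0 (by linarith), mul_comm]
      congr 2; ring
    simp_rw [hid]
    exact this
  · have he0 : 0 ≤ 1 / q' := by positivity
    have hB : (q - 1) * (1 / q') ≤ 1 / p := by
      have h1 : 0 < q - 1 := by linarith
      calc (q - 1) * (1 / q') ≤ (q - 1) * (1 / (p * (q - 1))) := by gcongr
        _ = 1 / p := by field_simp
    have h2 : 0 ≤ (q - 1) * (1 / q') := mul_nonneg (by linarith) he0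
    obtain ⟨C, hC, H⟩ := CarlesonFamily.packing (X := X) (e := 1 / q')
      (B := 1 / p - (q - 1) * (1 / q'))
      (a := 1 / p - 1 / q) (q := q) he0 (by linarith) (by linarith) (by linarith)
      (by linarith) L hL
    refine ⟨C, hC, fun V w s T c hCar hT hm hV hw hs hx R hR => ?_⟩
    have := H V s T (fun Q => w Q * s Q ^ (q - 1)) c hCar hT hm hV hs hx R hR
    have hid : ∀ Q, s Q ^ (1 / p) * w Q ^ (1 / q') =
        (w Q * s Q ^ (q - 1)) ^ (1 / q') * s Q ^ (1 / p - (q - 1) * (1 / q')) := by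
      intro Q
      rw [ENNReal.mul_rpow_of_nonneg _ _ he0, ← ENNReal.rpow_mul, mul_assoc,
        ← ENNReal.rpow_add_of_nonneg _ _ h2 (by linarith), mul_comm]
      congr 2; ring
    simp_rw [hid]
    exact this

/-- The bilinear estimate on a family where `w(Q) s(Q)^{q-1} / |Q|^q` is essentially constant. -/
lemma bilinear_sum_le_of_level {p q p' q' : ℝ} (hpp : p.HolderConjugate p')
    (hqq : q.HolderConjugate q') (hpq : p ≤ q) (L : ℝ≥0∞) (hL : L ≠ ⊤) :
    ∃ C : ℝ≥0∞, C ≠ ⊤ ∧ ∀ (V w s : Measure X) (T : Finset (Set X)) (c Lw Ls : ℝ≥0∞)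
      (h k : X → ℝ≥0∞),
      CarlesonFamily V L T → CarlesonFamily w Lw T → CarlesonFamily s Ls T →
      Laminar T → (∀ Q ∈ T, MeasurableSet Q) →
      (∀ Q ∈ T, V Q ≠ 0 ∧ V Q ≠ ⊤) → (∀ Q ∈ T, w Q ≠ 0 ∧ w Q ≠ ⊤) →
      (∀ Q ∈ T, s Q ≠ 0 ∧ s Q ≠ ⊤) →
      (∀ Q ∈ T, c * V Q ^ q ≤ w Q * s Q ^ (q - 1) ∧
        w Q * s Q ^ (q - 1) ≤ 2 * (c * V Q ^ q)) →
      Measurable h → Measurable k →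
      (∀ Q ∈ T, ∫⁻ x in Q, h x ∂s ≠ 0 ∧ ∫⁻ x in Q, h x ∂s ≠ ⊤) →
      (∀ Q ∈ T, ∫⁻ x in Q, k x ∂w ≠ 0 ∧ ∫⁻ x in Q, k x ∂w ≠ ⊤) →
      ∑ Q ∈ T, s Q ^ (1 / p) * w Q ^ (1 / q') * lavg s h Q * lavg w k Q ≤
        C * (Lw ^ (1 / p') + Ls ^ (1 / q)) *
          ((∫⁻ x, h x ^ p ∂s) ^ (1 / p) * (∫⁻ x, k x ^ q' ∂w) ^ (1 / q')) := by
  have hq_le : q' ≤ p' := by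
    rw [← inv_le_inv₀ hpp.symm.pos hqq.symm.pos, ← hpp.one_sub_inv, ← hqq.one_sub_inv]
    have := inv_anti₀ hpp.pos hpq
    linarith
  obtain ⟨C₁, hC₁, hpack⟩ := packing_of_level (X := X) hpp hqq hpq L hL
  obtain ⟨C₂, hC₂, hpr₁⟩ := exists_principal (X := X) hpp.lt
  obtain ⟨C₃, hC₃, hpr₂⟩ := exists_principal (X := X) hqq.symm.lt
  have hC₂' : C₂ ^ (1 / p) ≠ ⊤ := ENNReal.rpow_ne_top_of_nonneg hpp.one_div_nonneg hC₂
  have hC₃' : C₃ ^ (1 / q') ≠ ⊤ := ENNReal.rpow_ne_top_of_nonneg hqq.symm.one_div_nonneg hC₃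
  refine ⟨4 * C₁ * (C₂ ^ (1 / p) * C₃ ^ (1 / q')), ENNReal.mul_ne_top
    (ENNReal.mul_ne_top (by simp) hC₁) (ENNReal.mul_ne_top hC₂' hC₃'), ?_⟩
  intro V w s T c Lw Ls h k hCV hCw hCs hT hm hV hw hs hx hh hk hhT hkT
  obtain ⟨F, hFT, hF, hFsum⟩ := hpr₁ s T h hT hm hh hs hhT
  obtain ⟨G, hGT, hG, hGsum⟩ := hpr₂ w T k hT hm hk hw hkT
  have hpk := hpack V w s T c hCV hT hm hV hw hs hx
  have hnorm : (∑ P ∈ F, lavg s h P ^ p * s P) ^ (1 / p) *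
      (∑ R ∈ G, lavg w k R ^ q' * w R) ^ (1 / q') ≤ C₂ ^ (1 / p) * C₃ ^ (1 / q') *
      ((∫⁻ x, h x ^ p ∂s) ^ (1 / p) * (∫⁻ x, k x ^ q' ∂w) ^ (1 / q')) := by
    calc _ ≤ (C₂ * ∫⁻ x, h x ^ p ∂s) ^ (1 / p) * (C₃ * ∫⁻ x, k x ^ q' ∂w) ^ (1 / q') := by
          gcongr
          · exact hpp.one_div_nonneg
          · exact hqq.symm.one_div_nonneg
      _ = _ := by
          rw [ENNReal.mul_rpow_of_nonneg _ _ hpp.one_div_nonneg,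
            ENNReal.mul_rpow_of_nonneg _ _ hqq.symm.one_div_nonneg]
          ring
  set U₁ := T.filter fun Q => ∃ P ∈ F, ∃ R ∈ G, Q ⊆ P ∧ P ⊆ R ∧
    lavg s h Q ≤ 2 * lavg s h P ∧ lavg w k Q ≤ 2 * lavg w k R with hU₁
  set U₂ := T.filter fun Q => ∃ R ∈ G, ∃ P ∈ F, Q ⊆ R ∧ R ⊆ P ∧
    lavg w k Q ≤ 2 * lavg w k R ∧ lavg s h Q ≤ 2 * lavg s h P with hU₂
  have hcov : T ⊆ U₁ ∪ U₂ := by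
    intro Q hQ
    obtain ⟨P, hP, hQP, h1⟩ := hF Q hQ
    obtain ⟨R, hR, hQR, h2⟩ := hG Q hQ
    have hne : Q.Nonempty := by
      rw [nonempty_iff_ne_empty]
      rintro rfl
      exact (hV _ hQ).1 (measure_empty)
    rcases hT P (hFT hP) R (hGT hR) with h3 | h3 | h3
    · exact Finset.mem_union_left _ (Finset.mem_filter.2 ⟨hQ, P, hP, R, hR, hQP, h3, h1, h2⟩)
    · exact Finset.mem_union_right _ (Finset.mem_filter.2 ⟨hQ, R, hR, P, hP, hQR, h3, h2, h1⟩)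
    · obtain ⟨x, hx⟩ := hne
      exact absurd (hQR hx) (Set.disjoint_left.1 h3 (hQP hx))
  have b1 := bilinear_sum_le_of_principal (a := fun R => s R ^ (1 / p) * w R ^ (1 / q'))
    hpp hqq.symm.pos hq_le (Finset.filter_subset _ T) hFT hGT
    (s := s) (w := w) (H := lavg s h) (K := lavg w k) (fun _ _ => rfl) hpk hCw
    (U := U₁) fun Q hQ => (Finset.mem_filter.1 hQ).2
  have b2 := bilinear_sum_le_of_principal (a := fun R => s R ^ (1 / p) * w R ^ (1 / q'))
    hqq.symm hpp.pos hpq (Finset.filter_subset _ T) hGT hFT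
    (s := w) (w := s) (H := lavg w k) (K := lavg s h) (fun _ _ => mul_comm _ _) hpk hCs
    (U := U₂) fun Q hQ => (Finset.mem_filter.1 hQ).2
  calc ∑ Q ∈ T, s Q ^ (1 / p) * w Q ^ (1 / q') * lavg s h Q * lavg w k Q
      ≤ ∑ Q ∈ U₁ ∪ U₂, s Q ^ (1 / p) * w Q ^ (1 / q') * lavg s h Q * lavg w k Q :=
        Finset.sum_le_sum_of_subset hcov
    _ ≤ ∑ Q ∈ U₁, s Q ^ (1 / p) * w Q ^ (1 / q') * lavg s h Q * lavg w k Q +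
        ∑ Q ∈ U₂, s Q ^ (1 / p) * w Q ^ (1 / q') * lavg w k Q * lavg s h Q := by
        have hcomm : ∀ Q, s Q ^ (1 / p) * w Q ^ (1 / q') * lavg w k Q * lavg s h Q =
            s Q ^ (1 / p) * w Q ^ (1 / q') * lavg s h Q * lavg w k Q := fun Q =>
          mul_right_comm _ _ _
        simp_rw [hcomm]
        rw [← Finset.sum_union_inter]
        exact le_self_add
    _ ≤ 4 * C₁ * (Lw ^ (1 / p') + Ls ^ (1 / q)) *
        ((∑ P ∈ F, lavg s h P ^ p * s P) ^ (1 / p) *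
        (∑ R ∈ G, lavg w k R ^ q' * w R) ^ (1 / q')) := by
        refine (add_le_add b1 b2).trans_eq ?_
        ring
    _ ≤ 4 * C₁ * (Lw ^ (1 / p') + Ls ^ (1 / q)) * (C₂ ^ (1 / p) * C₃ ^ (1 / q') *
      ((∫⁻ x, h x ^ p ∂s) ^ (1 / p) * (∫⁻ x, k x ^ q' ∂w) ^ (1 / q'))) := by gcongr
    _ = _ := by ring

end SparseFormBounds

section SparseFormTheorem

open scoped Classical

variable {X : Type*} [MeasurableSpace X]

lemma setLIntegral_ne_top_of_rpow {p : ℝ} (hp : 1 < p) {m : Measure X} {h : X → ℝ≥0∞}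
    (hfin : ∫⁻ x, h x ^ p ∂m ≠ ⊤) {Q : Set X} (hQ : m Q ≠ ⊤) :
    ∫⁻ x in Q, h x ∂m ≠ ⊤ := by
  have hle : ∀ x, h x ≤ 1 + h x ^ p := by
    intro x
    rcases le_total (h x) 1 with h1 | h1
    · exact h1.trans le_self_add
    · refine le_trans ?_ le_add_self
      calc h x = h x ^ (1 : ℝ) := (ENNReal.rpow_one _).symm
        _ ≤ _ := ENNReal.rpow_le_rpow_of_exponent_le h1 hp.le
  refine ne_top_of_le_ne_top ?_ (lintegral_mono hle)
  rw [lintegral_add_left measurable_const]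
  refine ENNReal.add_ne_top.2 ⟨by simpa using hQ, ?_⟩
  exact ne_top_of_le_ne_top hfin (setLIntegral_le_lintegral _ _)

lemma carleson_of_char {q : ℝ} (hq : 1 < q) {V w s : Measure X} {T : Finset (Set X)}
    {A L : ℝ≥0∞} (hC : CarlesonFamily V L T) (hT : Laminar T) (hm : ∀ Q ∈ T, MeasurableSet Q)
    (hV : ∀ Q ∈ T, V Q ≠ 0 ∧ V Q ≠ ⊤) (hw : ∀ Q ∈ T, w Q ≠ 0 ∧ w Q ≠ ⊤)
    (hs : ∀ Q ∈ T, s Q ≠ 0 ∧ s Q ≠ ⊤)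
    (hlow : ∀ E, MeasurableSet E → V E ^ q ≤ w E * s E ^ (q - 1))
    (hup : ∀ Q ∈ T, w Q * s Q ^ (q - 1) ≤ A * V Q ^ q) (n : ℕ) (hn : 2 * L ≤ n) :
    CarlesonFamily w (A * 2 ^ q * n) T ∧
      CarlesonFamily s ((A * 2 ^ q) ^ (1 / (q - 1)) * n) T := by
  obtain ⟨E, hE, hEn⟩ := hC.exists_subsets hT hm hV n hn
  have hq1 : 0 < q - 1 := by linarith
  have hmain : ∀ F ∈ T, w F * s F ^ (q - 1) ≤ A * 2 ^ q * (w (E F) * s (E F) ^ (q - 1)) := by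
    intro F hF
    obtain ⟨-, hEm, hEV⟩ := hE F hF
    calc w F * s F ^ (q - 1) ≤ A * V F ^ q := hup F hF
      _ ≤ A * (2 * V (E F)) ^ q := by gcongr
      _ = A * 2 ^ q * V (E F) ^ q := by
          rw [ENNReal.mul_rpow_of_nonneg _ _ (by linarith), mul_assoc]
      _ ≤ _ := by gcongr; exact hlow _ hEm
  constructor
  · refine carleson_of_subsets (fun F hF => ⟨(hE F hF).1, (hE F hF).2.1⟩) hEn fun F hF => ?_
    have h0 : s F ^ (q - 1) ≠ 0 := by
      simp [ENNReal.rpow_eq_zero_iff, (hs F hF).1, (hs F hF).2]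
    have ht : s F ^ (q - 1) ≠ ⊤ := ENNReal.rpow_ne_top_of_nonneg hq1.le (hs F hF).2
    rw [← ENNReal.mul_le_mul_iff_left h0 ht]
    refine (hmain F hF).trans ?_
    rw [← mul_assoc]
    gcongr
    exact (hE F hF).1
  · refine carleson_of_subsets (fun F hF => ⟨(hE F hF).1, (hE F hF).2.1⟩) hEn fun F hF => ?_
    have h1 : s F ^ (q - 1) ≤ A * 2 ^ q * s (E F) ^ (q - 1) := by
      rw [← ENNReal.mul_le_mul_iff_right (hw F hF).1 (hw F hF).2]
      refine (hmain F hF).trans ?_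
      calc A * 2 ^ q * (w (E F) * s (E F) ^ (q - 1))
          ≤ A * 2 ^ q * (w F * s (E F) ^ (q - 1)) := by
            gcongr
            exact (hE F hF).1
        _ = _ := by ring
    have h2 := ENNReal.rpow_le_rpow h1 (one_div_pos.2 hq1).le
    rw [ENNReal.mul_rpow_of_nonneg _ _ (one_div_pos.2 hq1).le, ← ENNReal.rpow_mul,
      ← ENNReal.rpow_mul, mul_one_div_cancel hq1.ne', ENNReal.rpow_one, ENNReal.rpow_one] at h2
    exact h2

/-- The sharp weighted bound for the bilinear form of a fractional sparse operator. -/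
lemma sparse_bilinear_le {p q p' q' : ℝ} (hpp : p.HolderConjugate p')
    (hqq : q.HolderConjugate q') (hpq : p ≤ q) (L : ℝ≥0∞) (hL : L ≠ ⊤) :
    ∃ C : ℝ≥0∞, C ≠ ⊤ ∧ ∀ (V w s : Measure X) (T : Finset (Set X)) (A : ℝ≥0∞)
      (h k : X → ℝ≥0∞), CarlesonFamily V L T →
      Laminar T → (∀ Q ∈ T, MeasurableSet Q) →
      (∀ Q ∈ T, V Q ≠ 0 ∧ V Q ≠ ⊤) → (∀ Q ∈ T, w Q ≠ 0 ∧ w Q ≠ ⊤) →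
      (∀ Q ∈ T, s Q ≠ 0 ∧ s Q ≠ ⊤) →
      (∀ E, MeasurableSet E → V E ^ q ≤ w E * s E ^ (q - 1)) →
      (∀ Q ∈ T, w Q * s Q ^ (q - 1) ≤ A * V Q ^ q) → A ≠ ⊤ →
      Measurable h → Measurable k → ∫⁻ x, h x ^ p ∂s ≠ ⊤ → ∫⁻ x, k x ^ q' ∂w ≠ ⊤ →
      ∑ Q ∈ T, (V Q)⁻¹ * s Q ^ (1 / p - 1 / q) * (∫⁻ x in Q, h x ∂s) * (∫⁻ x in Q, k x ∂w) ≤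
        C * A ^ max (1 / p' + 1 / q) (1 / (q - 1)) *
          ((∫⁻ x, h x ^ p ∂s) ^ (1 / p) * (∫⁻ x, k x ^ q' ∂w) ^ (1 / q')) := by
  have hq0 := hqq.pos
  have hp0 := hpp.pos
  have hp'0 := hpp.symm.pos
  have hq'0 := hqq.symm.pos
  have hq1 := hqq.sub_one_pos
  have hq'e : 1 / q' = 1 - 1 / q := by
    have := hqq.inv_add_inv_eq_one
    rw [one_div, one_div]; linarith
  have hqi : 1 / q ≤ 1 / p := one_div_le_one_div_of_le hp0 hpq
  obtain ⟨C₁, hC₁, hlev⟩ := bilinear_sum_le_of_level (X := X) hpp hqq hpq L hL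
  obtain ⟨n, hn⟩ := ENNReal.exists_nat_gt (ENNReal.mul_ne_top (by simp : (2 : ℝ≥0∞) ≠ ⊤) hL)
  set c : ℝ≥0∞ := (1 - 2 ^ (-(1 / q)))⁻¹ with hc
  have hct : c ≠ ⊤ := geometric_const_ne_top (by positivity)
  set D : ℝ≥0∞ := (2 ^ q * n) ^ (1 / p') + (2 ^ (q * (1 / (q - 1))) * n) ^ (1 / q) with hD
  have hDt : D ≠ ⊤ := by
    refine ENNReal.add_ne_top.2 ⟨?_, ?_⟩
    · exact ENNReal.rpow_ne_top_of_nonneg (by positivity)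
        (ENNReal.mul_ne_top (ENNReal.rpow_ne_top_of_nonneg hq0.le (by simp)) (by simp))
    · exact ENNReal.rpow_ne_top_of_nonneg (by positivity)
        (ENNReal.mul_ne_top (ENNReal.rpow_ne_top_of_nonneg (by positivity) (by simp)) (by simp))
  refine ⟨2 ^ (1 / q) * c * C₁ * D, ENNReal.mul_ne_top (ENNReal.mul_ne_top (ENNReal.mul_ne_top
    (ENNReal.rpow_ne_top_of_nonneg (by positivity) (by simp)) hct) hC₁) hDt, ?_⟩
  intro V w s T₀ A h k hCar₀ hT₀ hm₀ hV₀ hw₀ hs₀ hlow hup₀ hA hh hk hhp hkq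
  set T := T₀.filter fun Q => ∫⁻ x in Q, h x ∂s ≠ 0 ∧ ∫⁻ x in Q, k x ∂w ≠ 0 with hTdef
  have hTT : T ⊆ T₀ := Finset.filter_subset _ _
  have hsum0 : ∑ Q ∈ T₀, (V Q)⁻¹ * s Q ^ (1 / p - 1 / q) * (∫⁻ x in Q, h x ∂s) *
      (∫⁻ x in Q, k x ∂w) = ∑ Q ∈ T, (V Q)⁻¹ * s Q ^ (1 / p - 1 / q) * (∫⁻ x in Q, h x ∂s) *
      (∫⁻ x in Q, k x ∂w) := by
    symm
    refine Finset.sum_subset hTT fun Q hQ hQT => ?_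
    have : ∫⁻ x in Q, h x ∂s = 0 ∨ ∫⁻ x in Q, k x ∂w = 0 := by
      by_contra hcon
      push Not at hcon
      exact hQT (Finset.mem_filter.2 ⟨hQ, hcon⟩)
    rcases this with h | h <;> simp [h]
  rw [hsum0]
  have hCar := hCar₀.mono hTT
  have hT := hT₀.mono hTT
  have hm : ∀ Q ∈ T, MeasurableSet Q := fun Q hQ => hm₀ Q (hTT hQ)
  have hV : ∀ Q ∈ T, V Q ≠ 0 ∧ V Q ≠ ⊤ := fun Q hQ => hV₀ Q (hTT hQ)
  have hw : ∀ Q ∈ T, w Q ≠ 0 ∧ w Q ≠ ⊤ := fun Q hQ => hw₀ Q (hTT hQ)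
  have hs : ∀ Q ∈ T, s Q ≠ 0 ∧ s Q ≠ ⊤ := fun Q hQ => hs₀ Q (hTT hQ)
  have hup : ∀ Q ∈ T, w Q * s Q ^ (q - 1) ≤ A * V Q ^ q := fun Q hQ => hup₀ Q (hTT hQ)
  have hhT : ∀ Q ∈ T, ∫⁻ x in Q, h x ∂s ≠ 0 ∧ ∫⁻ x in Q, h x ∂s ≠ ⊤ := fun Q hQ =>
    ⟨(Finset.mem_filter.1 hQ).2.1, setLIntegral_ne_top_of_rpow hpp.lt hhp (hs Q hQ).2⟩
  have hkT : ∀ Q ∈ T, ∫⁻ x in Q, k x ∂w ≠ 0 ∧ ∫⁻ x in Q, k x ∂w ≠ ⊤ := fun Q hQ =>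
    ⟨(Finset.mem_filter.1 hQ).2.2, setLIntegral_ne_top_of_rpow hqq.symm.lt hkq (hw Q hQ).2⟩
  clear_value T
  rcases T.eq_empty_or_nonempty with rfl | ⟨Q₀, hQ₀⟩
  · simp
  have hVq : ∀ Q ∈ T, V Q ^ q ≠ 0 ∧ V Q ^ q ≠ ⊤ := fun Q hQ =>
    ⟨by simp [ENNReal.rpow_eq_zero_iff, (hV Q hQ).1, (hV Q hQ).2],
      ENNReal.rpow_ne_top_of_nonneg hq0.le (hV Q hQ).2⟩
  have hA1 : 1 ≤ A := by
    have := (hlow Q₀ (hm Q₀ hQ₀)).trans (hup Q₀ hQ₀)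
    rw [← ENNReal.mul_le_mul_iff_left (hVq Q₀ hQ₀).1 (hVq Q₀ hQ₀).2]
    simpa using this
  obtain ⟨hcw, hcs⟩ := carleson_of_char hqq.lt hCar hT hm hV hw hs hlow hup n hn.le
  set Lw : ℝ≥0∞ := A * 2 ^ q * n with hLw
  set Ls : ℝ≥0∞ := (A * 2 ^ q) ^ (1 / (q - 1)) * n with hLs
  have hl : ∀ Q, ∃ i : ℕ, Q ∈ T → 2 ^ i ≤ A ∧ 2 ^ i * V Q ^ q ≤ w Q * s Q ^ (q - 1) ∧
      w Q * s Q ^ (q - 1) ≤ 2 * (2 ^ i * V Q ^ q) := by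
    intro Q
    by_cases hQ : Q ∈ T
    · obtain ⟨hv0, hvt⟩ := hVq Q hQ
      have hxt : w Q * s Q ^ (q - 1) ≠ ⊤ :=
        ENNReal.mul_ne_top (hw Q hQ).2 (ENNReal.rpow_ne_top_of_nonneg hq1.le (hs Q hQ).2)
      obtain ⟨i, hi1, hi2⟩ := exists_two_pow_le_lt (x := w Q * s Q ^ (q - 1) / V Q ^ q)
        ((ENNReal.le_div_iff_mul_le (Or.inl hv0) (Or.inl hvt)).2
          (by simpa using hlow Q (hm Q hQ))) (ENNReal.div_ne_top hxt hv0)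
      refine ⟨i, fun _ => ⟨hi1.trans ?_, ?_, ?_⟩⟩
      · exact ENNReal.div_le_of_le_mul (hup Q hQ)
      · exact (ENNReal.le_div_iff_mul_le (Or.inl hv0) (Or.inl hvt)).1 hi1
      · have := (ENNReal.div_le_iff_le_mul (Or.inl hv0) (Or.inl hvt)).1 hi2
        rw [pow_succ] at this
        refine this.trans_eq (by ring)
    · exact ⟨0, fun h => absurd h hQ⟩
  choose l hl using hl
  set Nh : ℝ≥0∞ := (∫⁻ x, h x ^ p ∂s) ^ (1 / p) * (∫⁻ x, k x ^ q' ∂w) ^ (1 / q') with hNh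
  have hterm : ∀ Q ∈ T, (V Q)⁻¹ * s Q ^ (1 / p - 1 / q) * (∫⁻ x in Q, h x ∂s) *
      (∫⁻ x in Q, k x ∂w) ≤ (2 * 2 ^ l Q) ^ (1 / q) *
        (s Q ^ (1 / p) * w Q ^ (1 / q') * lavg s h Q * lavg w k Q) := by
    intro Q hQ
    obtain ⟨hs0, hst⟩ := hs Q hQ
    obtain ⟨hw0, hwt⟩ := hw Q hQ
    obtain ⟨hV0, hVt⟩ := hV Q hQ
    have e1 : ∫⁻ x in Q, h x ∂s = lavg s h Q * s Q := (ENNReal.div_mul_cancel hs0 hst).symm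
    have e2 : ∫⁻ x in Q, k x ∂w = lavg w k Q * w Q := (ENNReal.div_mul_cancel hw0 hwt).symm
    have e3 : s Q ^ (1 / p - 1 / q) * s Q * w Q =
        (w Q * s Q ^ (q - 1)) ^ (1 / q) * (s Q ^ (1 / p) * w Q ^ (1 / q')) := by
      have f1 : s Q ^ (1 / p - 1 / q) * s Q = s Q ^ ((q - 1) * (1 / q)) * s Q ^ (1 / p) := by
        conv_lhs => enter [2]; rw [← ENNReal.rpow_one (s Q)]
        rw [← ENNReal.rpow_add _ _ hs0 hst, ← ENNReal.rpow_add _ _ hs0 hst]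
        congr 1; field_simp; ring
      have f2 : w Q = w Q ^ (1 / q) * w Q ^ (1 / q') := by
        rw [← ENNReal.rpow_add _ _ hw0 hwt, hq'e]; simp
      rw [ENNReal.mul_rpow_of_nonneg _ _ (by positivity), ← ENNReal.rpow_mul, f1]
      conv_lhs => rw [f2]
      ring
    have e4 : (w Q * s Q ^ (q - 1)) ^ (1 / q) ≤ (2 * 2 ^ l Q) ^ (1 / q) * V Q := by
      calc (w Q * s Q ^ (q - 1)) ^ (1 / q) ≤ (2 * (2 ^ l Q * V Q ^ q)) ^ (1 / q) := by
            exact ENNReal.rpow_le_rpow (hl Q hQ).2.2 (by positivity)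
        _ = _ := by
            rw [← mul_assoc, ENNReal.mul_rpow_of_nonneg _ _ (by positivity), ← ENNReal.rpow_mul,
              mul_one_div_cancel hq0.ne', ENNReal.rpow_one]
    rw [e1, e2]
    calc (V Q)⁻¹ * s Q ^ (1 / p - 1 / q) * (lavg s h Q * s Q) * (lavg w k Q * w Q)
        = (V Q)⁻¹ * (s Q ^ (1 / p - 1 / q) * s Q * w Q) * (lavg s h Q * lavg w k Q) := by ring
      _ ≤ (V Q)⁻¹ * (((2 * 2 ^ l Q) ^ (1 / q) * V Q) * (s Q ^ (1 / p) * w Q ^ (1 / q'))) *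
          (lavg s h Q * lavg w k Q) := by rw [e3]; gcongr
      _ = ((V Q)⁻¹ * V Q) * ((2 * 2 ^ l Q) ^ (1 / q) *
        (s Q ^ (1 / p) * w Q ^ (1 / q') * lavg s h Q * lavg w k Q)) := by ring
      _ = _ := by rw [ENNReal.inv_mul_cancel hV0 hVt, one_mul]
  have hfib : ∀ j ∈ T.image l, ∑ Q ∈ T with l Q = j, (V Q)⁻¹ * s Q ^ (1 / p - 1 / q) *
      (∫⁻ x in Q, h x ∂s) * (∫⁻ x in Q, k x ∂w) ≤
      ((2 : ℝ≥0∞) ^ (j : ℤ)) ^ (1 / q) *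
        (2 ^ (1 / q) * (C₁ * (Lw ^ (1 / p') + Ls ^ (1 / q)) * Nh)) := by
    intro j _
    have hsub : (T.filter fun Q => l Q = j) ⊆ T := Finset.filter_subset _ _
    have := hlev V w s (T.filter fun Q => l Q = j) (2 ^ j) Lw Ls h k (hCar.mono hsub)
      (hcw.mono hsub) (hcs.mono hsub) (hT.mono hsub) (fun Q hQ => hm Q (hsub hQ))
      (fun Q hQ => hV Q (hsub hQ)) (fun Q hQ => hw Q (hsub hQ)) (fun Q hQ => hs Q (hsub hQ))
      (fun Q hQ => by
        have := (hl Q (hsub hQ)).2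
        rwa [(Finset.mem_filter.1 hQ).2] at this) hh hk (fun Q hQ => hhT Q (hsub hQ))
      (fun Q hQ => hkT Q (hsub hQ))
    calc _ ≤ ∑ Q ∈ T with l Q = j, (2 * 2 ^ j) ^ (1 / q) *
        (s Q ^ (1 / p) * w Q ^ (1 / q') * lavg s h Q * lavg w k Q) := by
          refine Finset.sum_le_sum fun Q hQ => ?_
          have h2 := hterm Q (hsub hQ)
          rwa [(Finset.mem_filter.1 hQ).2] at h2
      _ ≤ (2 * 2 ^ j) ^ (1 / q) * (C₁ * (Lw ^ (1 / p') + Ls ^ (1 / q)) * Nh) := by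
          rw [← Finset.mul_sum]; gcongr
      _ = _ := by
          rw [ENNReal.mul_rpow_of_nonneg _ _ (by positivity), zpow_natCast]; ring
  have hLs' : A ^ (1 / q) * (Lw ^ (1 / p') + Ls ^ (1 / q)) ≤
      A ^ max (1 / p' + 1 / q) (1 / (q - 1)) * D := by
    have hA0 : A ≠ 0 := (zero_lt_one.trans_le hA1).ne'
    have g1 : A ^ (1 / q) * Lw ^ (1 / p') = A ^ (1 / p' + 1 / q) * (2 ^ q * n) ^ (1 / p') := by
      rw [hLw, mul_assoc, ENNReal.mul_rpow_of_nonneg _ _ (by positivity), ← mul_assoc,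
        ← ENNReal.rpow_add _ _ hA0 hA, add_comm]
    have g2 : A ^ (1 / q) * Ls ^ (1 / q) =
        A ^ (1 / (q - 1)) * (2 ^ (q * (1 / (q - 1))) * n) ^ (1 / q) := by
      rw [hLs, ENNReal.mul_rpow_of_nonneg _ _ (by positivity : 0 ≤ 1 / (q - 1)), mul_assoc,
        ENNReal.mul_rpow_of_nonneg _ _ (by positivity : 0 ≤ 1 / q), ← mul_assoc,
        ← ENNReal.rpow_mul A, ← ENNReal.rpow_add _ _ hA0 hA, ← ENNReal.rpow_mul 2]
      congr 2
      field_simp; ring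
    rw [mul_add, g1, g2, hD, mul_add]
    gcongr
    · exact le_max_left _ _
    · exact le_max_right _ _
  calc _ = ∑ j ∈ T.image l, ∑ Q ∈ T with l Q = j, (V Q)⁻¹ * s Q ^ (1 / p - 1 / q) *
      (∫⁻ x in Q, h x ∂s) * (∫⁻ x in Q, k x ∂w) :=
        (Finset.sum_fiberwise_of_maps_to (fun Q hQ => Finset.mem_image_of_mem l hQ) _).symm
    _ ≤ ∑ j ∈ T.image l, ((2 : ℝ≥0∞) ^ (j : ℤ)) ^ (1 / q) *
        (2 ^ (1 / q) * (C₁ * (Lw ^ (1 / p') + Ls ^ (1 / q)) * Nh)) := Finset.sum_le_sum hfib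
    _ ≤ (c * A ^ (1 / q)) * (2 ^ (1 / q) * (C₁ * (Lw ^ (1 / p') + Ls ^ (1 / q)) * Nh)) := by
        rw [← Finset.sum_mul]
        gcongr
        refine sum_zpow_rpow_le (by positivity) _ _ (fun a _ b _ h => by exact_mod_cast h) A ?_
        intro j hj
        obtain ⟨Q, hQ, rfl⟩ := Finset.mem_image.1 hj
        rw [zpow_natCast]
        exact (hl Q hQ).1
    _ = 2 ^ (1 / q) * c * C₁ * (A ^ (1 / q) * (Lw ^ (1 / p') + Ls ^ (1 / q))) * Nh := by ring
    _ ≤ 2 ^ (1 / q) * c * C₁ * (A ^ max (1 / p' + 1 / q) (1 / (q - 1)) * D) * Nh := by gcongr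
    _ = _ := by ring

/-- The sharp weighted bound for a fractional sparse operator. -/
lemma sparse_operator_le {p q p' q' : ℝ} (hpp : p.HolderConjugate p')
    (hqq : q.HolderConjugate q') (hpq : p ≤ q) (L : ℝ≥0∞) (hL : L ≠ ⊤) :
    ∃ C : ℝ≥0∞, C ≠ ⊤ ∧ ∀ (V w s : Measure X) (T : Finset (Set X)) (A : ℝ≥0∞)
      (h : X → ℝ≥0∞), CarlesonFamily V L T →
      Laminar T → (∀ Q ∈ T, MeasurableSet Q) →
      (∀ Q ∈ T, V Q ≠ 0 ∧ V Q ≠ ⊤) → (∀ Q ∈ T, w Q ≠ 0 ∧ w Q ≠ ⊤) →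
      (∀ Q ∈ T, s Q ≠ 0 ∧ s Q ≠ ⊤) →
      (∀ E, MeasurableSet E → V E ^ q ≤ w E * s E ^ (q - 1)) →
      (∀ Q ∈ T, w Q * s Q ^ (q - 1) ≤ A * V Q ^ q) → A ≠ ⊤ →
      Measurable h →
      (∫⁻ x, (∑ Q ∈ T, Q.indicator (fun _ => (V Q)⁻¹ * s Q ^ (1 / p - 1 / q) *
        ∫⁻ y in Q, h y ∂s) x) ^ q ∂w) ^ (1 / q) ≤
        C * A ^ max (1 / p' + 1 / q) (1 / (q - 1)) * (∫⁻ x, h x ^ p ∂s) ^ (1 / p) := by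
  obtain ⟨C, hC, H⟩ := sparse_bilinear_le (X := X) hpp hqq hpq L hL
  have hq0 := hqq.pos
  have hp0 := hpp.pos
  have hp'0 := hpp.symm.pos
  have hq'0 := hqq.symm.pos
  have hq1 := hqq.sub_one_pos
  have hqi : 1 / q ≤ 1 / p := one_div_le_one_div_of_le hp0 hpq
  refine ⟨C + 1, ENNReal.add_ne_top.2 ⟨hC, by simp⟩, ?_⟩
  intro V w s T A h hCar hT hm hV hw hs hlow hup hA hh
  rcases T.eq_empty_or_nonempty with rfl | ⟨Q₀, hQ₀⟩
  · simp [hq0]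
  by_cases hhp : ∫⁻ x, h x ^ p ∂s = ⊤
  · have hA0 : A ≠ 0 := by
      rintro rfl
      have := (hlow Q₀ (hm Q₀ hQ₀)).trans (hup Q₀ hQ₀)
      rw [zero_mul, nonpos_iff_eq_zero, ENNReal.rpow_eq_zero_iff] at this
      rcases this with ⟨h1, -⟩ | ⟨-, h1⟩
      · exact (hV Q₀ hQ₀).1 h1
      · linarith
    rw [hhp, ENNReal.top_rpow_of_pos (by positivity), ENNReal.mul_top]
    · exact le_top
    · refine mul_ne_zero (by simp) ?_
      simp [ENNReal.rpow_eq_zero_iff, hA0, hA]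
  set c : Set X → ℝ≥0∞ := fun Q => (V Q)⁻¹ * s Q ^ (1 / p - 1 / q) * ∫⁻ y in Q, h y ∂s with hc
  have hct : ∀ Q ∈ T, c Q ≠ ⊤ := fun Q hQ => ENNReal.mul_ne_top (ENNReal.mul_ne_top
    (ENNReal.inv_ne_top.2 (hV Q hQ).1)
    (ENNReal.rpow_ne_top_of_nonneg (by linarith) (hs Q hQ).2))
    (setLIntegral_ne_top_of_rpow hpp.lt hhp (hs Q hQ).2)
  set G : X → ℝ≥0∞ := fun x => ∑ Q ∈ T, Q.indicator (fun _ => c Q) x with hG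
  have hGm : Measurable G := Finset.measurable_sum _ fun Q hQ =>
    measurable_const.indicator (hm Q hQ)
  set I : ℝ≥0∞ := ∫⁻ x, G x ^ q ∂w with hI
  have hIt : I ≠ ⊤ := by
    have hbd : ∀ x, G x ^ q ≤ (⋃ Q ∈ T, Q).indicator (fun _ => (∑ Q ∈ T, c Q) ^ q) x := by
      intro x
      by_cases hx : x ∈ ⋃ Q ∈ T, Q
      · rw [indicator_of_mem hx]
        gcongr
        exact Finset.sum_le_sum fun Q _ => indicator_le_self' (fun _ _ => zero_le) x
      · rw [indicator_of_notMem hx, nonpos_iff_eq_zero, ENNReal.rpow_eq_zero_iff]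
        refine Or.inl ⟨Finset.sum_eq_zero fun Q hQ => indicator_of_notMem (fun h => hx ?_) _, hq0⟩
        exact mem_biUnion hQ h
    refine ne_top_of_le_ne_top ?_ (lintegral_mono hbd)
    rw [lintegral_indicator_const (T.measurableSet_biUnion hm)]
    refine ENNReal.mul_ne_top (ENNReal.rpow_ne_top_of_nonneg hq0.le
      (ENNReal.sum_ne_top.2 hct)) ?_
    exact ne_top_of_le_ne_top (ENNReal.sum_ne_top.2 fun Q hQ => (hw Q hQ).2)
      (measure_biUnion_finset_le _ _)
  have hpow : ∀ x, (G x ^ (q - 1)) ^ q' = G x ^ q := by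
    intro x
    rw [← ENNReal.rpow_mul, hqq.sub_one_mul_conj]
  have hkey := H V w s T A h (fun x => G x ^ (q - 1)) hCar hT hm hV hw hs hlow hup hA hh
    (hGm.pow_const _) hhp (by simp_rw [hpow]; exact hIt)
  simp_rw [hpow] at hkey
  have hform : ∑ Q ∈ T, (V Q)⁻¹ * s Q ^ (1 / p - 1 / q) * (∫⁻ x in Q, h x ∂s) *
      (∫⁻ x in Q, G x ^ (q - 1) ∂w) = I := by
    calc _ = ∑ Q ∈ T, ∫⁻ x, Q.indicator (fun _ => c Q) x * G x ^ (q - 1) ∂w := by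
          refine Finset.sum_congr rfl fun Q hQ => ?_
          rw [← lintegral_const_mul _ (hGm.pow_const _), ← lintegral_indicator (hm Q hQ)]
          refine lintegral_congr fun x => ?_
          by_cases hx : x ∈ Q <;> simp [hx, hc]
      _ = ∫⁻ x, G x * G x ^ (q - 1) ∂w := by
          have hsm := lintegral_finsetSum (μ := w) T
            (f := fun Q x => Q.indicator (fun _ => c Q) x * G x ^ (q - 1)) fun Q hQ =>
              (measurable_const.indicator (hm Q hQ)).mul (hGm.pow_const _)
          rw [← hsm]
          exact lintegral_congr fun x => (Finset.sum_mul _ _ _).symm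
      _ = I := by
          refine lintegral_congr fun x => ?_
          conv_lhs => enter [1]; rw [← ENNReal.rpow_one (G x)]
          rw [← ENNReal.rpow_add_of_nonneg _ _ zero_le_one hq1.le]
          congr 1; ring
  rw [hform] at hkey
  change I ^ (1 / q) ≤ _
  by_cases hI0 : I = 0
  · rw [hI0, ENNReal.zero_rpow_of_pos (by positivity)]; exact zero_le
  have hsplit : I = I ^ (1 / q) * I ^ (1 / q') := by
    rw [← ENNReal.rpow_add _ _ hI0 hIt, one_div, one_div, hqq.inv_add_inv_eq_one,
      ENNReal.rpow_one]
  have hI'0 : I ^ (1 / q') ≠ 0 := by simp [ENNReal.rpow_eq_zero_iff, hI0, hIt]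
  have hI't : I ^ (1 / q') ≠ ⊤ := ENNReal.rpow_ne_top_of_nonneg (by positivity) hIt
  rw [← ENNReal.mul_le_mul_iff_left hI'0 hI't, ← hsplit]
  refine hkey.trans ?_
  rw [← mul_assoc]
  gcongr
  exact le_self_add

end SparseFormTheorem

section OscillationAugmentation

open scoped Classical

lemma exists_minimal_le_of_mem {ι : Type*} [PartialOrder ι] (T : Finset ι) {a : ι} (ha : a ∈ T) :
    ∃ m, m ≤ a ∧ Minimal (· ∈ T) m := by
  obtain ⟨m, hm⟩ := Finset.exists_minimal (s := T.filter (· ≤ a))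
    ⟨a, Finset.mem_filter.2 ⟨ha, le_rfl⟩⟩
  have hm' := Finset.mem_filter.1 hm.1
  exact ⟨m, hm'.2, hm'.1, fun y hy hym =>
    hm.2 (Finset.mem_filter.2 ⟨hy, hym.trans hm'.2⟩) hym⟩

lemma sum_biUnion_le_sum {ι κ : Type*} (I : Finset κ) (c : κ → Finset ι) (f : ι → ℝ≥0∞) :
    ∑ P ∈ I.biUnion c, f P ≤ ∑ Q ∈ I, ∑ P ∈ c Q, f P := by
  obtain ⟨r, hr⟩ : ∃ r : ι → κ → Prop, ∀ P Q, r P Q ↔ P ∈ c Q := ⟨_, fun _ _ => Iff.rfl⟩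
  refine (sum_le_sum_cover _ I r (fun P hP => by simpa [hr] using hP) _).trans ?_
  refine Finset.sum_le_sum fun Q _ => Finset.sum_le_sum_of_subset fun P hP => ?_
  exact (hr P Q).1 (Finset.mem_filter.1 hP).2

/-- A stopping-time family: starting from `S₀`, one adds the elements that are bad relative to the
smallest selected element above them. -/
lemma exists_stopping_family {ι : Type*} [PartialOrder ι] (bad : ι → ι → Prop) (U : Finset ι) :
    ∀ S₀ : Finset ι, ∃ S : Finset ι, S ⊆ U ∧ ∀ P ∈ U, P ∈ S ↔ P ∈ S₀ ∨
      ∃ Q ∈ S, P < Q ∧ (∀ R ∈ S, P < R → ¬ R < Q) ∧ bad Q P := by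
  induction U using Finset.strongInduction with
  | H U ih =>
    intro S₀
    rcases U.eq_empty_or_nonempty with rfl | hU
    · exact ⟨∅, by simp, by simp⟩
    obtain ⟨M, hM⟩ := Finset.exists_minimal hU
    obtain ⟨S, hSU, hS⟩ := ih (U.erase M) (Finset.erase_ssubset hM.1) S₀
    have hMS : M ∉ S := fun h => (Finset.mem_erase.1 (hSU h)).1 rfl
    have hnot : ∀ P ∈ U, ¬ P < M := fun P hP h => hM.not_lt hP h
    set c : Prop := M ∈ S₀ ∨ ∃ Q ∈ S, M < Q ∧ (∀ R ∈ S, M < R → ¬ R < Q) ∧ bad Q M with hc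
    set S' : Finset ι := if c then insert M S else S with hS'
    have hSS' : S ⊆ S' := by
      rw [hS']; split_ifs
      · exact Finset.subset_insert _ _
      · exact le_rfl
    have hS'S : ∀ Q ∈ S', Q = M ∨ Q ∈ S := by
      intro Q hQ
      rw [hS'] at hQ
      split_ifs at hQ
      · exact Finset.mem_insert.1 hQ
      · exact Or.inr hQ
    have hMS' : M ∈ S' ↔ c := by
      rw [hS']; split_ifs with h <;> simp [h, hMS]
    have hequiv : ∀ P ∈ U, (∃ Q ∈ S', P < Q ∧ (∀ R ∈ S', P < R → ¬ R < Q) ∧ bad Q P) ↔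
        ∃ Q ∈ S, P < Q ∧ (∀ R ∈ S, P < R → ¬ R < Q) ∧ bad Q P := by
      intro P hP
      constructor
      · rintro ⟨Q, hQ, h1, h2, h3⟩
        rcases hS'S Q hQ with rfl | hQ'
        · exact absurd h1 (hnot P hP)
        · exact ⟨Q, hQ', h1, fun R hR => h2 R (hSS' hR), h3⟩
      · rintro ⟨Q, hQ, h1, h2, h3⟩
        refine ⟨Q, hSS' hQ, h1, fun R hR hPR => ?_, h3⟩
        rcases hS'S R hR with rfl | hR'
        · exact absurd hPR (hnot P hP)
        · exact h2 R hR' hPR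
    refine ⟨S', fun Q hQ => ?_, fun P hP => ?_⟩
    · rcases hS'S Q hQ with rfl | h
      · exact hM.1
      · exact Finset.mem_of_mem_erase (hSU h)
    · rw [hequiv P hP]
      by_cases hPM : P = M
      · rw [hPM, hMS']
      · rw [← hS P (Finset.mem_erase.2 ⟨hPM, hP⟩)]
        exact ⟨fun h => (hS'S P h).resolve_left hPM, fun h => hSS' h⟩

variable {X : Type*} [MeasurableSpace X]

/-- Augmentation of a Carleson family so that the oscillation of `b` is controlled along chains. -/
lemma exists_oscillation_family {V : Measure X} {U S₀ : Finset (Set X)} (hU : Laminar U)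
    (hm : ∀ Q ∈ U, MeasurableSet Q) (hV : ∀ Q ∈ U, V Q ≠ 0 ∧ V Q ≠ ⊤) (hS₀ : S₀ ⊆ U)
    {L : ℝ≥0∞} (hC : ∀ R ∈ U, ∑ Q ∈ S₀ with Q ⊆ R, V Q ≤ L * V R) {K : ℝ≥0∞} (hK : 1 ≤ K)
    (hpar : ∀ R ∈ U, ∀ Q ∈ U, R ⊂ Q → ∃ P ∈ U, R ⊂ P ∧ P ⊆ Q ∧ V P ≤ K * V R)
    (b : X → ℝ) (β : Set X → ℝ)
    (hβ : ∀ P ∈ U, ∀ c : ℝ, ‖β P - c‖ₑ ≤ lavg V (fun x => ‖b x - c‖ₑ) P)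
    (hfin : ∀ P ∈ U, ∫⁻ x in P, ‖b x - β P‖ₑ ∂V ≠ ⊤) :
    ∃ S : Finset (Set X), S₀ ⊆ S ∧ S ⊆ U ∧ CarlesonFamily V (2 * (1 + L)) S ∧
      ∀ P ∈ U, ∀ Q ∈ S, P ⊆ Q → ‖β P - β Q‖ₑ ≤
        2 * K * ∑ R ∈ S with P ⊆ R ∧ R ⊆ Q, lavg V (fun x => ‖b x - β R‖ₑ) R := by
  set Ω : Set X → Set X → ℝ≥0∞ := fun Q P => lavg V (fun x => ‖b x - β Q‖ₑ) P with hΩ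
  obtain ⟨S, hSU, hS⟩ := exists_stopping_family (fun Q P => 2 * Ω Q Q < Ω Q P) U S₀
  have hne : ∀ Q ∈ U, Q.Nonempty := by
    intro Q hQ
    rw [nonempty_iff_ne_empty]
    rintro rfl
    exact (hV _ hQ).1 measure_empty
  have hΩV : ∀ Q, ∀ P ∈ U, Ω Q P * V P = ∫⁻ x in P, ‖b x - β Q‖ₑ ∂V := fun Q P hP =>
    ENNReal.div_mul_cancel (hV P hP).1 (hV P hP).2
  have hmin : ∀ P ∈ U, ∀ Q ∈ S, P ⊂ Q → ∃ R ∈ S, P ⊂ R ∧ R ⊆ Q ∧ ∀ R' ∈ S, P ⊂ R' → ¬ R' ⊂ R := by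
    intro P hP Q hQ hPQ
    obtain ⟨R, hRQ, hR⟩ := exists_minimal_le_of_mem (S.filter fun R => P ⊂ R)
      (Finset.mem_filter.2 ⟨hQ, hPQ⟩)
    obtain ⟨hRS, hPR⟩ := Finset.mem_filter.1 hR.1
    exact ⟨R, hRS, hPR, hRQ, fun R' hR' h1 => hR.not_lt (Finset.mem_filter.2 ⟨hR', h1⟩)⟩
  refine ⟨S, fun P hP => (hS P (hS₀ hP)).2 (Or.inl hP), hSU, ?_, ?_⟩
  · intro R hR
    set ch : Set X → Finset (Set X) := fun Q =>
      S.filter fun P => P ⊂ Q ∧ (∀ R ∈ S, P ⊂ R → ¬ R ⊂ Q) ∧ 2 * Ω Q Q < Ω Q P with hch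
    have hchild : ∀ Q ∈ S, 2 * ∑ P ∈ ch Q, V P ≤ V Q := by
      intro Q hQ
      have hchS : ∀ P ∈ ch Q, P ∈ U := fun P hP => hSU (Finset.mem_filter.1 hP).1
      by_cases h0 : Ω Q Q = 0
      · have hint : ∫⁻ x in Q, ‖b x - β Q‖ₑ ∂V = 0 := by rw [← hΩV Q Q (hSU hQ), h0, zero_mul]
        have : ch Q = ∅ := by
          refine Finset.eq_empty_of_forall_notMem fun P hP => ?_
          obtain ⟨hPS, hPQ, -, h2⟩ := Finset.mem_filter.1 hP
          have h3 : ∫⁻ x in P, ‖b x - β Q‖ₑ ∂V = 0 := by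
            rw [← nonpos_iff_eq_zero, ← hint]
            exact lintegral_mono_set hPQ.subset
          have h4 : Ω Q P = 0 := by
            simp only [hΩ, lavg, h3, ENNReal.zero_div]
          simp [h4] at h2
        simp [this]
      have ht : Ω Q Q ≠ ⊤ := ENNReal.div_ne_top (hfin Q (hSU hQ)) (hV Q (hSU hQ)).1
      have hdisj : (↑(ch Q) : Set (Set X)).PairwiseDisjoint id := by
        intro P₁ hP₁ P₂ hP₂ hne
        obtain ⟨hS₁, hQ₁, hn₁, -⟩ := Finset.mem_filter.1 (Finset.mem_coe.1 hP₁)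
        obtain ⟨hS₂, hQ₂, hn₂, -⟩ := Finset.mem_filter.1 (Finset.mem_coe.1 hP₂)
        rcases hU P₁ (hSU hS₁) P₂ (hSU hS₂) with h | h | h
        · exact absurd hQ₂ (hn₁ P₂ hS₂ (h.ssubset_of_ne hne))
        · exact absurd hQ₁ (hn₂ P₁ hS₁ (h.ssubset_of_ne hne.symm))
        · exact h
      have h1 : Ω Q Q * (2 * ∑ P ∈ ch Q, V P) ≤ Ω Q Q * V Q := by
        calc Ω Q Q * (2 * ∑ P ∈ ch Q, V P) = ∑ P ∈ ch Q, 2 * Ω Q Q * V P := by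
              rw [← Finset.mul_sum]; ring
          _ ≤ ∑ P ∈ ch Q, (V.withDensity fun x => ‖b x - β Q‖ₑ) P := by
              refine Finset.sum_le_sum fun P hP => ?_
              rw [withDensity_apply _ (hm P (hchS P hP)), ← hΩV Q P (hchS P hP)]
              gcongr
              exact (Finset.mem_filter.1 hP).2.2.2.le
          _ ≤ (V.withDensity fun x => ‖b x - β Q‖ₑ) Q :=
              sum_measure_le_of_disjoint (fun P hP => hm P (hchS P hP)) hdisj
                fun P hP => (Finset.mem_filter.1 hP).2.1.subset
          _ = Ω Q Q * V Q := by
              rw [withDensity_apply _ (hm Q (hSU hQ)), hΩV Q Q (hSU hQ)]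
      exact (ENNReal.mul_le_mul_iff_right h0 ht).1 h1
    set Y := ∑ P ∈ S with P ⊆ R, V P with hY
    have hYt : Y ≠ ⊤ := ENNReal.sum_ne_top.2 fun P hP => (hV P (hSU (Finset.mem_filter.1 hP).1)).2
    have hcov : (S.filter fun P => P ⊆ R) ⊆ insert R ((S₀.filter fun P => P ⊆ R) ∪
        (S.filter fun Q => Q ⊆ R).biUnion ch) := by
      intro P hP
      obtain ⟨hPS, hPR⟩ := Finset.mem_filter.1 hP
      rcases (hS P (hSU hPS)).1 hPS with h | ⟨Q, hQ, hPQ, h1, h2⟩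
      · exact Finset.mem_insert_of_mem (Finset.mem_union_left _ (Finset.mem_filter.2 ⟨h, hPR⟩))
      by_cases hPRe : P = R
      · rw [hPRe]; exact Finset.mem_insert_self _ _
      refine Finset.mem_insert_of_mem (Finset.mem_union_right _ (Finset.mem_biUnion.2
        ⟨Q, Finset.mem_filter.2 ⟨hQ, ?_⟩, Finset.mem_filter.2 ⟨hPS, hPQ, h1, h2⟩⟩))
      rcases hU Q (hSU hQ) R (hSU hR) with h | h | h
      · exact h
      · by_contra hcon
        exact h1 R hR (hPR.ssubset_of_ne hPRe) ⟨h, hcon⟩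
      · obtain ⟨x, hx⟩ := hne P (hSU hPS)
        exact absurd (hPR hx) (Set.disjoint_left.1 h (hPQ.subset hx))
    have hYle : Y ≤ V R + (L * V R + ∑ Q ∈ S with Q ⊆ R, ∑ P ∈ ch Q, V P) := by
      calc Y ≤ ∑ P ∈ insert R ((S₀.filter fun P => P ⊆ R) ∪
            (S.filter fun Q => Q ⊆ R).biUnion ch), V P := Finset.sum_le_sum_of_subset hcov
        _ ≤ V R + ∑ P ∈ ((S₀.filter fun P => P ⊆ R) ∪
            (S.filter fun Q => Q ⊆ R).biUnion ch), V P := by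
            rw [Finset.insert_eq, ← Finset.sum_singleton (fun P => V P) R,
              ← Finset.sum_union_inter]
            exact le_self_add
        _ ≤ V R + (∑ P ∈ S₀ with P ⊆ R, V P +
            ∑ P ∈ (S.filter fun Q => Q ⊆ R).biUnion ch, V P) := by
            gcongr
            rw [← Finset.sum_union_inter]
            exact le_self_add
        _ ≤ _ := by
            gcongr
            · exact hC R (hSU hR)
            · exact sum_biUnion_le_sum _ _ _
    have hsumch : 2 * ∑ Q ∈ S with Q ⊆ R, ∑ P ∈ ch Q, V P ≤ Y := by
      rw [Finset.mul_sum]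
      exact Finset.sum_le_sum fun Q hQ => hchild Q (Finset.mem_filter.1 hQ).1
    have : Y + Y ≤ 2 * (1 + L) * V R + Y := by
      calc Y + Y = 2 * Y := (two_mul _).symm
        _ ≤ 2 * (V R + (L * V R + ∑ Q ∈ S with Q ⊆ R, ∑ P ∈ ch Q, V P)) := by gcongr
        _ = 2 * (1 + L) * V R + 2 * ∑ Q ∈ S with Q ⊆ R, ∑ P ∈ ch Q, V P := by ring
        _ ≤ _ := by gcongr
    exact (ENNReal.add_le_add_iff_right hYt).1 this
  · have hgood : ∀ P ∈ U, P ∉ S → ∀ R ∈ S, P ⊂ R → (∀ R' ∈ S, P ⊂ R' → ¬ R' ⊂ R) →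
        Ω R P ≤ 2 * Ω R R := by
      intro P hP hPS R hR hPR hmin'
      by_contra hcon
      exact hPS ((hS P hP).2 (Or.inr ⟨R, hR, hPR, hmin', not_le.1 hcon⟩))
    have hstep : ∀ P ∈ S, ∀ R ∈ S, P ⊂ R → (∀ R' ∈ S, P ⊂ R' → ¬ R' ⊂ R) →
        ‖β P - β R‖ₑ ≤ 2 * K * Ω R R := by
      intro P hP R hR hPR hmin'
      obtain ⟨P', hP', hPP', hP'R, hVP'⟩ := hpar P (hSU hP) R (hSU hR) hPR
      have h1 : Ω R P' ≤ 2 * Ω R R := by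
        rcases hP'R.eq_or_ssubset with rfl | hss
        · rw [two_mul]; exact le_self_add
        · exact hgood P' hP' (fun h => hmin' P' h hPP' hss) R hR hss
            fun R' hR' h => hmin' R' hR' (hPP'.trans h)
      have h2 : Ω R P ≤ K * Ω R P' := by
        refine ENNReal.div_le_of_le_mul ?_
        calc ∫⁻ x in P, ‖b x - β R‖ₑ ∂V ≤ ∫⁻ x in P', ‖b x - β R‖ₑ ∂V :=
              lintegral_mono_set hPP'.subset
          _ = Ω R P' * V P' := (hΩV R P' hP').symm
          _ ≤ Ω R P' * (K * V P) := by gcongr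
          _ = _ := by ring
      calc ‖β P - β R‖ₑ ≤ Ω R P := hβ P (hSU hP) _
        _ ≤ K * (2 * Ω R R) := h2.trans (by gcongr)
        _ = _ := by ring
    have htri : ∀ x y z : ℝ, ‖x - z‖ₑ ≤ ‖x - y‖ₑ + ‖y - z‖ₑ := by
      intro x y z
      rw [← sub_add_sub_cancel x y z]
      exact enorm_add_le _ _
    have hchain : ∀ n : ℕ, ∀ P ∈ S, ∀ Q ∈ S, P ⊆ Q →
        (S.filter fun R => P ⊂ R ∧ R ⊆ Q).card ≤ n →
        ‖β P - β Q‖ₑ ≤ 2 * K * ∑ R ∈ S with P ⊂ R ∧ R ⊆ Q, Ω R R := by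
      intro n
      induction n with
      | zero =>
        intro P hP Q hQ hPQ hcard
        rcases hPQ.eq_or_ssubset with rfl | hss
        · simp
        · have : Q ∈ S.filter fun R => P ⊂ R ∧ R ⊆ Q := Finset.mem_filter.2 ⟨hQ, hss, le_rfl⟩
          rw [Finset.card_eq_zero.1 (Nat.le_zero.1 hcard)] at this
          simp at this
      | succ n ih =>
        intro P hP Q hQ hPQ hcard
        rcases hPQ.eq_or_ssubset with rfl | hss
        · simp
        obtain ⟨R, hR, hPR, hRQ, hmin'⟩ := hmin P (hSU hP) Q hQ hss
        have hRnot : R ∉ S.filter fun R' => R ⊂ R' ∧ R' ⊆ Q := fun h =>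
          (Finset.mem_filter.1 h).2.1.ne rfl
        have hsub : insert R (S.filter fun R' => R ⊂ R' ∧ R' ⊆ Q) ⊆
            S.filter fun R' => P ⊂ R' ∧ R' ⊆ Q := by
          intro R' hR'
          rcases Finset.mem_insert.1 hR' with rfl | h
          · exact Finset.mem_filter.2 ⟨hR, hPR, hRQ⟩
          · obtain ⟨h1, h2, h3⟩ := Finset.mem_filter.1 h
            exact Finset.mem_filter.2 ⟨h1, hPR.trans h2, h3⟩
        have hcard' := Finset.card_le_card hsub
        rw [Finset.card_insert_of_notMem hRnot] at hcard'
        calc ‖β P - β Q‖ₑ ≤ ‖β P - β R‖ₑ + ‖β R - β Q‖ₑ := htri _ _ _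
          _ ≤ 2 * K * Ω R R + 2 * K * ∑ R' ∈ S with R ⊂ R' ∧ R' ⊆ Q, Ω R' R' :=
              add_le_add (hstep P hP R hR hPR hmin') (ih R hR Q hQ hRQ (by omega))
          _ = 2 * K * ∑ R' ∈ insert R (S.filter fun R' => R ⊂ R' ∧ R' ⊆ Q), Ω R' R' := by
              rw [Finset.sum_insert hRnot]; ring
          _ ≤ _ := by gcongr
    intro P hP Q hQ hPQ
    by_cases hPS : P ∈ S
    · refine (hchain _ P hPS Q hQ hPQ le_rfl).trans ?_
      gcongr 2 * K * ?_
      refine Finset.sum_le_sum_of_subset fun R hR => ?_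
      obtain ⟨h1, h2, h3⟩ := Finset.mem_filter.1 hR
      exact Finset.mem_filter.2 ⟨h1, h2.subset, h3⟩
    · have hss : P ⊂ Q := hPQ.ssubset_of_ne fun h => hPS (h ▸ hQ)
      obtain ⟨R, hR, hPR, hRQ, hmin'⟩ := hmin P hP Q hQ hss
      have hRnot : R ∉ S.filter fun R' => R ⊂ R' ∧ R' ⊆ Q := fun h =>
        (Finset.mem_filter.1 h).2.1.ne rfl
      calc ‖β P - β Q‖ₑ ≤ ‖β P - β R‖ₑ + ‖β R - β Q‖ₑ := htri _ _ _
        _ ≤ 2 * K * Ω R R + 2 * K * ∑ R' ∈ S with R ⊂ R' ∧ R' ⊆ Q, Ω R' R' := by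
            refine add_le_add ?_ (hchain _ R hR Q hQ hRQ le_rfl)
            calc ‖β P - β R‖ₑ ≤ Ω R P := hβ P hP _
              _ ≤ 2 * Ω R R := hgood P hP hPS R hR hPR hmin'
              _ = 2 * 1 * Ω R R := by ring
              _ ≤ _ := by gcongr
        _ = 2 * K * ∑ R' ∈ insert R (S.filter fun R' => R ⊂ R' ∧ R' ⊆ Q), Ω R' R' := by
            rw [Finset.sum_insert hRnot]; ring
        _ ≤ _ := by
            gcongr 2 * K * ?_
            refine Finset.sum_le_sum_of_subset fun R' hR' => ?_
            rcases Finset.mem_insert.1 hR' with rfl | h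
            · exact Finset.mem_filter.2 ⟨hR, hPR.subset, hRQ⟩
            · obtain ⟨h1, h2, h3⟩ := Finset.mem_filter.1 h
              exact Finset.mem_filter.2 ⟨h1, hPR.subset.trans h2.subset, h3⟩

end OscillationAugmentation

section CubeGeometry

open scoped Classical

lemma Cube.carrier_eq_preimage (Q : Cube d) : Q.carrier =
    (MeasurableEquiv.toLp 2 (Fin d → ℝ)).symm ⁻¹'
      univ.pi fun i => Ico (Q.corner i) (Q.corner i + Q.side) := by
  ext x
  simp [Cube.carrier]

lemma Cube.measurableSet_carrier (Q : Cube d) : MeasurableSet Q.carrier := by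
  rw [Q.carrier_eq_preimage]
  exact (MeasurableEquiv.measurable _) (MeasurableSet.univ_pi fun i => measurableSet_Ico)

lemma Cube.vol_pos (Q : Cube d) : 0 < Q.vol := pow_pos Q.side_pos d

lemma Cube.volume_carrier (Q : Cube d) : volume Q.carrier = ENNReal.ofReal Q.vol := by
  rw [Q.carrier_eq_preimage,
    (EuclideanSpace.volume_preserving_symm_measurableEquiv_toLp (Fin d)).measure_preimage
      (MeasurableSet.univ_pi fun i => measurableSet_Ico).nullMeasurableSet, volume_pi_pi]
  simp [Real.volume_Ico, Cube.vol, ENNReal.ofReal_pow Q.side_pos.le]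

lemma Cube.volume_real_carrier (Q : Cube d) : volume.real Q.carrier = Q.vol := by
  rw [measureReal_def, Q.volume_carrier, ENNReal.toReal_ofReal Q.vol_pos.le]

lemma Cube.volume_carrier_ne_zero (Q : Cube d) : volume Q.carrier ≠ 0 := by
  rw [Q.volume_carrier]
  exact (ENNReal.ofReal_pos.2 Q.vol_pos).ne'

lemma Cube.volume_carrier_ne_top (Q : Cube d) : volume Q.carrier ≠ ⊤ := by
  rw [Q.volume_carrier]
  exact ENNReal.ofReal_ne_top

lemma Cube.dist_le (Q : Cube d) {x y : Rd d} (hx : x ∈ Q.carrier) (hy : y ∈ Q.carrier) :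
    dist x y ≤ √d * Q.side := by
  rw [EuclideanSpace.dist_eq]
  calc √(∑ i, dist (x i) (y i) ^ 2) ≤ √(∑ _i : Fin d, Q.side ^ 2) := by
        refine Real.sqrt_le_sqrt (Finset.sum_le_sum fun i _ => ?_)
        refine pow_le_pow_left₀ dist_nonneg ?_ 2
        rw [Real.dist_eq, abs_le]
        constructor <;> linarith [(hx i).1, (hx i).2, (hy i).1, (hy i).2]
    _ = √d * Q.side := by
        rw [Finset.sum_const, Finset.card_univ, Fintype.card_fin, nsmul_eq_mul,
          Real.sqrt_mul (Nat.cast_nonneg d), Real.sqrt_sq Q.side_pos.le]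

lemma Cube.corner_mem (Q : Cube d) : WithLp.toLp 2 Q.corner ∈ Q.carrier := fun i => by
  simpa using Q.side_pos

lemma Cube.isBounded_carrier (Q : Cube d) : Bornology.IsBounded Q.carrier :=
  Metric.isBounded_iff.2 ⟨_, fun _ hx _ hy => Q.dist_le hx hy⟩

lemma Cube.integrableOn {f : Rd d → ℝ} (hf : LocallyIntegrable f volume) (Q : Cube d) :
    IntegrableOn f Q.carrier volume :=
  (hf.integrableOn_isCompact Q.isBounded_carrier.isCompact_closure).mono_set subset_closure

lemma Cube.side_le_of_subset (hd : 0 < d) {Q R : Cube d} (h : Q.carrier ⊆ R.carrier) :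
    Q.side ≤ R.side := by
  have h1 := measure_mono (μ := volume) h
  rw [Q.volume_carrier, R.volume_carrier, ENNReal.ofReal_le_ofReal_iff R.vol_pos.le] at h1
  exact (pow_le_pow_iff_left₀ Q.side_pos.le R.side_pos.le hd.ne').1 h1

lemma Cube.carrier_injective (hd : 0 < d) : Function.Injective (Cube.carrier (d := d)) := by
  intro Q R h
  have hs : Q.side = R.side :=
    le_antisymm (Cube.side_le_of_subset hd h.le) (Cube.side_le_of_subset hd h.ge)
  have hc : Q.corner = R.corner := by
    funext i
    have h1 := h.le Q.corner_mem i
    have h2 := h.ge R.corner_mem i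
    exact le_antisymm h2.1 h1.1
  cases Q; cases R
  simp_all

lemma DyadicLattice.subset_or_disjoint_aux (D : DyadicLattice d) (k : ℤ) (n : ℕ) :
    ∀ Q ∈ D.layer (k + n), ∃ R ∈ D.layer k, Q.carrier ⊆ R.carrier := by
  induction n with
  | zero => intro Q hQ; exact ⟨Q, by simpa using hQ, le_rfl⟩
  | succ n ih =>
    intro Q hQ
    obtain ⟨R, hR, hQR⟩ := D.refines (k + n) Q (by push_cast at hQ; rwa [← add_assoc] at hQ)
    obtain ⟨R', hR', h⟩ := ih R hR
    exact ⟨R', hR', hQR.trans h⟩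

lemma DyadicLattice.exists_ancestor (D : DyadicLattice d) {j k : ℤ} (hjk : j ≤ k) {Q : Cube d}
    (hQ : Q ∈ D.layer k) : ∃ R ∈ D.layer j, Q.carrier ⊆ R.carrier := by
  obtain ⟨n, rfl⟩ := Int.le.dest hjk
  exact D.subset_or_disjoint_aux j n Q hQ

lemma DyadicLattice.subset_of_mem (D : DyadicLattice d) {j k : ℤ} (hjk : j ≤ k) {Q R : Cube d}
    (hQ : Q ∈ D.layer k) (hR : R ∈ D.layer j) {x : Rd d} (hxQ : x ∈ Q.carrier)
    (hxR : x ∈ R.carrier) : Q.carrier ⊆ R.carrier := by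
  obtain ⟨R', hR', h⟩ := D.exists_ancestor hjk hQ
  by_cases hRR : R = R'
  · rwa [hRR]
  · have := D.pairwiseDisjoint j R hR R' hR' hRR
    exact absurd (show x ∈ R.carrier ∩ R'.carrier from ⟨hxR, h hxQ⟩) (by simp [this])

/-- The dyadic cubes, viewed as sets. -/
def DyadicLattice.sets (D : DyadicLattice d) : Set (Set (Rd d)) := Cube.carrier '' D.cubes

lemma DyadicLattice.laminar (D : DyadicLattice d) {T : Finset (Set (Rd d))}
    (hT : ∀ P ∈ T, P ∈ D.sets) : Laminar T := by
  intro P hP Q hQ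
  obtain ⟨P, ⟨k, hk⟩, rfl⟩ := hT P hP
  obtain ⟨Q, ⟨j, hj⟩, rfl⟩ := hT Q hQ
  by_cases hdis : Disjoint P.carrier Q.carrier
  · exact Or.inr (Or.inr hdis)
  obtain ⟨x, hxP, hxQ⟩ := Set.not_disjoint_iff.1 hdis
  rcases le_total j k with h | h
  · exact Or.inl (D.subset_of_mem h hk hj hxP hxQ)
  · exact Or.inr (Or.inl (D.subset_of_mem h hj hk hxQ hxP))

lemma DyadicLattice.measurableSet (D : DyadicLattice d) {P : Set (Rd d)} (hP : P ∈ D.sets) :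
    MeasurableSet P := by
  obtain ⟨P, -, rfl⟩ := hP
  exact P.measurableSet_carrier

lemma DyadicLattice.volume_ne (D : DyadicLattice d) {P : Set (Rd d)} (hP : P ∈ D.sets) :
    volume P ≠ 0 ∧ volume P ≠ ⊤ := by
  obtain ⟨P, -, rfl⟩ := hP
  exact ⟨P.volume_carrier_ne_zero, P.volume_carrier_ne_top⟩

lemma DyadicLattice.countable_layer (D : DyadicLattice d) (k : ℤ) : (D.layer k).Countable := by
  have h := Measure.countable_meas_pos_of_disjoint_iUnion (μ := (volume : Measure (Rd d)))
    (As := fun Q : D.layer k => (Q : Cube d).carrier) (fun Q => Q.1.measurableSet_carrier)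
    (fun Q R hQR => Set.disjoint_iff_inter_eq_empty.2
      (D.pairwiseDisjoint k Q Q.2 R R.2 fun h => hQR (Subtype.ext h)))
  have h2 : {i : D.layer k | 0 < volume (i : Cube d).carrier} = univ :=
    eq_univ_of_forall fun Q => pos_iff_ne_zero.2 Q.1.volume_carrier_ne_zero
  rw [h2] at h
  exact Set.countable_coe_iff.1 (Set.countable_univ_iff.1 h)

lemma DyadicLattice.countable_cubes (D : DyadicLattice d) : D.cubes.Countable := by
  have : D.cubes = ⋃ k, D.layer k := by ext; simp [DyadicLattice.cubes]
  rw [this]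
  exact countable_iUnion D.countable_layer

lemma DyadicLattice.finite_layer_below (D : DyadicLattice d) (k : ℤ) (R : Cube d) :
    {Q ∈ D.layer k | Q.carrier ⊆ R.carrier}.Finite := by
  set I := {Q ∈ D.layer k | Q.carrier ⊆ R.carrier} with hI
  have hε : (0 : ℝ≥0∞) < ENNReal.ofReal (((2 : ℝ) ^ (-k)) ^ d) := by
    rw [ENNReal.ofReal_pos]; positivity
  have h := Measure.finite_const_le_meas_of_disjoint_iUnion (μ := (volume : Measure (Rd d))) hε
    (As := fun Q : I => (Q : Cube d).carrier) (fun Q => Q.1.measurableSet_carrier)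
    (fun Q R hQR => Set.disjoint_iff_inter_eq_empty.2
      (D.pairwiseDisjoint k Q Q.2.1 R R.2.1 fun h => hQR (Subtype.ext h)))
    (measure_ne_top_of_subset (iUnion_subset fun Q => Q.2.2) R.volume_carrier_ne_top)
  have h2 : {i : I | ENNReal.ofReal (((2 : ℝ) ^ (-k)) ^ d) ≤ volume (i : Cube d).carrier} = univ :=
    eq_univ_of_forall fun Q => by
      rw [mem_ofPred_eq, Q.1.volume_carrier, Cube.vol, D.side_eq k Q Q.2.1]
  rw [h2] at h
  exact Set.finite_coe_iff.1 (Set.finite_univ_iff.1 h)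

lemma DyadicLattice.level_le_of_subset (D : DyadicLattice d) (hd : 0 < d) {j k : ℤ} {Q R : Cube d}
    (hQ : Q ∈ D.layer k) (hR : R ∈ D.layer j) (h : Q.carrier ⊆ R.carrier) : j ≤ k := by
  have := Cube.side_le_of_subset hd h
  rw [D.side_eq k Q hQ, D.side_eq j R hR, zpow_le_zpow_iff_right₀ (by norm_num)] at this
  omega

/-- The dyadic cubes of generation at most `n` contained in a cube of `S₀`. -/
lemma DyadicLattice.finite_truncation (D : DyadicLattice d) (hd : 0 < d) {S₀ : Finset (Cube d)}
    (hS₀ : ↑S₀ ⊆ D.cubes) (n : ℤ) :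
    {P : Set (Rd d) | ∃ k ≤ n, ∃ Q ∈ D.layer k, Q.carrier = P ∧
      ∃ R ∈ S₀, Q.carrier ⊆ R.carrier}.Finite := by
  have h : ∀ R ∈ S₀, ∃ j, R ∈ D.layer j := fun R hR => hS₀ hR
  choose! l hl using h
  refine Set.Finite.subset (s := ⋃ R ∈ S₀, ⋃ k ∈ Icc (l R) n,
    Cube.carrier '' {Q ∈ D.layer k | Q.carrier ⊆ R.carrier}) ?_ ?_
  · exact S₀.finite_toSet.biUnion fun R _ => (finite_Icc _ _).biUnion fun k _ =>
      (D.finite_layer_below k R).image _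
  · rintro P ⟨k, hk, Q, hQ, rfl, R, hR, hQR⟩
    exact mem_biUnion hR (mem_biUnion (x := k) ⟨D.level_le_of_subset hd hQ (hl R hR) hQR, hk⟩
      ⟨Q, ⟨hQ, hQR⟩, rfl⟩)

/-- Every dyadic cube strictly inside another has a parent there, of comparable volume. -/
lemma DyadicLattice.exists_parent (D : DyadicLattice d) (hd : 0 < d) {j k : ℤ} {R Q : Cube d}
    (hR : R ∈ D.layer k) (hQ : Q ∈ D.layer j) (h : R.carrier ⊂ Q.carrier) :
    ∃ P ∈ D.layer (k - 1), R.carrier ⊂ P.carrier ∧ P.carrier ⊆ Q.carrier ∧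
      volume P.carrier ≤ 2 ^ d * volume R.carrier := by
  have hjk : j < k := by
    refine lt_of_le_of_ne (D.level_le_of_subset hd hR hQ h.subset) ?_
    rintro rfl
    by_cases hRQ : R = Q
    · exact h.ne (by rw [hRQ])
    · have := D.pairwiseDisjoint j R hR Q hQ hRQ
      rw [inter_eq_left.2 h.subset] at this
      exact absurd R.corner_mem (by simp [this])
  obtain ⟨P, hP, hRP⟩ := D.exists_ancestor (sub_one_lt k).le hR
  have hside : P.side = 2 * R.side := by
    rw [D.side_eq _ P hP, D.side_eq _ R hR, ← zpow_one_add₀ (by norm_num)]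
    congr 1; ring
  refine ⟨P, hP, hRP.ssubset_of_ne fun he => ?_, ?_, ?_⟩
  · have := Cube.carrier_injective hd he
    rw [← this] at hside
    linarith [R.side_pos]
  · exact D.subset_of_mem (by omega) hP hQ (hRP R.corner_mem) (h.subset R.corner_mem)
  · rw [P.volume_carrier, R.volume_carrier, Cube.vol, Cube.vol, hside, mul_pow,
      ENNReal.ofReal_mul (by positivity), ENNReal.ofReal_pow (by norm_num)]
    simp

/-- Lebesgue differentiation along shrinking cubes. -/
lemma ae_tendsto_setAverage_cube {b : Rd d → ℝ} (hb : LocallyIntegrable b volume) :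
    ∀ᵐ x : Rd d, ∀ P : ℕ → Cube d, (∀ n, x ∈ (P n).carrier) →
      Tendsto (fun n => (P n).side) atTop (nhds 0) →
      Tendsto (fun n => ⨍ y in (P n).carrier, b y) atTop (nhds (b x)) := by
  filter_upwards [IsUnifLocDoublingMeasure.ae_tendsto_average_norm_sub volume hb 1]
    with x hx P hP hside
  set δ : ℕ → ℝ := fun n => (√d + 1) * (P n).side with hδ
  have hδpos : ∀ n, 0 < δ n := fun n => mul_pos (by positivity) (P n).side_pos
  have hδlim : Tendsto δ atTop (nhdsWithin 0 (Ioi 0)) := by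
    refine tendsto_nhdsWithin_iff.2 ⟨?_, Eventually.of_forall fun n => hδpos n⟩
    simpa using hside.const_mul (√d + 1)
  have h1 := hx (fun _ => x) δ hδlim
    (Eventually.of_forall fun n => Metric.mem_closedBall_self (by simpa using (hδpos n).le))
  set c : ℝ := (√d + 1) ^ d * volume.real (Metric.ball (0 : Rd d) 1) with hc
  have hball : ∀ n, volume.real (Metric.closedBall x (δ n)) = c * (P n).vol := by
    intro n
    rw [measureReal_def, Measure.addHaar_closedBall _ _ (hδpos n).le, ENNReal.toReal_mul,
      ENNReal.toReal_ofReal (pow_nonneg (hδpos n).le _), hc, hδ, measureReal_def, Cube.vol]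
    simp only [finrank_euclideanSpace, Fintype.card_fin, mul_pow]
    ring
  have hsub : ∀ n, (P n).carrier ⊆ Metric.closedBall x (δ n) := fun n y hy => by
    rw [Metric.mem_closedBall]
    refine ((P n).dist_le hy (hP n)).trans ?_
    rw [hδ]
    have := (P n).side_pos
    nlinarith
  rw [tendsto_iff_norm_sub_tendsto_zero]
  refine squeeze_zero (fun n => norm_nonneg _) (fun n => ?_) (by simpa using h1.const_mul c)
  have hint : IntegrableOn b (P n).carrier volume := (P n).integrableOn hb
  have hintc : IntegrableOn (fun _ : Rd d => b x) (P n).carrier volume :=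
    integrableOn_const (P n).volume_carrier_ne_top
  have hintB : IntegrableOn (fun y => ‖b y - b x‖) (Metric.closedBall x (δ n)) volume :=
    ((hb.integrableOn_isCompact (isCompact_closedBall _ _)).sub
      (integrableOn_const (isCompact_closedBall _ _).measure_lt_top.ne)).norm
  have hv := (P n).vol_pos
  have hcpos : 0 < c := by
    have : 0 < volume.real (Metric.ball (0 : Rd d) 1) :=
      ENNReal.toReal_pos (Metric.measure_ball_pos _ _ one_pos).ne' measure_ball_lt_top.ne
    positivity
  have h2 : (⨍ y in (P n).carrier, b y) - b x = (P n).vol⁻¹ * ∫ y in (P n).carrier, (b y - b x) := by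
    rw [setAverage_eq, integral_sub hint hintc, setIntegral_const, (P n).volume_real_carrier]
    simp only [smul_eq_mul]
    field_simp
  rw [h2, setAverage_eq, hball, norm_mul, norm_inv, Real.norm_of_nonneg hv.le, smul_eq_mul]
  calc (P n).vol⁻¹ * ‖∫ y in (P n).carrier, (b y - b x)‖
      ≤ (P n).vol⁻¹ * ∫ y in Metric.closedBall x (δ n), ‖b y - b x‖ := by
        gcongr
        refine (norm_integral_le_integral_norm _).trans ?_
        exact setIntegral_mono_set hintB (Eventually.of_forall fun y => norm_nonneg _)
          (hsub n).eventuallyLE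
    _ = _ := by simp only [Real.norm_eq_abs]; field_simp

end CubeGeometry

section SparseDomination

open scoped Classical

lemma avg_eq_setAverage (Q : Cube d) (f : Rd d → ℝ) : avg Q f = ⨍ x in Q.carrier, f x := by
  rw [setAverage_eq, Q.volume_real_carrier, avg, intC, smul_eq_mul]

lemma enorm_setAverage_sub_le {b : Rd d → ℝ} (hb : LocallyIntegrable b volume) (Q : Cube d)
    (c : ℝ) : ‖(⨍ y in Q.carrier, b y) - c‖ₑ ≤ lavg volume (fun y => ‖b y - c‖ₑ) Q.carrier := by
  have hv := Q.vol_pos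
  have h2 : (⨍ y in Q.carrier, b y) - c = Q.vol⁻¹ * ∫ y in Q.carrier, (b y - c) := by
    rw [setAverage_eq, integral_sub (Q.integrableOn hb)
      (integrableOn_const Q.volume_carrier_ne_top), setIntegral_const, Q.volume_real_carrier]
    simp only [smul_eq_mul]
    field_simp
  rw [h2, enorm_mul, lavg, div_eq_mul_inv, mul_comm]
  gcongr
  · exact enorm_integral_le_lintegral_enorm _
  · rw [enorm_inv hv.ne', Q.volume_carrier, Real.enorm_eq_ofReal hv.le]

lemma lintegral_enorm_sub_ne_top {b : Rd d → ℝ} (hb : LocallyIntegrable b volume) (Q : Cube d)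
    (c : ℝ) : ∫⁻ y in Q.carrier, ‖b y - c‖ₑ ≠ ⊤ :=
  ((Q.integrableOn hb).sub (integrableOn_const Q.volume_carrier_ne_top)).2.ne

lemma SparseFamily.sum_volume_le {γ : ℝ} (hγ : 0 < γ) {S : Set (Cube d)}
    (hS : SparseFamily γ (fun _ => 1) S) {T : Finset (Cube d)} (hT : ↑T ⊆ S) {R : Set (Rd d)}
    (hTR : ∀ Q ∈ T, Q.carrier ⊆ R) :
    ∑ Q ∈ T, volume Q.carrier ≤ (ENNReal.ofReal γ)⁻¹ * volume R := by
  obtain ⟨E, hE, hdis⟩ := hS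
  have hγ' : ENNReal.ofReal γ ≠ 0 := (ENNReal.ofReal_pos.2 hγ).ne'
  have h1 : ∀ Q ∈ T, volume Q.carrier ≤ (ENNReal.ofReal γ)⁻¹ * volume (E Q) := by
    intro Q hQ
    obtain ⟨hEQ, -, h⟩ := hE Q (hT hQ)
    have hEt : volume (E Q) ≠ ⊤ := measure_ne_top_of_subset hEQ Q.volume_carrier_ne_top
    rw [wInt, intC, setIntegral_const, setIntegral_const, smul_eq_mul, smul_eq_mul, mul_one,
      mul_one] at h
    rw [← ENNReal.div_eq_inv_mul, ENNReal.le_div_iff_mul_le (Or.inl hγ')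
      (Or.inl ENNReal.ofReal_ne_top), ← ENNReal.ofReal_toReal Q.volume_carrier_ne_top,
      ← ENNReal.ofReal_toReal hEt, ← ENNReal.ofReal_mul ENNReal.toReal_nonneg, mul_comm]
    exact ENNReal.ofReal_le_ofReal h
  calc ∑ Q ∈ T, volume Q.carrier ≤ ∑ Q ∈ T, (ENNReal.ofReal γ)⁻¹ * volume (E Q) :=
        Finset.sum_le_sum h1
    _ = (ENNReal.ofReal γ)⁻¹ * ∑ Q ∈ T, volume (E Q) := by rw [Finset.mul_sum]
    _ ≤ _ := by
        gcongr
        rw [← measure_biUnion_finset (fun Q hQ R hR hQR => hdis (hT hQ) (hT hR) hQR)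
          fun Q hQ => (hE Q (hT hQ)).2.1]
        exact measure_mono (iUnion₂_subset fun Q hQ => (hE Q (hT hQ)).1.trans (hTR Q hQ))

/-- A finite sparse family can be augmented so as to dominate the oscillations of `b`. -/
lemma DyadicLattice.exists_augmentation (D : DyadicLattice d) (hd : 0 < d) {γ : ℝ} (hγ : 0 < γ)
    {S : Set (Cube d)} (hS : SparseFamily γ (fun _ => 1) S) {S₀ : Finset (Cube d)}
    (hSD : S ⊆ D.cubes) (hS₀ : ↑S₀ ⊆ S) {b : Rd d → ℝ} (hb : LocallyIntegrable b volume) :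
    ∃ T : ℕ → Finset (Set (Rd d)), (∀ n, ∀ P ∈ T n, P ∈ D.sets) ∧
      (∀ n, CarlesonFamily volume (2 * (1 + (ENNReal.ofReal γ)⁻¹)) (T n)) ∧
      ∀ Q ∈ S₀, ∀ g : Rd d → ℝ≥0∞, Measurable g →
        ∫⁻ x in Q.carrier, ‖b x - avg Q b‖ₑ * g x ≤ liminf (fun n => 2 * 2 ^ d *
          ∑ R ∈ T n with R ⊆ Q.carrier,
            lavg volume (fun x => ‖b x - ⨍ y in R, b y‖ₑ) R * ∫⁻ x in R, g x) atTop := by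
  have hS₀D : ↑S₀ ⊆ D.cubes := hS₀.trans hSD
  choose! l hl using fun Q (hQ : Q ∈ S₀) => (hS₀D hQ : ∃ k, Q ∈ D.layer k)
  obtain ⟨M, hM⟩ := (S₀.image l).exists_le
  have hM : ∀ Q ∈ S₀, l Q ≤ M := fun Q hQ => hM _ (Finset.mem_image_of_mem l hQ)
  have hfinU := fun n : ℕ => D.finite_truncation hd hS₀D (M + n)
  set U : ℕ → Finset (Set (Rd d)) := fun n => (hfinU n).toFinset with hUdef
  have hUmem : ∀ n P, P ∈ U n ↔ ∃ k ≤ M + n, ∃ Q ∈ D.layer k, Q.carrier = P ∧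
      ∃ R ∈ S₀, Q.carrier ⊆ R.carrier := fun n P => by
    rw [hUdef, Set.Finite.mem_toFinset]; rfl
  have hUD : ∀ n, ∀ P ∈ U n, P ∈ D.sets := by
    intro n P hP
    obtain ⟨k, -, Q, hQ, rfl, -⟩ := (hUmem n P).1 hP
    exact ⟨Q, ⟨k, hQ⟩, rfl⟩
  have hS₀U : ∀ n, S₀.image Cube.carrier ⊆ U n := by
    intro n P hP
    obtain ⟨Q, hQ, rfl⟩ := Finset.mem_image.1 hP
    exact (hUmem n _).2 ⟨l Q, (hM Q hQ).trans (by simp), Q, hl Q hQ, rfl, Q, hQ, le_rfl⟩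
  have key := fun n : ℕ => exists_oscillation_family (V := (volume : Measure (Rd d)))
    (U := U n) (S₀ := S₀.image Cube.carrier) (D.laminar (hUD n))
    (fun Q hQ => D.measurableSet (hUD n Q hQ)) (fun Q hQ => D.volume_ne (hUD n Q hQ)) (hS₀U n)
    (L := (ENNReal.ofReal γ)⁻¹) (fun R hR => by
      have : (S₀.image Cube.carrier).filter (· ⊆ R) =
          (S₀.filter fun Q => Q.carrier ⊆ R).image Cube.carrier := by
        rw [Finset.filter_image]
      rw [this, Finset.sum_image fun Q _ R _ h => Cube.carrier_injective hd h]
      exact hS.sum_volume_le hγ (fun Q hQ => hS₀ (Finset.mem_filter.1 hQ).1)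
        fun Q hQ => (Finset.mem_filter.1 hQ).2)
    (K := 2 ^ d) (one_le_pow₀ (by norm_num)) (fun R hR Q hQ hRQ => by
      obtain ⟨k, hk, R, hRk, rfl, -⟩ := (hUmem n R).1 hR
      obtain ⟨j, hj, Q, hQj, rfl, Z, hZ, hQZ⟩ := (hUmem n Q).1 hQ
      obtain ⟨P, hP, h1, h2, h3⟩ := D.exists_parent hd hRk hQj hRQ
      exact ⟨P.carrier, (hUmem n _).2 ⟨k - 1, by omega, P, hP, rfl, Z, hZ, h2.trans hQZ⟩,
        h1, h2, h3⟩)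
    b (fun P => ⨍ y in P, b y)
    (fun P hP c => by
      obtain ⟨Q, -, rfl⟩ := hUD n P hP
      exact enorm_setAverage_sub_le hb Q c)
    (fun P hP => by
      obtain ⟨Q, -, rfl⟩ := hUD n P hP
      exact lintegral_enorm_sub_ne_top hb Q _)
  choose T hST hTU hTC hT using key
  refine ⟨T, fun n P hP => hUD n P (hTU n hP), hTC, fun Q hQ g hg => ?_⟩
  have hTQ : ∀ n, Q.carrier ∈ T n := fun n => hST n (Finset.mem_image_of_mem _ hQ)
  have hTm : ∀ n, ∀ P ∈ T n, MeasurableSet P := fun n P hP => D.measurableSet (hUD n P (hTU n hP))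
  set H : ℕ → Rd d → ℝ≥0∞ := fun n x => 2 * 2 ^ d * ∑ R ∈ T n with R ⊆ Q.carrier,
    R.indicator (fun _ => lavg volume (fun x => ‖b x - ⨍ y in R, b y‖ₑ) R) x with hH
  have hHm : ∀ n, Measurable (H n) := fun n => Measurable.const_mul
    (Finset.measurable_sum _ fun R hR =>
      measurable_const.indicator (hTm n R (Finset.mem_filter.1 hR).1)) _
  have hdom : ∀ᵐ x : Rd d, x ∈ Q.carrier → ‖b x - avg Q b‖ₑ ≤ liminf (fun n => H n x) atTop := by
    filter_upwards [ae_tendsto_setAverage_cube hb] with x hx hxQ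
    choose P hPl hxP using fun n : ℕ => D.covers (M + n) x
    have hside : Tendsto (fun n => (P n).side) atTop (nhds 0) := by
      have : ∀ n : ℕ, (P n).side = 2 ^ (-M) * (1 / 2) ^ n := fun n => by
        rw [D.side_eq _ _ (hPl n), neg_add, zpow_add₀ (by norm_num), zpow_neg, zpow_neg,
          zpow_natCast, one_div, inv_pow]
      simp_rw [this]
      simpa using (tendsto_pow_atTop_nhds_zero_of_lt_one (r := (1 / 2 : ℝ)) (by norm_num)
        (by norm_num)).const_mul ((2 : ℝ) ^ (-M))
    have hlim := hx P hxP hside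
    have hlim' : Tendsto (fun n => ‖(⨍ y in (P n).carrier, b y) - avg Q b‖ₑ) atTop
        (nhds ‖b x - avg Q b‖ₑ) := (hlim.sub_const _).enorm
    rw [← hlim'.liminf_eq]
    refine liminf_le_liminf (Eventually.of_forall fun n => ?_)
    have hPQ : (P n).carrier ⊆ Q.carrier :=
      D.subset_of_mem ((hM Q hQ).trans (by simp)) (hPl n) (hl Q hQ) (hxP n) hxQ
    have h1 := hT n (P n).carrier ((hUmem n _).2 ⟨M + n, le_rfl, P n, hPl n, rfl, Q, hQ, hPQ⟩)
      Q.carrier (hTQ n) hPQ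
    rw [avg_eq_setAverage]
    refine h1.trans ?_
    simp only [hH]
    gcongr 2 * 2 ^ d * ?_
    calc _ ≤ ∑ R ∈ T n with (P n).carrier ⊆ R ∧ R ⊆ Q.carrier,
          R.indicator (fun _ => lavg volume (fun x => ‖b x - ⨍ y in R, b y‖ₑ) R) x := by
          refine Finset.sum_le_sum fun R hR => ?_
          rw [indicator_of_mem ((Finset.mem_filter.1 hR).2.1 (hxP n))]
      _ ≤ _ := Finset.sum_le_sum_of_subset fun R hR => by
          obtain ⟨h1, h2, h3⟩ := Finset.mem_filter.1 hR
          exact Finset.mem_filter.2 ⟨h1, h3⟩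
  calc ∫⁻ x in Q.carrier, ‖b x - avg Q b‖ₑ * g x
      ≤ ∫⁻ x in Q.carrier, liminf (fun n => H n x * g x) atTop := by
        refine lintegral_mono_ae ?_
        rw [ae_restrict_iff' Q.measurableSet_carrier]
        filter_upwards [hdom] with x hx hxQ
        calc ‖b x - avg Q b‖ₑ * g x ≤ liminf (fun n => H n x) atTop * g x := by
              gcongr; exact hx hxQ
          _ ≤ _ := by
              have := ENNReal.le_liminf_mul (f := atTop) (u := fun n => H n x)
                (v := fun _ : ℕ => g x)
              rwa [liminf_const] at this
    _ ≤ liminf (fun n => ∫⁻ x in Q.carrier, H n x * g x) atTop :=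
        lintegral_liminf_le fun n => (hHm n).mul hg
    _ = _ := by
        congr 1
        funext n
        simp only [hH]
        have : ∀ x, (2 * 2 ^ d * ∑ R ∈ T n with R ⊆ Q.carrier, R.indicator
            (fun _ => lavg volume (fun x => ‖b x - ⨍ y in R, b y‖ₑ) R) x) * g x =
            2 * 2 ^ d * ∑ R ∈ T n with R ⊆ Q.carrier, R.indicator
              (fun x => lavg volume (fun x => ‖b x - ⨍ y in R, b y‖ₑ) R * g x) x := by
          intro x
          rw [mul_assoc, Finset.sum_mul]
          congr 1
          refine Finset.sum_congr rfl fun R _ => ?_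
          by_cases hxR : x ∈ R <;> simp [hxR]
        simp_rw [this]
        rw [lintegral_const_mul' _ _ (by finiteness), lintegral_finsetSum]
        · congr 1
          refine Finset.sum_congr rfl fun R hR => ?_
          obtain ⟨hR1, hR2⟩ := Finset.mem_filter.1 hR
          rw [lintegral_indicator (hTm n R hR1), Measure.restrict_restrict (hTm n R hR1),
            inter_eq_left.2 hR2, lintegral_const_mul _ hg]
        · exact fun R hR => (hg.const_mul _).indicator (hTm n R (Finset.mem_filter.1 hR).1)

end SparseDomination

section MuckenhouptWeights

open scoped Classical

/-- The density `w^{-q'/q}` of the weight dual to `w`. -/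
def dualDensity (q : ℝ) (w : Rd d → ℝ) (x : Rd d) : ℝ≥0∞ :=
  ENNReal.ofReal (w x ^ (-(conj q / q)))

lemma conj_div_self {q : ℝ} (hq : 1 < q) : conj q / q = 1 / (q - 1) := by
  have : q - 1 ≠ 0 := by linarith
  have : q ≠ 0 := by linarith
  rw [conj]; field_simp

lemma self_div_conj {q : ℝ} (hq : 1 < q) : q / conj q = q - 1 := by
  have : q - 1 ≠ 0 := by linarith
  have : q ≠ 0 := by linarith
  rw [conj]; field_simp

lemma one_div_conj {q : ℝ} (hq : 1 < q) : 1 / conj q = 1 - 1 / q := by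
  have : q - 1 ≠ 0 := by linarith
  have : q ≠ 0 := by linarith
  rw [conj]; field_simp

lemma holderConjugate_conj {q : ℝ} (hq : 1 < q) : q.HolderConjugate (conj q) :=
  Real.HolderConjugate.conjExponent hq

lemma dualDensity_rpow {q : ℝ} (hq : 1 < q) {w : Rd d → ℝ} (hw : ∀ x, 0 < w x) (t : ℝ) (x : Rd d) :
    dualDensity q w x ^ t = ENNReal.ofReal (w x ^ (-(t / (q - 1)))) := by
  rw [dualDensity, ENNReal.ofReal_rpow_of_pos (Real.rpow_pos_of_pos (hw x) _),
    ← Real.rpow_mul (hw x).le, conj_div_self hq]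
  congr 2
  ring

lemma dualDensity_ne_zero {q : ℝ} {w : Rd d → ℝ} (hw : ∀ x, 0 < w x) (x : Rd d) :
    dualDensity q w x ≠ 0 := (ENNReal.ofReal_pos.2 (Real.rpow_pos_of_pos (hw x) _)).ne'

lemma dualDensity_ne_top {q : ℝ} {w : Rd d → ℝ} (x : Rd d) : dualDensity q w x ≠ ⊤ :=
  ENNReal.ofReal_ne_top

lemma measurable_dualDensity {q : ℝ} {w : Rd d → ℝ} (hw : Measurable w) :
    Measurable (dualDensity q w) := (hw.pow_const _).ennreal_ofReal

lemma setLIntegral_ofReal_eq {g : Rd d → ℝ} (hg : LocallyIntegrable g volume) (h0 : ∀ x, 0 ≤ g x)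
    (Q : Cube d) : ∫⁻ x in Q.carrier, ENNReal.ofReal (g x) = ENNReal.ofReal (Q.vol * avg Q g) := by
  rw [← ofReal_integral_eq_lintegral_ofReal (Q.integrableOn hg) (Eventually.of_forall h0), avg,
    intC, mul_inv_cancel_left₀ Q.vol_pos.ne']

lemma setLIntegral_ne_zero_of_pos {g : Rd d → ℝ≥0∞} (hg : Measurable g) (h0 : ∀ x, g x ≠ 0)
    (Q : Cube d) : ∫⁻ x in Q.carrier, g x ≠ 0 := by
  rw [Ne, lintegral_eq_zero_iff hg]
  intro h
  have h2 : ∀ᵐ _x ∂(volume.restrict Q.carrier), False := h.mono fun x hx => h0 x hx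
  rw [ae_iff] at h2
  simp at h2
  exact Q.volume_carrier_ne_zero h2

lemma IsApOn.rpow_volume_le {q : ℝ} (hq : 1 < q) {w : Rd d → ℝ} (hw : IsWeight w)
    {E : Set (Rd d)} : volume E ^ q ≤
      (∫⁻ x in E, ENNReal.ofReal (w x)) * (∫⁻ x in E, dualDensity q w x) ^ (q - 1) := by
  have hq0 : 0 < q := by linarith
  have hq1 : 0 < q - 1 := by linarith
  have h := ENNReal.lintegral_mul_norm_pow_le (μ := volume.restrict E)
    (f := fun x => ENNReal.ofReal (w x)) (g := dualDensity q w)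
    hw.2.1.ennreal_ofReal.aemeasurable (measurable_dualDensity hw.2.1).aemeasurable
    (p := 1 / q) (q := (q - 1) / q) (by positivity) (by positivity) (by field_simp; ring)
  have h1 : ∀ x, ENNReal.ofReal (w x) ^ (1 / q) * dualDensity q w x ^ ((q - 1) / q) = 1 := by
    intro x
    rw [dualDensity_rpow hq hw.1, ENNReal.ofReal_rpow_of_pos (hw.1 x),
      ← ENNReal.ofReal_mul (Real.rpow_nonneg (hw.1 x).le _), ← Real.rpow_add (hw.1 x)]
    have : 1 / q + -((q - 1) / q / (q - 1)) = 0 := by field_simp; ring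
    rw [this, Real.rpow_zero, ENNReal.ofReal_one]
  simp_rw [h1] at h
  rw [setLIntegral_one] at h
  calc volume E ^ q ≤ ((∫⁻ x in E, ENNReal.ofReal (w x)) ^ (1 / q) *
        (∫⁻ x in E, dualDensity q w x) ^ ((q - 1) / q)) ^ q := by gcongr
    _ = _ := by
        rw [ENNReal.mul_rpow_of_nonneg _ _ hq0.le, ← ENNReal.rpow_mul, ← ENNReal.rpow_mul,
          div_mul_cancel₀ _ hq0.ne', div_mul_cancel₀ _ hq0.ne', ENNReal.rpow_one]

lemma IsApOn.mul_rpow_le {q : ℝ} (hq : 1 < q) {w : Rd d → ℝ} (hw : IsApOn univ q w) (Q : Cube d) :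
    (∫⁻ x in Q.carrier, ENNReal.ofReal (w x)) *
      (∫⁻ x in Q.carrier, dualDensity q w x) ^ (q - 1) ≤
        ApCharOn univ q w * volume Q.carrier ^ q := by
  have hq1 : 0 < q - 1 := by linarith
  obtain ⟨hW, hσ, -⟩ := hw
  have hv := Q.vol_pos
  have hpos : ∀ x, 0 ≤ w x ^ (-(conj q / q)) := fun x => Real.rpow_nonneg (hW.1 x).le _
  have ha : 0 ≤ avg Q w :=
    mul_nonneg (inv_nonneg.2 hv.le) (integral_nonneg fun x => (hW.1 x).le)
  have hb : 0 ≤ avg Q fun x => w x ^ (-(conj q / q)) :=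
    mul_nonneg (inv_nonneg.2 hv.le) (integral_nonneg hpos)
  have hA : ENNReal.ofReal (avg Q w * avg Q (fun x => w x ^ (-(conj q / q))) ^ (q / conj q)) ≤
      ApCharOn univ q w :=
    le_iSup₂_of_le (f := fun (Q : Cube d) (_ : Q ∈ univ) => ENNReal.ofReal
      (avg Q w * avg Q (fun x => w x ^ (-(conj q / q))) ^ (q / conj q))) Q (mem_univ Q) le_rfl
  rw [setLIntegral_ofReal_eq hW.2.2 (fun x => (hW.1 x).le)]
  simp only [dualDensity]
  rw [setLIntegral_ofReal_eq hσ hpos, ENNReal.ofReal_rpow_of_nonneg (by positivity) hq1.le,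
    ← ENNReal.ofReal_mul (by positivity), Q.volume_carrier,
    ENNReal.ofReal_rpow_of_pos hv]
  refine le_trans (le_of_eq ?_) (mul_le_mul_left hA _)
  rw [← ENNReal.ofReal_mul (by positivity), self_div_conj hq, Real.mul_rpow hv.le hb]
  congr 1
  have : Q.vol ^ q = Q.vol * Q.vol ^ (q - 1) := by
    rw [← Real.rpow_one_add' hv.le (by linarith)]; congr 1; ring
  rw [this]; ring

lemma IsApOn.lintegral_ne {q : ℝ} {w : Rd d → ℝ} (hw : IsApOn univ q w) (Q : Cube d) :
    (∫⁻ x in Q.carrier, ENNReal.ofReal (w x) ≠ 0 ∧ ∫⁻ x in Q.carrier, ENNReal.ofReal (w x) ≠ ⊤) ∧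
    (∫⁻ x in Q.carrier, dualDensity q w x ≠ 0 ∧ ∫⁻ x in Q.carrier, dualDensity q w x ≠ ⊤) := by
  obtain ⟨hW, hσ, -⟩ := hw
  refine ⟨⟨setLIntegral_ne_zero_of_pos hW.2.1.ennreal_ofReal
    (fun x => (ENNReal.ofReal_pos.2 (hW.1 x)).ne') Q, ?_⟩,
    setLIntegral_ne_zero_of_pos (measurable_dualDensity hW.2.1) (dualDensity_ne_zero hW.1) Q, ?_⟩
  · rw [setLIntegral_ofReal_eq hW.2.2 fun x => (hW.1 x).le]
    exact ENNReal.ofReal_ne_top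
  · simp only [dualDensity]
    rw [setLIntegral_ofReal_eq hσ fun x => Real.rpow_nonneg (hW.1 x).le _]
    exact ENNReal.ofReal_ne_top

/-- The sharp bound for fractional sparse operators with `A_q` weights. -/
lemma exists_weighted_sparse_le {s q : ℝ} (hs : 1 < s) (hq : 1 < q) (hsq : s ≤ q) {L : ℝ≥0∞}
    (hL : L ≠ ⊤) : ∃ C : ℝ≥0∞, C ≠ ⊤ ∧ ∀ (D : DyadicLattice d) (w : Rd d → ℝ)
      (T : Finset (Set (Rd d))) (φ : Rd d → ℝ≥0∞), IsApOn univ q w → (∀ P ∈ T, P ∈ D.sets) →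
      CarlesonFamily volume L T → Measurable φ →
      (∫⁻ x, (∑ Q ∈ T, Q.indicator (fun _ => (volume Q)⁻¹ *
        (∫⁻ y in Q, dualDensity q w y) ^ (1 / s - 1 / q) * ∫⁻ y in Q, φ y) x) ^ q *
          ENNReal.ofReal (w x)) ^ (1 / q) ≤
        C * ApCharOn univ q w ^ max (1 / conj s + 1 / q) (1 / (q - 1)) *
          (∫⁻ x, φ x ^ s * dualDensity q w x ^ (1 - s)) ^ (1 / s) := by
  obtain ⟨C, hC, H⟩ := sparse_operator_le (X := Rd d) (holderConjugate_conj hs)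
    (holderConjugate_conj hq) hsq L hL
  refine ⟨C, hC, fun D w T φ hw hT hCar hφ => ?_⟩
  have hWm : Measurable fun x => ENNReal.ofReal (w x) := hw.1.2.1.ennreal_ofReal
  have hσm := measurable_dualDensity (q := q) hw.1.2.1
  have hσ0 := dualDensity_ne_zero (q := q) hw.1.1
  have hσt := dualDensity_ne_top (d := d) (q := q) (w := w)
  set W : Measure (Rd d) := volume.withDensity fun x => ENNReal.ofReal (w x) with hWdef
  set σ : Measure (Rd d) := volume.withDensity (dualDensity q w) with hσdef
  have hW : ∀ E, MeasurableSet E → W E = ∫⁻ x in E, ENNReal.ofReal (w x) :=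
    fun E hE => withDensity_apply _ hE
  have hσ : ∀ E, MeasurableSet E → σ E = ∫⁻ x in E, dualDensity q w x :=
    fun E hE => withDensity_apply _ hE
  have hTm : ∀ Q ∈ T, MeasurableSet Q := fun Q hQ => D.measurableSet (hT Q hQ)
  have hcancel : ∀ x, dualDensity q w x * (φ x / dualDensity q w x) = φ x := fun x =>
    ENNReal.mul_div_cancel (hσ0 x) (hσt x)
  have h := H volume W σ T (ApCharOn univ q w) (fun x => φ x / dualDensity q w x) hCar
    (D.laminar hT) hTm (fun Q hQ => D.volume_ne (hT Q hQ))
    (fun Q hQ => by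
      rw [hW Q (hTm Q hQ)]
      obtain ⟨Q, -, rfl⟩ := hT Q hQ
      exact (hw.lintegral_ne Q).1)
    (fun Q hQ => by
      rw [hσ Q (hTm Q hQ)]
      obtain ⟨Q, -, rfl⟩ := hT Q hQ
      exact (hw.lintegral_ne Q).2)
    (fun E hE => by
      rw [hW E hE, hσ E hE]
      exact IsApOn.rpow_volume_le hq hw.1)
    (fun Q hQ => by
      rw [hW Q (hTm Q hQ), hσ Q (hTm Q hQ)]
      obtain ⟨Q, -, rfl⟩ := hT Q hQ
      exact hw.mul_rpow_le hq Q)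
    hw.2.2.ne (hφ.div hσm)
  have hdm : Measurable fun x => φ x / dualDensity q w x := hφ.div hσm
  have h1 : ∀ Q ∈ T, ∫⁻ y in Q, φ y / dualDensity q w y ∂σ = ∫⁻ y in Q, φ y := by
    intro Q hQ
    rw [hσdef, setLIntegral_withDensity_eq_setLIntegral_mul _ hσm hdm (hTm Q hQ)]
    exact lintegral_congr fun x => hcancel x
  have h2 : ∫⁻ x, (φ x / dualDensity q w x) ^ s ∂σ =
      ∫⁻ x, φ x ^ s * dualDensity q w x ^ (1 - s) := by
    rw [hσdef, lintegral_withDensity_eq_lintegral_mul _ hσm (hdm.pow_const s)]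
    refine lintegral_congr fun x => ?_
    rw [Pi.mul_apply, div_eq_mul_inv, ENNReal.mul_rpow_of_nonneg _ _ (by linarith),
      sub_eq_add_neg, ENNReal.rpow_add _ _ (hσ0 x) (hσt x), ENNReal.rpow_one, ENNReal.rpow_neg,
      ENNReal.inv_rpow]
    ring
  have hsum : ∀ x, ∑ Q ∈ T, Q.indicator (fun _ => (volume Q)⁻¹ * σ Q ^ (1 / s - 1 / q) *
      ∫⁻ y in Q, φ y / dualDensity q w y ∂σ) x = ∑ Q ∈ T, Q.indicator (fun _ => (volume Q)⁻¹ *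
        (∫⁻ y in Q, dualDensity q w y) ^ (1 / s - 1 / q) * ∫⁻ y in Q, φ y) x := fun x =>
    Finset.sum_congr rfl fun Q hQ => by rw [h1 Q hQ, hσ Q (hTm Q hQ)]
  simp_rw [hsum] at h
  rw [h2, hWdef, lintegral_withDensity_eq_lintegral_mul _ hWm] at h
  · simpa only [Pi.mul_apply, mul_comm (ENNReal.ofReal _)] using h
  · exact (Finset.measurable_sum _ fun Q hQ =>
      measurable_const.indicator (hTm Q hQ)).pow_const q

end MuckenhouptWeights

section SparseCommutator

open scoped Classical

lemma sum_liminf_le_liminf_sum {ι : Type*} (s : Finset ι) (u : ι → ℕ → ℝ≥0∞) :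
    ∑ i ∈ s, liminf (u i) atTop ≤ liminf (fun n => ∑ i ∈ s, u i n) atTop := by
  simp_rw [liminf_eq_iSup_iInf_of_nat]
  rw [ENNReal.finsetSum_iSup_of_monotone fun i m n hmn =>
    le_iInf₂ fun k hk => iInf₂_le k (hmn.trans hk)]
  exact iSup_mono fun n => le_iInf₂ fun k hk => Finset.sum_le_sum fun i _ => iInf₂_le k hk

lemma rpow_liminf {q : ℝ} (hq : 0 < q) (u : ℕ → ℝ≥0∞) :
    liminf u atTop ^ q = liminf (fun n => u n ^ q) atTop :=
  (ENNReal.orderIsoRpow q hq).liminf_apply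

lemma rpow_iSup {ι : Sort*} {q : ℝ} (hq : 0 < q) (u : ι → ℝ≥0∞) :
    (⨆ i, u i) ^ q = ⨆ i, u i ^ q :=
  (ENNReal.orderIsoRpow q hq).map_iSup u

/-- Rearrangement of a localized sum of integrals. -/
lemma sum_mul_setLIntegral_le {X : Type*} [MeasurableSpace X] {m : Measure X}
    {T : Finset (Set X)} (hT : ∀ P ∈ T, MeasurableSet P) (c : Set X → ℝ≥0∞) {θ : X → ℝ≥0∞}
    (hθ : Measurable θ) (Q : Set X) :
    ∑ R ∈ T with R ⊆ Q, c R * ∫⁻ x in R, θ x ∂m ≤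
      ∫⁻ x in Q, θ x * ∑ P ∈ T, P.indicator (fun _ => c P) x ∂m := by
  calc ∑ R ∈ T with R ⊆ Q, c R * ∫⁻ x in R, θ x ∂m
      = ∑ R ∈ T with R ⊆ Q, ∫⁻ x in Q, R.indicator (fun x => c R * θ x) x ∂m := by
        refine Finset.sum_congr rfl fun R hR => ?_
        obtain ⟨hR1, hR2⟩ := Finset.mem_filter.1 hR
        rw [lintegral_indicator (hT R hR1), Measure.restrict_restrict (hT R hR1),
          inter_eq_left.2 hR2, lintegral_const_mul _ hθ]
    _ ≤ ∑ R ∈ T, ∫⁻ x in Q, R.indicator (fun x => c R * θ x) x ∂m :=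
        Finset.sum_le_sum_of_subset (Finset.filter_subset _ _)
    _ = ∫⁻ x in Q, ∑ R ∈ T, R.indicator (fun x => c R * θ x) x ∂m :=
        (lintegral_finsetSum _ fun R hR => (hθ.const_mul _).indicator (hT R hR)).symm
    _ = _ := by
        refine lintegral_congr fun x => ?_
        rw [Finset.mul_sum]
        refine Finset.sum_congr rfl fun R _ => ?_
        by_cases hx : x ∈ R <;> simp [hx, mul_comm]

lemma ofReal_avg_mul_abs_le (Q : Cube d) (b f : Rd d → ℝ) :
    ENNReal.ofReal (avg Q fun y => |b y - avg Q b| * |f y|) ≤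
      (volume Q.carrier)⁻¹ * ∫⁻ x in Q.carrier, ‖b x - avg Q b‖ₑ * ‖f x‖ₑ := by
  rw [avg, ENNReal.ofReal_mul (inv_nonneg.2 Q.vol_pos.le), ENNReal.ofReal_inv_of_pos Q.vol_pos,
    ← Q.volume_carrier, intC]
  gcongr
  refine (Real.ofReal_le_enorm _).trans ((enorm_integral_le_lintegral_enorm _).trans_eq ?_)
  simp [enorm_mul]

/-- The sparse commutator bound over finitely many cubes, given a function `φ` controlling the
local oscillation sums over every Carleson family. -/
lemma exists_finite_sparse_commutator_le (hd : 0 < d) {s q γ : ℝ} (hs : 1 < s) (hq : 1 < q)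
    (hsq : s ≤ q) (hγ : 0 < γ) : ∃ C : ℝ≥0∞, C ≠ ⊤ ∧ ∀ (D : DyadicLattice d) (w : Rd d → ℝ)
      (S : Set (Cube d)) (S₀ : Finset (Cube d)) (b f : Rd d → ℝ) (Z : ℝ≥0∞), IsApOn univ q w →
      S ⊆ D.cubes → SparseFamily γ (fun _ => 1) S → ↑S₀ ⊆ S → LocallyIntegrable b volume →
      Measurable f →
      (∀ T : Finset (Set (Rd d)), (∀ P ∈ T, P ∈ D.sets) →
        CarlesonFamily volume (2 * (1 + (ENNReal.ofReal γ)⁻¹)) T →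
        ∃ φ : Rd d → ℝ≥0∞, Measurable φ ∧
          (∀ Q : Cube d, ∑ R ∈ T with R ⊆ Q.carrier,
            lavg volume (fun x => ‖b x - ⨍ y in R, b y‖ₑ) R * ∫⁻ x in R, ‖f x‖ₑ ≤
              (∫⁻ y in Q.carrier, dualDensity q w y) ^ (1 / s - 1 / q) * ∫⁻ y in Q.carrier, φ y) ∧
          (∫⁻ x, φ x ^ s * dualDensity q w x ^ (1 - s)) ^ (1 / s) ≤ Z) →
      (∫⁻ x, (∑ Q ∈ S₀, Q.carrier.indicator (fun _ =>
        ENNReal.ofReal (avg Q fun y => |b y - avg Q b| * |f y|)) x) ^ q *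
          ENNReal.ofReal (w x)) ^ (1 / q) ≤
        C * ApCharOn univ q w ^ max (1 / conj s + 1 / q) (1 / (q - 1)) * Z := by
  have hγ' : ENNReal.ofReal γ ≠ 0 := (ENNReal.ofReal_pos.2 hγ).ne'
  have hq0 : 0 < q := by linarith
  obtain ⟨C, hC, H⟩ := exists_weighted_sparse_le (d := d) hs hq hsq (ENNReal.inv_ne_top.2 hγ')
  refine ⟨2 * 2 ^ d * C, by finiteness, fun D w S S₀ b f Z hw hSD hS hS₀ hb hf hφ => ?_⟩
  obtain ⟨T, hTD, hTC, hT⟩ := D.exists_augmentation hd hγ hS hSD hS₀ hb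
  choose φ hφm hφ1 hφ2 using fun n => hφ (T n) (hTD n) (hTC n)
  set K : ℝ≥0∞ := 2 * 2 ^ d with hK
  have hKt : K ≠ ⊤ := by finiteness
  let G : ℕ → Rd d → ℝ≥0∞ := fun n x => ∑ Q ∈ S₀, Q.carrier.indicator (fun _ =>
    (volume Q.carrier)⁻¹ * (∫⁻ y in Q.carrier, dualDensity q w y) ^ (1 / s - 1 / q) *
      ∫⁻ y in Q.carrier, φ n y) x
  have hGm : ∀ n, Measurable (G n) := fun n => Finset.measurable_sum _ fun Q _ =>
    measurable_const.indicator Q.measurableSet_carrier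
  have hcoef : ∀ Q ∈ S₀, ENNReal.ofReal (avg Q fun y => |b y - avg Q b| * |f y|) ≤
      liminf (fun n => K * ((volume Q.carrier)⁻¹ *
        (∫⁻ y in Q.carrier, dualDensity q w y) ^ (1 / s - 1 / q) * ∫⁻ y in Q.carrier, φ n y)) atTop := by
    intro Q hQ
    refine (ofReal_avg_mul_abs_le Q b f).trans ?_
    calc (volume Q.carrier)⁻¹ * ∫⁻ x in Q.carrier, ‖b x - avg Q b‖ₑ * ‖f x‖ₑ
        ≤ (volume Q.carrier)⁻¹ * liminf (fun n => K * ∑ R ∈ T n with R ⊆ Q.carrier,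
          lavg volume (fun x => ‖b x - ⨍ y in R, b y‖ₑ) R * ∫⁻ x in R, ‖f x‖ₑ) atTop := by
          gcongr
          exact hT Q hQ _ hf.enorm
      _ = liminf (fun n => (volume Q.carrier)⁻¹ * (K * ∑ R ∈ T n with R ⊆ Q.carrier,
          lavg volume (fun x => ‖b x - ⨍ y in R, b y‖ₑ) R * ∫⁻ x in R, ‖f x‖ₑ)) atTop :=
          (ENNReal.liminf_const_mul_of_ne_top
            (ENNReal.inv_ne_top.2 Q.volume_carrier_ne_zero)).symm
      _ ≤ _ := by
          refine liminf_le_liminf (Eventually.of_forall fun n => ?_)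
          calc _ ≤ (volume Q.carrier)⁻¹ * (K * ((∫⁻ y in Q.carrier, dualDensity q w y) ^ (1 / s - 1 / q) *
                ∫⁻ y in Q.carrier, φ n y)) := by gcongr; exact hφ1 n Q
            _ = _ := by ring
  have hpt : ∀ x, ∑ Q ∈ S₀, Q.carrier.indicator (fun _ =>
      ENNReal.ofReal (avg Q fun y => |b y - avg Q b| * |f y|)) x ≤
        liminf (fun n => K * G n x) atTop := by
    intro x
    calc _ ≤ ∑ Q ∈ S₀, liminf (fun n => K * Q.carrier.indicator (fun _ =>
          (volume Q.carrier)⁻¹ * (∫⁻ y in Q.carrier, dualDensity q w y) ^ (1 / s - 1 / q) *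
            ∫⁻ y in Q.carrier, φ n y) x) atTop := by
          refine Finset.sum_le_sum fun Q hQ => ?_
          by_cases hx : x ∈ Q.carrier
          · simpa only [indicator_of_mem hx] using hcoef Q hQ
          · simp [hx]
      _ ≤ _ := sum_liminf_le_liminf_sum _ _
      _ = _ := by simp only [G, Finset.mul_sum]
  have himg : ∀ n x, ∑ Q ∈ S₀.image Cube.carrier, Q.indicator (fun _ => (volume Q)⁻¹ *
      (∫⁻ y in Q, dualDensity q w y) ^ (1 / s - 1 / q) * ∫⁻ y in Q, φ n y) x = G n x := fun n x =>
    Finset.sum_image fun Q _ R _ h => Cube.carrier_injective hd h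
  have hGle : ∀ n, (∫⁻ x, G n x ^ q * ENNReal.ofReal (w x)) ^ (1 / q) ≤
      C * ApCharOn univ q w ^ max (1 / conj s + 1 / q) (1 / (q - 1)) * Z := by
    intro n
    have h := H D w (S₀.image Cube.carrier) (φ n) hw
      (fun P hP => by
        obtain ⟨Q, hQ, rfl⟩ := Finset.mem_image.1 hP
        exact ⟨Q, hSD (hS₀ hQ), rfl⟩)
      (fun R hR => by
        rw [Finset.filter_image, Finset.sum_image fun Q _ R _ h => Cube.carrier_injective hd h]
        exact hS.sum_volume_le hγ (fun Q hQ => hS₀ (Finset.mem_filter.1 hQ).1)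
          fun Q hQ => (Finset.mem_filter.1 hQ).2)
      (hφm n)
    simp only [himg n] at h
    exact h.trans (by gcongr; exact hφ2 n)
  have hKG : ∀ n, ∫⁻ x, (K * G n x) ^ q * ENNReal.ofReal (w x) ≤
      (K * (C * ApCharOn univ q w ^ max (1 / conj s + 1 / q) (1 / (q - 1)) * Z)) ^ q := by
    intro n
    simp_rw [ENNReal.mul_rpow_of_nonneg _ _ hq0.le, mul_assoc (K ^ q)]
    rw [lintegral_const_mul' _ _ (ENNReal.rpow_ne_top_of_nonneg hq0.le hKt)]
    gcongr
    rw [← ENNReal.mul_rpow_of_nonneg _ _ hq0.le, ← ENNReal.mul_rpow_of_nonneg _ _ hq0.le,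
      ← ENNReal.rpow_inv_le_iff hq0, inv_eq_one_div]
    exact hGle n
  rw [one_div, ENNReal.rpow_inv_le_iff hq0]
  calc _ ≤ ∫⁻ x, liminf (fun n => (K * G n x) ^ q * ENNReal.ofReal (w x)) atTop := by
        refine lintegral_mono fun x => ?_
        calc _ ≤ liminf (fun n => K * G n x) atTop ^ q * ENNReal.ofReal (w x) := by
              gcongr; exact hpt x
          _ ≤ _ := by
              rw [rpow_liminf hq0]
              have := ENNReal.le_liminf_mul (f := atTop) (u := fun n => (K * G n x) ^ q)
                (v := fun _ : ℕ => ENNReal.ofReal (w x))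
              rwa [liminf_const] at this
    _ ≤ liminf (fun n => ∫⁻ x, (K * G n x) ^ q * ENNReal.ofReal (w x)) atTop :=
        lintegral_liminf_le fun n => (((hGm n).const_mul _).pow_const _).mul
          hw.1.2.1.ennreal_ofReal
    _ ≤ liminf (fun _ : ℕ =>
          (K * (C * ApCharOn univ q w ^ max (1 / conj s + 1 / q) (1 / (q - 1)) * Z)) ^ q) atTop :=
        liminf_le_liminf (Eventually.of_forall hKG)
    _ = _ := by rw [liminf_const, hK]; simp only [mul_assoc, one_div]

/-- The sparse commutator bound, given a function `φ` controlling the local oscillation sums over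
every Carleson family. -/
lemma exists_sparseOpStar_le (hd : 0 < d) {s q γ : ℝ} (hs : 1 < s) (hq : 1 < q)
    (hsq : s ≤ q) (hγ : 0 < γ) : ∃ C : ℝ≥0∞, C ≠ ⊤ ∧ ∀ (D : DyadicLattice d) (w : Rd d → ℝ)
      (S : Set (Cube d)) (b f : Rd d → ℝ) (Z : ℝ≥0∞), IsApOn univ q w →
      S ⊆ D.cubes → SparseFamily γ (fun _ => 1) S → LocallyIntegrable b volume →
      Measurable f →
      (∀ T : Finset (Set (Rd d)), (∀ P ∈ T, P ∈ D.sets) →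
        CarlesonFamily volume (2 * (1 + (ENNReal.ofReal γ)⁻¹)) T →
        ∃ φ : Rd d → ℝ≥0∞, Measurable φ ∧
          (∀ Q : Cube d, ∑ R ∈ T with R ⊆ Q.carrier,
            lavg volume (fun x => ‖b x - ⨍ y in R, b y‖ₑ) R * ∫⁻ x in R, ‖f x‖ₑ ≤
              (∫⁻ y in Q.carrier, dualDensity q w y) ^ (1 / s - 1 / q) * ∫⁻ y in Q.carrier, φ y) ∧
          (∫⁻ x, φ x ^ s * dualDensity q w x ^ (1 - s)) ^ (1 / s) ≤ Z) →
      wnormE q w (sparseOpStar S b f) ≤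
        C * ApCharOn univ q w ^ max (1 / conj s + 1 / q) (1 / (q - 1)) * Z := by
  obtain ⟨C, hC, H⟩ := exists_finite_sparse_commutator_le hd hs hq hsq hγ
  have hq0 : 0 < q := by linarith
  refine ⟨C, hC, fun D w S b f Z hw hSD hS hb hf hφ => ?_⟩
  have hcount : Countable S := (D.countable_cubes.mono hSD).to_subtype
  rw [wnormE, one_div, ENNReal.rpow_inv_le_iff hq0]
  simp_rw [sparseOpStar, ENNReal.tsum_eq_iSup_sum, rpow_iSup hq0, ENNReal.iSup_mul]
  rw [lintegral_iSup_directed_of_measurable]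
  · refine iSup_le fun F => ?_
    rw [← ENNReal.rpow_inv_le_iff hq0, inv_eq_one_div]
    have h := H D w S (F.map (Function.Embedding.subtype _)) b f Z hw hSD hS (by simp) hb hf hφ
    simpa only [Finset.sum_map, Function.Embedding.subtype_apply] using h
  · exact fun F => ((Finset.measurable_sum _ fun Q _ =>
      measurable_const.indicator Q.1.measurableSet_carrier).pow_const _).mul
        hw.1.2.1.ennreal_ofReal
  · refine Monotone.directed_le fun F F' h x => ?_
    dsimp only
    gcongr

/-- The sharp bound for sparse operators on `L^p(w)`. -/
lemma exists_sparse_average_le {p : ℝ} (hp : 1 < p) {L : ℝ≥0∞} (hL : L ≠ ⊤) :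
    ∃ C : ℝ≥0∞, C ≠ ⊤ ∧ ∀ (D : DyadicLattice d) (w : Rd d → ℝ) (T : Finset (Set (Rd d)))
      (f : Rd d → ℝ), IsApOn univ p w → (∀ P ∈ T, P ∈ D.sets) → CarlesonFamily volume L T →
      Measurable f →
      (∫⁻ x, (∑ Q ∈ T, Q.indicator (fun _ => (volume Q)⁻¹ * ∫⁻ y in Q, ‖f y‖ₑ) x) ^ p *
        ENNReal.ofReal (w x)) ^ (1 / p) ≤
        C * ApCharOn univ p w ^ max 1 (1 / (p - 1)) * wnorm p w f := by
  obtain ⟨C, hC, H⟩ := exists_weighted_sparse_le (d := d) hp hp le_rfl hL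
  refine ⟨C, hC, fun D w T f hw hT hCar hf => ?_⟩
  have h := H D w T (fun x => ‖f x‖ₑ) hw hT hCar hf.enorm
  have h1 : 1 / conj p + 1 / p = 1 := by rw [one_div_conj hp]; ring
  have h2 : ∀ x, ‖f x‖ₑ ^ p * dualDensity p w x ^ (1 - p) =
      ENNReal.ofReal (|f x| ^ p * w x) := by
    intro x
    rw [dualDensity_rpow hp hw.1.1, ENNReal.ofReal_mul (by positivity),
      ← ENNReal.ofReal_rpow_of_nonneg (abs_nonneg _) (by linarith), ← Real.norm_eq_abs,
      ofReal_norm]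
    have : -((1 - p) / (p - 1)) = 1 := by
      have : p - 1 ≠ 0 := by linarith
      field_simp; ring
    rw [this, Real.rpow_one]
  simpa only [sub_self, ENNReal.rpow_zero, mul_one, h1, h2, wnorm] using h

end SparseCommutator

section BloomWeights

open scoped Classical

lemma lintegral_rpow_le_of_rpow_eq {X : Type*} [MeasurableSpace X] {m : Measure X}
    {h f g : X → ℝ≥0∞} (hf : Measurable f) (hg : Measurable g) {u v e : ℝ} (hu : 0 ≤ u)
    (hv : 0 ≤ v) (he : 0 < e) (huv : u + v = e) (hfg : ∀ x, h x ^ e = f x ^ u * g x ^ v) :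
    (∫⁻ x, h x ∂m) ^ e ≤ (∫⁻ x, f x ∂m) ^ u * (∫⁻ x, g x ∂m) ^ v := by
  have h1 : ∀ x, h x = f x ^ (u / e) * g x ^ (v / e) := by
    intro x
    rw [div_eq_mul_inv, div_eq_mul_inv, ENNReal.rpow_mul, ENNReal.rpow_mul,
      ← ENNReal.mul_rpow_of_nonneg _ _ (inv_nonneg.2 he.le), ← hfg, ENNReal.rpow_rpow_inv he.ne']
  have h2 := ENNReal.lintegral_mul_norm_pow_le (μ := m) hf.aemeasurable hg.aemeasurable
    (p := u / e) (q := v / e) (by positivity) (by positivity) (by field_simp; exact huv)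
  simp_rw [← h1] at h2
  calc (∫⁻ x, h x ∂m) ^ e ≤ ((∫⁻ x, f x ∂m) ^ (u / e) * (∫⁻ x, g x ∂m) ^ (v / e)) ^ e := by
        gcongr
    _ = _ := by
        rw [ENNReal.mul_rpow_of_nonneg _ _ he.le, ← ENNReal.rpow_mul, ← ENNReal.rpow_mul,
          div_mul_cancel₀ _ he.ne', div_mul_cancel₀ _ he.ne']

lemma bloom_exponent_pos {p q : ℝ} (hp : 1 < p) (hq : 1 < q) : 0 < 1 / p + 1 / conj q := by
  have : 0 < q - 1 := by linarith
  rw [conj]; positivity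

lemma bloom_measurable {p q : ℝ} (hp : 1 < p) (hq : 1 < q) {μ lam ν : Rd d → ℝ}
    (hμ : Measurable μ) (hlam : Measurable lam) (hν0 : ∀ x, 0 < ν x)
    (hν : ∀ x, ν x ^ (1 / p + 1 / conj q) = μ x ^ (1 / p) * lam x ^ (-(1 / q))) :
    Measurable ν := by
  have : ν = fun x => (μ x ^ (1 / p) * lam x ^ (-(1 / q))) ^ (1 / p + 1 / conj q)⁻¹ := by
    funext x
    rw [← hν, Real.rpow_rpow_inv (hν0 x).le (bloom_exponent_pos hp hq).ne']
  rw [this]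
  exact ((hμ.pow_const _).mul (hlam.pow_const _)).pow_const _

lemma ofReal_bloom_rpow {p q : ℝ} (hq : 1 < q) {μ lam ν : Rd d → ℝ}
    (hμ0 : ∀ x, 0 < μ x) (hlam0 : ∀ x, 0 < lam x) (hν0 : ∀ x, 0 < ν x)
    (hν : ∀ x, ν x ^ (1 / p + 1 / conj q) = μ x ^ (1 / p) * lam x ^ (-(1 / q))) (x : Rd d) :
    ENNReal.ofReal (ν x) ^ (1 / p + 1 / conj q) =
      ENNReal.ofReal (μ x) ^ (1 / p) * dualDensity q lam x ^ (1 / conj q) := by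
  rw [dualDensity_rpow hq hlam0, ENNReal.ofReal_rpow_of_pos (hν0 x),
    ENNReal.ofReal_rpow_of_pos (hμ0 x), hν, ENNReal.ofReal_mul (Real.rpow_nonneg (hμ0 x).le _),
    one_div_conj hq]
  have h1 : q - 1 ≠ 0 := by linarith
  have : (1 - 1 / q) / (q - 1) = 1 / q := by field_simp
  rw [this]

lemma bloom_setLIntegral_ne_top {p q : ℝ} (hp : 1 < p) (hq : 1 < q) {μ lam ν : Rd d → ℝ}
    (hμ : IsApOn univ p μ) (hlam : IsApOn univ q lam) (hν0 : ∀ x, 0 < ν x)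
    (hν : ∀ x, ν x ^ (1 / p + 1 / conj q) = μ x ^ (1 / p) * lam x ^ (-(1 / q))) (Q : Cube d) :
    ∫⁻ x in Q.carrier, ENNReal.ofReal (ν x) ≠ ⊤ := by
  have he := bloom_exponent_pos hp hq
  have hc : 0 ≤ 1 / conj q := by rw [one_div_conj hq]; simp [inv_le_one_of_one_le₀ hq.le]
  have hp0 : 0 ≤ 1 / p := by positivity
  have h := lintegral_rpow_le_of_rpow_eq (m := volume.restrict Q.carrier)
    hμ.1.2.1.ennreal_ofReal (measurable_dualDensity hlam.1.2.1) hp0 hc he rfl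
    (ofReal_bloom_rpow hq hμ.1.1 hlam.1.1 hν0 hν)
  intro htop
  rw [htop, ENNReal.top_rpow_of_pos he, top_le_iff] at h
  exact ENNReal.mul_ne_top (ENNReal.rpow_ne_top_of_nonneg hp0 (hμ.lintegral_ne Q).1.2)
    (ENNReal.rpow_ne_top_of_nonneg hc (hlam.lintegral_ne Q).2.2) h

lemma bloom_setLIntegral_rpow_le {p q : ℝ} (hp : 1 < p) (hq : 1 < q) (hpq : p ≤ q)
    {μ lam ν : Rd d → ℝ} (hμ : IsApOn univ p μ) (hlam : IsApOn univ q lam) (hν0 : ∀ x, 0 < ν x)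
    (hν : ∀ x, ν x ^ (1 / p + 1 / conj q) = μ x ^ (1 / p) * lam x ^ (-(1 / q))) (Q : Cube d) :
    (∫⁻ x in Q.carrier, ENNReal.ofReal (ν x)) ^ (1 / p + 1 / conj q) ≤
      (∫⁻ x in Q.carrier, ENNReal.ofReal (μ x) ^ (1 / p) * dualDensity q lam x ^ (1 / conj p)) *
        (∫⁻ x in Q.carrier, dualDensity q lam x) ^ (1 / p - 1 / q) := by
  have hσm := measurable_dualDensity (q := q) hlam.1.2.1
  have h := lintegral_rpow_le_of_rpow_eq (m := volume.restrict Q.carrier)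
    (h := fun x => ENNReal.ofReal (ν x))
    (f := fun x => ENNReal.ofReal (μ x) ^ (1 / p) * dualDensity q lam x ^ (1 / conj p))
    (g := dualDensity q lam) (u := 1) (v := 1 / p - 1 / q)
    ((hμ.1.2.1.ennreal_ofReal.pow_const _).mul (hσm.pow_const _)) hσm zero_le_one
    (sub_nonneg.2 (one_div_le_one_div_of_le (by linarith) hpq)) (bloom_exponent_pos hp hq)
    (by rw [one_div_conj hq]; ring)
    (fun x => by
      rw [ofReal_bloom_rpow hq hμ.1.1 hlam.1.1 hν0 hν, ENNReal.rpow_one, mul_assoc,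
        ← ENNReal.rpow_add _ _ (dualDensity_ne_zero hlam.1.1 x) (dualDensity_ne_top x),
        one_div_conj hq, one_div_conj hp]
      congr 2; ring)
  rwa [ENNReal.rpow_one] at h

lemma ofReal_wInt {ν : Rd d → ℝ} (hν0 : ∀ x, 0 < ν x) (hνm : Measurable ν) {Q : Cube d}
    (hQ : ∫⁻ x in Q.carrier, ENNReal.ofReal (ν x) ≠ ⊤) :
    ENNReal.ofReal (wInt Q ν) = ∫⁻ x in Q.carrier, ENNReal.ofReal (ν x) := by
  refine ofReal_integral_eq_lintegral_ofReal ⟨hνm.aestronglyMeasurable, ?_⟩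
    (Eventually.of_forall fun x => (hν0 x).le)
  rw [hasFiniteIntegral_iff_ofReal (Eventually.of_forall fun x => (hν0 x).le)]
  exact hQ.lt_top

lemma wInt_pos {ν : Rd d → ℝ} (hν0 : ∀ x, 0 < ν x) (hνm : Measurable ν) {Q : Cube d}
    (hQ : ∫⁻ x in Q.carrier, ENNReal.ofReal (ν x) ≠ ⊤) : 0 < wInt Q ν := by
  rw [← ENNReal.ofReal_pos, ofReal_wInt hν0 hνm hQ, pos_iff_ne_zero]
  exact setLIntegral_ne_zero_of_pos hνm.ennreal_ofReal
    (fun x => (ENNReal.ofReal_pos.2 (hν0 x)).ne') Q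

lemma ofReal_osc {b : Rd d → ℝ} (hb : LocallyIntegrable b volume) (Q : Cube d) :
    ENNReal.ofReal (osc Q b) = ∫⁻ x in Q.carrier, ‖b x - avg Q b‖ₑ :=
  ofReal_integral_norm_eq_lintegral_enorm
    ((Q.integrableOn hb).sub (integrableOn_const Q.volume_carrier_ne_top))

lemma lavg_mul_lintegral_eq {b : Rd d → ℝ} (hb : LocallyIntegrable b volume) (Q : Cube d)
    (I : ℝ≥0∞) : lavg volume (fun x => ‖b x - ⨍ y in Q.carrier, b y‖ₑ) Q.carrier * I =
      ENNReal.ofReal (osc Q b) * ((volume Q.carrier)⁻¹ * I) := by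
  rw [lavg, ofReal_osc hb, avg_eq_setAverage, div_eq_mul_inv, mul_assoc]

/-- A fractional sparse bound for the local oscillation sums of a function in `BMO_ν^α`. -/
lemma sum_oscillation_le_of_bmo {p q : ℝ} (hp : 1 < p) (hq : 1 < q) (hpq : p ≤ q)
    {μ lam ν : Rd d → ℝ} (hμ : IsApOn univ p μ) (hlam : IsApOn univ q lam) (hν0 : ∀ x, 0 < ν x)
    (hν : ∀ x, ν x ^ (1 / p + 1 / conj q) = μ x ^ (1 / p) * lam x ^ (-(1 / q)))
    {b : Rd d → ℝ} (hb : LocallyIntegrable b volume) {g : Rd d → ℝ≥0∞} {D : DyadicLattice d}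
    {T : Finset (Set (Rd d))} (hT : ∀ P ∈ T, P ∈ D.sets) (Q : Set (Rd d)) :
    ∑ R ∈ T with R ⊆ Q, lavg volume (fun x => ‖b x - ⨍ y in R, b y‖ₑ) R * ∫⁻ x in R, g x ≤
      (∫⁻ y in Q, dualDensity q lam y) ^ (1 / p - 1 / q) *
        ∫⁻ x in Q, bmoNormOn univ (1 / p + 1 / conj q) ν b *
          (ENNReal.ofReal (μ x) ^ (1 / p) * dualDensity q lam x ^ (1 / conj p)) *
            ∑ P ∈ T, P.indicator (fun _ => (volume P)⁻¹ * ∫⁻ y in P, g y) x := by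
  have he := bloom_exponent_pos hp hq
  have ha : 0 ≤ 1 / p - 1 / q := sub_nonneg.2 (one_div_le_one_div_of_le (by linarith) hpq)
  have hνm := bloom_measurable hp hq hμ.1.2.1 hlam.1.2.1 hν0 hν
  have hσm := measurable_dualDensity (q := q) hlam.1.2.1
  set B := bmoNormOn univ (1 / p + 1 / conj q) ν b with hB
  set η : Rd d → ℝ≥0∞ := fun x =>
    ENNReal.ofReal (μ x) ^ (1 / p) * dualDensity q lam x ^ (1 / conj p) with hη
  have hηm : Measurable η := (hμ.1.2.1.ennreal_ofReal.pow_const _).mul (hσm.pow_const _)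
  have hosc : ∀ R : Cube d, ENNReal.ofReal (osc R b) ≤ B * ((∫⁻ x in R.carrier, η x) *
      (∫⁻ x in R.carrier, dualDensity q lam x) ^ (1 / p - 1 / q)) := by
    intro R
    have hR := bloom_setLIntegral_ne_top hp hq hμ hlam hν0 hν R
    have hpos := wInt_pos hν0 hνm hR
    have h1 : ENNReal.ofReal (osc R b / wInt R ν ^ (1 / p + 1 / conj q)) ≤ B :=
      le_iSup₂_of_le (f := fun (R : Cube d) (_ : R ∈ univ) =>
        ENNReal.ofReal (osc R b / wInt R ν ^ (1 / p + 1 / conj q))) R (mem_univ R) le_rfl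
    rw [ENNReal.ofReal_div_of_pos (Real.rpow_pos_of_pos hpos _),
      ← ENNReal.ofReal_rpow_of_pos hpos, ofReal_wInt hν0 hνm hR] at h1
    refine (ENNReal.div_le_iff_le_mul (Or.inl ?_) (Or.inl ?_)).1 h1 |>.trans ?_
    · rw [← ofReal_wInt hν0 hνm hR, ENNReal.ofReal_rpow_of_pos hpos]
      exact (ENNReal.ofReal_pos.2 (Real.rpow_pos_of_pos hpos _)).ne'
    · exact ENNReal.rpow_ne_top_of_nonneg he.le hR
    · gcongr
      exact bloom_setLIntegral_rpow_le hp hq hpq hμ hlam hν0 hν R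
  calc ∑ R ∈ T with R ⊆ Q, lavg volume (fun x => ‖b x - ⨍ y in R, b y‖ₑ) R * ∫⁻ x in R, g x
      ≤ ∑ R ∈ T with R ⊆ Q, (∫⁻ y in Q, dualDensity q lam y) ^ (1 / p - 1 / q) *
          (((volume R)⁻¹ * ∫⁻ y in R, g y) * ∫⁻ x in R, B * η x) := by
        refine Finset.sum_le_sum fun R hR => ?_
        obtain ⟨hR1, hR2⟩ := Finset.mem_filter.1 hR
        obtain ⟨R, -, rfl⟩ := hT R hR1
        rw [lavg_mul_lintegral_eq hb, lintegral_const_mul _ hηm]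
        calc _ ≤ B * ((∫⁻ x in R.carrier, η x) *
              (∫⁻ y in Q, dualDensity q lam y) ^ (1 / p - 1 / q)) *
                ((volume R.carrier)⁻¹ * ∫⁻ y in R.carrier, g y) := by
              gcongr
              refine (hosc R).trans ?_
              gcongr
          _ = _ := by ring
    _ ≤ (∫⁻ y in Q, dualDensity q lam y) ^ (1 / p - 1 / q) * ∫⁻ x in Q, B * η x *
          ∑ P ∈ T, P.indicator (fun _ => (volume P)⁻¹ * ∫⁻ y in P, g y) x := by
        rw [← Finset.mul_sum]
        gcongr
        exact sum_mul_setLIntegral_le (fun P hP => D.measurableSet (hT P hP)) _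
          (hηm.const_mul B) Q

/-- The maximal function of the normalized oscillations over a finite family of sets. -/
def oscMax (ν b : Rd d → ℝ) (T : Finset (Set (Rd d))) (x : Rd d) : ℝ≥0∞ :=
  ⨆ P ∈ T, P.indicator (fun _ => (∫⁻ y in P, ‖b y - ⨍ z in P, b z‖ₑ) /
    ∫⁻ y in P, ENNReal.ofReal (ν y)) x

lemma measurable_oscMax (ν b : Rd d → ℝ) {T : Finset (Set (Rd d))}
    (hT : ∀ P ∈ T, MeasurableSet P) : Measurable (oscMax ν b T) :=
  Measurable.biSup (T : Set (Set (Rd d))) T.countable_toSet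
    fun P hP => measurable_const.indicator (hT P hP)

lemma oscMax_le_sharpMaxOn {ν b : Rd d → ℝ} (hb : LocallyIntegrable b volume)
    (hν0 : ∀ x, 0 < ν x) (hνm : Measurable ν)
    (hνQ : ∀ Q : Cube d, ∫⁻ x in Q.carrier, ENNReal.ofReal (ν x) ≠ ⊤) {D : DyadicLattice d}
    {T : Finset (Set (Rd d))} (hT : ∀ P ∈ T, P ∈ D.sets) (x : Rd d) :
    oscMax ν b T x ≤ sharpMaxOn univ ν b x := by
  refine iSup₂_le fun P hP => ?_
  by_cases hx : x ∈ P
  · rw [indicator_of_mem hx]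
    obtain ⟨Q, -, rfl⟩ := hT P hP
    rw [← avg_eq_setAverage, ← ofReal_osc hb, ← ofReal_wInt hν0 hνm (hνQ Q),
      ← ENNReal.ofReal_div_of_pos (wInt_pos hν0 hνm (hνQ Q))]
    exact le_iSup₂_of_le (f := fun (Q : Cube d) (_ : Q ∈ univ) => ⨆ _ : x ∈ Q.carrier,
      ENNReal.ofReal (osc Q b / wInt Q ν)) Q (mem_univ Q) (le_iSup_of_le hx le_rfl)
  · simp [hx]

/-- A sparse bound for the local oscillation sums in terms of the maximal oscillation. -/
lemma sum_oscillation_le_of_oscMax {ν b : Rd d → ℝ} (hν0 : ∀ x, 0 < ν x) (hνm : Measurable ν)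
    (hνQ : ∀ Q : Cube d, ∫⁻ x in Q.carrier, ENNReal.ofReal (ν x) ≠ ⊤) {g : Rd d → ℝ≥0∞}
    {D : DyadicLattice d} {T : Finset (Set (Rd d))} (hT : ∀ P ∈ T, P ∈ D.sets)
    (Q : Set (Rd d)) :
    ∑ R ∈ T with R ⊆ Q, lavg volume (fun x => ‖b x - ⨍ y in R, b y‖ₑ) R * ∫⁻ x in R, g x ≤
      ∫⁻ x in Q, oscMax ν b T x * ENNReal.ofReal (ν x) *
        ∑ P ∈ T, P.indicator (fun _ => (volume P)⁻¹ * ∫⁻ y in P, g y) x := by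
  set M : Set (Rd d) → ℝ≥0∞ := fun P => (∫⁻ y in P, ‖b y - ⨍ z in P, b z‖ₑ) /
    ∫⁻ y in P, ENNReal.ofReal (ν y) with hM
  calc ∑ R ∈ T with R ⊆ Q, lavg volume (fun x => ‖b x - ⨍ y in R, b y‖ₑ) R * ∫⁻ x in R, g x
      = ∑ R ∈ T with R ⊆ Q, M R * ((volume R)⁻¹ * ∫⁻ y in R, g y) *
          ∫⁻ x in R, ENNReal.ofReal (ν x) := by
        refine Finset.sum_congr rfl fun R hR => ?_
        obtain ⟨R, -, rfl⟩ := hT R (Finset.mem_filter.1 hR).1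
        have h0 : ∫⁻ x in R.carrier, ENNReal.ofReal (ν x) ≠ 0 :=
          setLIntegral_ne_zero_of_pos hνm.ennreal_ofReal
            (fun x => (ENNReal.ofReal_pos.2 (hν0 x)).ne') R
        have h1 : M R.carrier * ∫⁻ x in R.carrier, ENNReal.ofReal (ν x) =
            ∫⁻ y in R.carrier, ‖b y - ⨍ z in R.carrier, b z‖ₑ :=
          ENNReal.div_mul_cancel h0 (hνQ R)
        rw [lavg, ← h1, div_eq_mul_inv]
        ring
    _ ≤ ∫⁻ x in Q, ENNReal.ofReal (ν x) *
          ∑ P ∈ T, P.indicator (fun _ => M P * ((volume P)⁻¹ * ∫⁻ y in P, g y)) x :=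
        sum_mul_setLIntegral_le (fun P hP => D.measurableSet (hT P hP)) _
          hνm.ennreal_ofReal Q
    _ ≤ _ := by
        refine lintegral_mono fun x => ?_
        rw [mul_comm (oscMax ν b T x), mul_assoc]
        gcongr ENNReal.ofReal (ν x) * ?_
        rw [Finset.mul_sum]
        refine Finset.sum_le_sum fun P hP => ?_
        by_cases hx : x ∈ P
        · simp only [indicator_of_mem hx]
          gcongr
          refine le_trans (le_of_eq ?_) (le_iSup₂ (f := fun P (_ : P ∈ T) =>
            P.indicator (fun _ => M P) x) P hP)
          rw [indicator_of_mem hx]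
        · simp [hx]

/-- Hölder's inequality for the three weights in the lower triangular Bloom setting. -/
lemma bloom_holder {p q r : ℝ} (hp : 1 < p) (hq : 1 < q) (hqp : q < p)
    (hr : 1 / r = 1 / q - 1 / p) {μ lam ν : Rd d → ℝ} (hμ0 : ∀ x, 0 < μ x)
    (hμm : Measurable μ) (hlam0 : ∀ x, 0 < lam x) (hν0 : ∀ x, 0 < ν x) (hνm : Measurable ν)
    (hν : ∀ x, ν x ^ (1 / p + 1 / conj q) = μ x ^ (1 / p) * lam x ^ (-(1 / q)))
    {m F : Rd d → ℝ≥0∞} (hm : Measurable m) (hF : Measurable F) :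
    (∫⁻ x, (m x * ENNReal.ofReal (ν x) * F x) ^ q * ENNReal.ofReal (lam x)) ^ (1 / q) ≤
      wnormE r ν m * wnormE p μ F := by
  have hp0 : 0 < p := by linarith
  have hq0 : 0 < q := by linarith
  have hr0 : 0 < r := by
    rw [← one_div_pos, hr, sub_pos]
    exact one_div_lt_one_div_of_lt hq0 hqp
  have hsum : q / r + q / p = 1 := by
    rw [div_eq_mul_one_div q r, hr]; field_simp; ring
  have hpt : ∀ x, (m x * ENNReal.ofReal (ν x) * F x) ^ q * ENNReal.ofReal (lam x) =
      (m x ^ r * ENNReal.ofReal (ν x)) ^ (q / r) *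
        (F x ^ p * ENNReal.ofReal (μ x)) ^ (q / p) := by
    intro x
    have h1 : ν x ^ q * lam x = ν x ^ (q / r) * μ x ^ (q / p) := by
      have h2 : ν x ^ q = ν x ^ (q / r) * (ν x ^ (1 / p + 1 / conj q)) ^ q := by
        rw [← Real.rpow_mul (hν0 x).le, ← Real.rpow_add (hν0 x), one_div_conj hq]
        congr 1
        rw [div_eq_mul_one_div q r, hr]; ring
      rw [h2, hν, Real.mul_rpow (Real.rpow_nonneg (hμ0 x).le _)
        (Real.rpow_nonneg (hlam0 x).le _), ← Real.rpow_mul (hμ0 x).le,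
        ← Real.rpow_mul (hlam0 x).le]
      have h3 : -(1 / q) * q = -1 := by field_simp
      rw [h3, Real.rpow_neg_one, one_div_mul_eq_div, mul_assoc, mul_assoc,
        inv_mul_cancel₀ (hlam0 x).ne', mul_one]
    have h4 : ENNReal.ofReal (ν x) ^ q * ENNReal.ofReal (lam x) =
        ENNReal.ofReal (ν x) ^ (q / r) * ENNReal.ofReal (μ x) ^ (q / p) := by
      rw [ENNReal.ofReal_rpow_of_pos (hν0 x), ENNReal.ofReal_rpow_of_pos (hν0 x),
        ENNReal.ofReal_rpow_of_pos (hμ0 x),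
        ← ENNReal.ofReal_mul (Real.rpow_nonneg (hν0 x).le _),
        ← ENNReal.ofReal_mul (Real.rpow_nonneg (hν0 x).le _), h1]
    rw [ENNReal.mul_rpow_of_nonneg _ _ hq0.le, ENNReal.mul_rpow_of_nonneg _ _ hq0.le,
      ENNReal.mul_rpow_of_nonneg _ _ (by positivity),
      ENNReal.mul_rpow_of_nonneg _ _ (by positivity), ← ENNReal.rpow_mul, ← ENNReal.rpow_mul,
      mul_div_cancel₀ _ hr0.ne', mul_div_cancel₀ _ hp0.ne']
    calc _ = m x ^ q * F x ^ q * (ENNReal.ofReal (ν x) ^ q * ENNReal.ofReal (lam x)) := by ring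
      _ = _ := by rw [h4]; ring
  simp_rw [hpt]
  refine (ENNReal.rpow_le_rpow (ENNReal.lintegral_mul_norm_pow_le
    ((hm.pow_const _).mul hνm.ennreal_ofReal).aemeasurable
    ((hF.pow_const _).mul hμm.ennreal_ofReal).aemeasurable (by positivity) (by positivity) hsum)
    (by positivity)).trans_eq ?_
  rw [ENNReal.mul_rpow_of_nonneg _ _ (by positivity), ← ENNReal.rpow_mul, ← ENNReal.rpow_mul,
    wnormE, wnormE]
  congr 2 <;> field_simp

end BloomWeights

section BloomBounds

/-- The Bloom bound for the sparse commutator operator in the range `p ≤ q`. -/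
lemma exists_sparseOpStar_le_bmo (hd : 0 < d) {p q γ : ℝ} (hp : 1 < p) (hq : 1 < q)
    (hpq : p ≤ q) (hγ : 0 < γ) : ∃ C : ℝ≥0∞, C ≠ ⊤ ∧ ∀ μ lam ν : Rd d → ℝ,
      IsApOn univ p μ → IsApOn univ q lam → (∀ x, 0 < ν x) →
      (∀ x, ν x ^ (1 / p + 1 / conj q) = μ x ^ (1 / p) * lam x ^ (-(1 / q))) →
      ∀ (D : DyadicLattice d) (S : Set (Cube d)), S ⊆ D.cubes → SparseFamily γ (fun _ => 1) S →
      ∀ b : Rd d → ℝ, L1loc b → ∀ f : Rd d → ℝ, Measurable f →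
      wnormE q lam (sparseOpStar S b f) ≤ C * ApCharOn univ p μ ^ max 1 (1 / (p - 1)) *
        ApCharOn univ q lam ^ max (1 / conj p + 1 / q) (1 / (q - 1)) *
        bmoNormOn univ (1 / p + 1 / conj q) ν b * wnorm p μ f := by
  have hL : 2 * (1 + (ENNReal.ofReal γ)⁻¹) ≠ ⊤ := by
    have := ENNReal.inv_ne_top.2 (ENNReal.ofReal_pos.2 hγ).ne'
    finiteness
  obtain ⟨C₁, hC₁, H₁⟩ := exists_sparseOpStar_le hd hp hq hpq hγ
  obtain ⟨C₂, hC₂, H₂⟩ := exists_sparse_average_le (d := d) hp hL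
  have hp0 : 0 < p := by linarith
  refine ⟨C₁ * C₂, by finiteness, fun μ lam ν hμ hlam hν0 hν D S hSD hS b hb f hf => ?_⟩
  have hμm : Measurable fun x => ENNReal.ofReal (μ x) := hμ.1.2.1.ennreal_ofReal
  have hσm := measurable_dualDensity (q := q) hlam.1.2.1
  set B := bmoNormOn univ (1 / p + 1 / conj q) ν b with hB
  refine (H₁ D lam S b f (B * (C₂ * ApCharOn univ p μ ^ max 1 (1 / (p - 1)) * wnorm p μ f)) hlam
    hSD hS hb.2 hf fun T hTD hTC => ?_).trans_eq (by ring)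
  have hFm : Measurable fun x =>
      ∑ P ∈ T, P.indicator (fun _ => (volume P)⁻¹ * ∫⁻ y in P, ‖f y‖ₑ) x :=
    Finset.measurable_sum _ fun P hP => measurable_const.indicator (D.measurableSet (hTD P hP))
  refine ⟨_, ((((hμm.pow_const _).mul (hσm.pow_const _)).const_mul _).mul hFm),
    fun Q => sum_oscillation_le_of_bmo hp hq hpq hμ hlam hν0 hν hb.2 hTD Q.carrier, ?_⟩
  have hpt : ∀ x, (B * (ENNReal.ofReal (μ x) ^ (1 / p) * dualDensity q lam x ^ (1 / conj p)) *
      ∑ P ∈ T, P.indicator (fun _ => (volume P)⁻¹ * ∫⁻ y in P, ‖f y‖ₑ) x) ^ p *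
        dualDensity q lam x ^ (1 - p) =
      B ^ p * ((∑ P ∈ T, P.indicator (fun _ => (volume P)⁻¹ * ∫⁻ y in P, ‖f y‖ₑ) x) ^ p *
        ENNReal.ofReal (μ x)) := by
    intro x
    have h1 : dualDensity q lam x ^ (1 / conj p * p) * dualDensity q lam x ^ (1 - p) = 1 := by
      rw [← ENNReal.rpow_add _ _ (dualDensity_ne_zero hlam.1.1 x) (dualDensity_ne_top x),
        one_div_conj hp]
      have : (1 - 1 / p) * p + (1 - p) = 0 := by field_simp; ring
      rw [this, ENNReal.rpow_zero]
    rw [ENNReal.mul_rpow_of_nonneg _ _ hp0.le, ENNReal.mul_rpow_of_nonneg _ _ hp0.le,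
      ENNReal.mul_rpow_of_nonneg _ _ hp0.le, ← ENNReal.rpow_mul, ← ENNReal.rpow_mul,
      one_div_mul_cancel hp0.ne', ENNReal.rpow_one]
    set F := ∑ P ∈ T, P.indicator (fun _ => (volume P)⁻¹ * ∫⁻ y in P, ‖f y‖ₑ) x
    calc _ = B ^ p * (F ^ p * ENNReal.ofReal (μ x)) *
          (dualDensity q lam x ^ (1 / conj p * p) * dualDensity q lam x ^ (1 - p)) := by ring
      _ = _ := by rw [h1, mul_one]
  have hFμ : Measurable fun x =>
      (∑ P ∈ T, P.indicator (fun _ => (volume P)⁻¹ * ∫⁻ y in P, ‖f y‖ₑ) x) ^ p *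
        ENNReal.ofReal (μ x) := (hFm.pow_const _).mul hμm
  refine (congrArg (fun t : ℝ≥0∞ => t ^ (1 / p)) (lintegral_congr hpt)).trans_le ?_
  beta_reduce
  rw [lintegral_const_mul _ hFμ,
    ENNReal.mul_rpow_of_nonneg _ _ (by positivity), ← ENNReal.rpow_mul, mul_one_div_cancel hp0.ne',
    ENNReal.rpow_one]
  gcongr
  exact H₂ D μ T f hμ hTD hTC hf

/-- The Bloom bound for the sparse commutator operator in the range `q < p`. -/
lemma exists_sparseOpStar_le_sharp (hd : 0 < d) {p q r γ : ℝ} (hp : 1 < p) (hq : 1 < q)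
    (hqp : q < p) (hr : 1 / r = 1 / q - 1 / p) (hγ : 0 < γ) : ∃ C : ℝ≥0∞, C ≠ ⊤ ∧
      ∀ μ lam ν : Rd d → ℝ, IsApOn univ p μ → IsApOn univ q lam → (∀ x, 0 < ν x) →
      (∀ x, ν x ^ (1 / p + 1 / conj q) = μ x ^ (1 / p) * lam x ^ (-(1 / q))) →
      ∀ (D : DyadicLattice d) (S : Set (Cube d)), S ⊆ D.cubes → SparseFamily γ (fun _ => 1) S →
      ∀ b : Rd d → ℝ, L1loc b → ∀ f : Rd d → ℝ, Measurable f →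
      wnormE q lam (sparseOpStar S b f) ≤ C * ApCharOn univ p μ ^ max 1 (1 / (p - 1)) *
        ApCharOn univ q lam ^ max 1 (1 / (q - 1)) * sharpNormOn univ r ν b * wnorm p μ f := by
  have hL : 2 * (1 + (ENNReal.ofReal γ)⁻¹) ≠ ⊤ := by
    have := ENNReal.inv_ne_top.2 (ENNReal.ofReal_pos.2 hγ).ne'
    finiteness
  obtain ⟨C₁, hC₁, H₁⟩ := exists_sparseOpStar_le hd hq hq le_rfl hγ
  obtain ⟨C₂, hC₂, H₂⟩ := exists_sparse_average_le (d := d) hp hL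
  have hq0 : 0 < q := by linarith
  have hr0 : 0 < r := by
    rw [← one_div_pos, hr, sub_pos]
    exact one_div_lt_one_div_of_lt hq0 hqp
  have hexp : 1 / conj q + 1 / q = 1 := by rw [one_div_conj hq]; ring
  rw [hexp] at H₁
  refine ⟨C₁ * C₂, by finiteness, fun μ lam ν hμ hlam hν0 hν D S hSD hS b hb f hf => ?_⟩
  have hνm := bloom_measurable hp hq hμ.1.2.1 hlam.1.2.1 hν0 hν
  have hνQ := bloom_setLIntegral_ne_top hp hq hμ hlam hν0 hν
  refine (H₁ D lam S b f (sharpNormOn univ r ν b *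
    (C₂ * ApCharOn univ p μ ^ max 1 (1 / (p - 1)) * wnorm p μ f)) hlam
    hSD hS hb.2 hf fun T hTD hTC => ?_).trans_eq (by ring)
  have hTm : ∀ P ∈ T, MeasurableSet P := fun P hP => D.measurableSet (hTD P hP)
  have hFm : Measurable fun x =>
      ∑ P ∈ T, P.indicator (fun _ => (volume P)⁻¹ * ∫⁻ y in P, ‖f y‖ₑ) x :=
    Finset.measurable_sum _ fun P hP => measurable_const.indicator (hTm P hP)
  refine ⟨_, (((measurable_oscMax ν b hTm).mul hνm.ennreal_ofReal).mul hFm), fun Q => ?_, ?_⟩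
  · rw [sub_self, ENNReal.rpow_zero, one_mul]
    exact sum_oscillation_le_of_oscMax hν0 hνm hνQ hTD Q.carrier
  have hdual : ∀ x, dualDensity q lam x ^ (1 - q) = ENNReal.ofReal (lam x) := by
    intro x
    have h1 : -((1 - q) / (q - 1)) = 1 := by
      have : q - 1 ≠ 0 := by linarith
      field_simp; ring
    rw [dualDensity_rpow hq hlam.1.1, h1, Real.rpow_one]
  simp_rw [hdual]
  refine (bloom_holder hp hq hqp hr hμ.1.1 hμ.1.2.1 hlam.1.1 hν0 hνm hν
    (measurable_oscMax ν b hTm) hFm).trans ?_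
  refine mul_le_mul' ?_ (H₂ D μ T f hμ hTD hTC hf)
  rw [sharpNormOn, wnormE, wnormE]
  gcongr with x
  exact oscMax_le_sharpMaxOn hb.2 hν0 hνm hνQ hTD x

end BloomBounds

/-- **Proposition 3.3** (Bloom estimate for the sparse operator `𝒜^⋆_{S,b}`). For
`μ ∈ A_p`, `λ ∈ A_q`, the Bloom weight `ν`, and any `γ`-sparse collection `S` of dyadic
cubes, `‖𝒜^⋆_{S,b}‖_{L^p(μ)→L^q(λ)} ≲ [μ]_{A_p}^{max(1,1/(p−1))}` times
`[λ]_{A_q}^{max(1/p'+1/q,1/(q−1))} ‖b‖_{BMO_ν^α}` if `p ≤ q`, respectively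
`[λ]_{A_q}^{max(1,1/(q−1))} ‖M_ν^♯ b‖_{L^r(ν)}` if `p > q`. -/
theorem stmt3 (d : ℕ) (hd : 0 < d) (p q r α γ : ℝ) (hp : 1 < p) (hq : 1 < q)
    (hr : 1 / r = 1 / q - 1 / p) (hα : α / d = 1 / p - 1 / q)
    (hγ : 0 < γ) (hγ1 : γ < 1) :
    ∃ C : ℝ, 0 < C ∧
      ∀ μ lam ν : Rd d → ℝ, IsApOn Set.univ p μ → IsApOn Set.univ q lam →
        (∀ x, 0 < ν x) →
        (∀ x, ν x ^ (1 / p + 1 / conj q) = μ x ^ (1 / p) * lam x ^ (-(1 / q))) →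
        ∀ (D : DyadicLattice d) (S : Set (Cube d)), S ⊆ D.cubes →
          SparseFamily γ (fun _ => 1) S →
          ∀ b : Rd d → ℝ, L1loc b →
            ∀ f : Rd d → ℝ, Measurable f →
              (p ≤ q →
                wnormE q lam (sparseOpStar S b f) ≤
                  ENNReal.ofReal C * ApCharOn Set.univ p μ ^ max 1 (1 / (p - 1)) *
                    ApCharOn Set.univ q lam ^ max (1 / conj p + 1 / q) (1 / (q - 1)) *
                    bmoNormOn Set.univ (1 + α / d) ν b * wnorm p μ f) ∧
              (q < p →
                wnormE q lam (sparseOpStar S b f) ≤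
                  ENNReal.ofReal C * ApCharOn Set.univ p μ ^ max 1 (1 / (p - 1)) *
                    ApCharOn Set.univ q lam ^ max 1 (1 / (q - 1)) *
                    sharpNormOn Set.univ r ν b * wnorm p μ f) := by
  have hle : ∀ {C : ℝ≥0∞}, C ≠ ⊤ → C ≤ ENNReal.ofReal (C.toReal + 1) := fun hC =>
    (ENNReal.ofReal_toReal hC).symm.le.trans (ENNReal.ofReal_le_ofReal (by linarith))
  rcases le_or_gt p q with hpq | hqp
  · obtain ⟨C, hC, H⟩ := exists_sparseOpStar_le_bmo hd hp hq hpq hγ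
    refine ⟨C.toReal + 1, by positivity, fun μ lam ν hμ hlam hν0 hν D S hSD hS b hb f hf =>
      ⟨fun _ => ?_, fun h => absurd h hpq.not_gt⟩⟩
    have he : 1 + α / d = 1 / p + 1 / conj q := by rw [hα, one_div_conj hq]; ring
    rw [he]
    refine (H μ lam ν hμ hlam hν0 hν D S hSD hS b hb f hf).trans ?_
    gcongr
    exact hle hC
  · obtain ⟨C, hC, H⟩ := exists_sparseOpStar_le_sharp hd hp hq hqp hr hγ
    refine ⟨C.toReal + 1, by positivity, fun μ lam ν hμ hlam hν0 hν D S hSD hS b hb f hf =>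
      ⟨fun h => absurd h hqp.not_ge, fun _ => ?_⟩⟩
    refine (H μ lam ν hμ hlam hν0 hν D S hSD hS b hb f hf).trans ?_
    gcongr
    exact hle hC
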